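/- Let r ≥ 1 be an integer and let N be a positive integer satisfying the three conditions: d_N ≥ e^{11.2}, p_N^{1/2 − 1/log d_N} ≥ 2^r, and (0.655/(π·e))·√(d_N)/log(d_N) ≥ 2^{r(N−1)}. Then there is at most one fundamental discriminant D < 0 with |D| ≥ d_N such that the exponent E(D) of the class group Cl(D) equals 2^r. -/

import Mathlib

open NumberField

/-- `D` is a fundamental discriminant: either `D ≡ 1 (mod 4)` and `D` is squarefree,
or `D = 4m` for a squarefree integer `m ≡ 2` or `3 (mod 4)`. (We exclude the degenerate
case `D = 1`, so that `D` is the discriminant of a quadratic number field.) -/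
def IsFundamentalDiscriminant (D : ℤ) : Prop :=
  D ≠ 1 ∧ ((D % 4 = 1 ∧ Squarefree D) ∨
    ∃ m : ℤ, D = 4 * m ∧ Squarefree m ∧ (m % 4 = 2 ∨ m % 4 = 3))

/-- `d n`: the product of the first `n` prime numbers. -/
noncomputable def primesProd (n : ℕ) : ℕ := ∏ i ∈ Finset.range n, Nat.nth Nat.Prime i

section

open Filter Topology MeasureTheory Set Asymptotics

/-- Summatory function of an arithmetic sequence. -/
noncomputable def partialSum (b : ℕ → ℝ) (y : ℝ) : ℝ := ∑ n ∈ Finset.Ioc 0 ⌊y⌋₊, b n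

lemma measurable_partialSum (b : ℕ → ℝ) : Measurable (partialSum b) :=
  (measurable_from_nat (f := fun N : ℕ ↦ ∑ n ∈ Finset.Ioc 0 N, b n)).comp Nat.measurable_floor

/-- `∫₁^∞ E(y) y^{-s-1} dy`. -/
noncomputable def tailTransform (E : ℝ → ℝ) (s : ℂ) : ℂ :=
  ∫ y in Ioi (1 : ℝ), (E y : ℂ) * (y : ℂ) ^ (-s - 1)

lemma tailTransform_eq_mellin (E : ℝ → ℝ) (s : ℂ) :
    tailTransform E s = mellin ((Ioi (1 : ℝ)).indicator fun y ↦ (E y : ℂ)) (-s) := by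
  rw [tailTransform, mellin]
  have h : ∀ y : ℝ, (y : ℂ) ^ (-s - 1) • (Ioi (1 : ℝ)).indicator (fun y ↦ (E y : ℂ)) y =
      (Ioi (1 : ℝ)).indicator (fun y ↦ (E y : ℂ) * (y : ℂ) ^ (-s - 1)) y := by
    intro y
    by_cases hy : y ∈ Ioi (1 : ℝ) <;> simp [hy, mul_comm]
  simp_rw [h]
  rw [setIntegral_indicator measurableSet_Ioi]
  congr 2
  ext y
  simp only [mem_Ioi, mem_inter_iff]
  exact ⟨fun h ↦ ⟨by linarith, h⟩, fun h ↦ h.2⟩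

lemma differentiableAt_tailTransform {E : ℝ → ℝ} (hE : Measurable E) {C θ : ℝ} (hθ : 0 ≤ θ)
    (hb : ∀ y, 1 ≤ y → |E y| ≤ C * y ^ θ) {s : ℂ} (hs : θ < s.re) :
    DifferentiableAt ℂ (tailTransform E) s := by
  have key : DifferentiableAt ℂ (mellin ((Ioi (1 : ℝ)).indicator fun y ↦ (E y : ℂ))) (-s) := by
    refine mellin_differentiableAt_of_isBigO_rpow (a := -θ) (b := -s.re - 1) ?_ ?_ ?_ ?_ ?_
    · have h1 : LocallyIntegrable (fun y : ℝ ↦ C * (max 1 y) ^ θ) := by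
        refine Continuous.locallyIntegrable ?_
        refine continuous_const.mul (Continuous.rpow_const (by fun_prop) fun y ↦ Or.inr hθ)
      refine LocallyIntegrable.locallyIntegrableOn (h1.mono ?_ (Eventually.of_forall fun y ↦ ?_)) _
      · exact (((Complex.measurable_ofReal.comp hE)).indicator measurableSet_Ioi).aestronglyMeasurable
      · have hC : 0 ≤ C := by
          have := (abs_nonneg _).trans (hb 1 le_rfl)
          simpa using this
        by_cases hy : y ∈ Ioi (1 : ℝ)
        · simp only [hy, indicator_of_mem, Complex.norm_real, Real.norm_eq_abs]
          rw [max_eq_right (le_of_lt hy)]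
          exact (hb y (le_of_lt hy)).trans (le_abs_self _)
        · simp only [hy, not_false_eq_true, indicator_of_notMem, norm_zero]
          exact norm_nonneg _
    · refine IsBigO.of_bound C ?_
      filter_upwards [eventually_gt_atTop 1] with y hy
      simp only [mem_Ioi, hy, indicator_of_mem, Complex.norm_real, Real.norm_eq_abs, neg_neg]
      rw [abs_of_nonneg (Real.rpow_nonneg (by linarith) θ)]
      exact hb y hy.le
    · simpa using hs
    · refine IsBigO.of_bound 0 ?_
      filter_upwards [Ioo_mem_nhdsGT (zero_lt_one' ℝ)] with y hy
      simp [hy.2.le]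
    · simp
  have : tailTransform E = fun s ↦ mellin ((Ioi (1 : ℝ)).indicator fun y ↦ (E y : ℂ)) (-s) :=
    funext fun s ↦ tailTransform_eq_mellin E s
  rw [this]
  exact key.comp s (differentiableAt_id.neg)

lemma integrableOn_rpow_bound {E : ℝ → ℝ} (hE : Measurable E) {C θ σ x : ℝ} (hx : 1 ≤ x)
    (hb : ∀ y, 1 ≤ y → |E y| ≤ C * y ^ θ) (hσ : θ + σ < -1) :
    IntegrableOn (fun y ↦ E y * y ^ σ) (Ioi x) := by
  have h1 : IntegrableOn (fun y : ℝ ↦ C * y ^ (θ + σ)) (Ioi x) :=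
    (integrableOn_Ioi_rpow_of_lt hσ (by linarith)).const_mul C
  refine h1.mono' (hE.mul (measurable_id.pow_const σ)).aestronglyMeasurable ?_
  refine (ae_restrict_mem measurableSet_Ioi).mono fun y hy ↦ ?_
  have hy1 : (1 : ℝ) ≤ y := hx.trans (le_of_lt hy)
  have hy0 : (0 : ℝ) < y := by linarith
  rw [norm_mul, Real.norm_eq_abs, Real.norm_eq_abs, abs_of_nonneg (Real.rpow_nonneg hy0.le σ),
    Real.rpow_add hy0, ← mul_assoc]
  exact mul_le_mul_of_nonneg_right (hb y hy1) (Real.rpow_nonneg hy0.le σ)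

lemma integrableOn_cpow_bound {E : ℝ → ℝ} (hE : Measurable E) {C θ : ℝ}
    (hb : ∀ y, 1 ≤ y → |E y| ≤ C * y ^ θ) {s : ℂ} (hs : θ < s.re) :
    IntegrableOn (fun y : ℝ ↦ (E y : ℂ) * (y : ℂ) ^ (-s - 1)) (Ioi 1) := by
  have h1 := (integrableOn_rpow_bound hE (σ := -s.re - 1) le_rfl hb (by linarith)).norm
  refine h1.mono' ?_ ?_
  · refine Measurable.aestronglyMeasurable ?_
    exact (Complex.measurable_ofReal.comp hE).mul (Complex.measurable_ofReal.pow_const _)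
  · refine (ae_restrict_mem measurableSet_Ioi).mono fun y hy ↦ ?_
    have hy0 : (0 : ℝ) < y := lt_trans one_pos hy
    rw [norm_mul, norm_mul, Complex.norm_cpow_eq_rpow_re_of_pos hy0, Complex.norm_real,
      Real.norm_of_nonneg (Real.rpow_nonneg hy0.le _)]
    simp

/-- Continuation of a Dirichlet series whose summatory function is `κ y + O(y ^ θ)`. -/
theorem continuation_formula {b : ℕ → ℝ} {κ C θ : ℝ} (hθ : 0 ≤ θ) (hθ1 : θ < 1)
    (hb : ∀ y, 1 ≤ y → |partialSum b y - κ * y| ≤ C * y ^ θ)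
    (hsum : ∀ s : ℂ, 1 < s.re → LSeriesSummable (fun n ↦ (b n : ℂ)) s)
    {G : ℂ → ℂ} (hG : ∀ s : ℂ, θ < s.re → DifferentiableAt ℂ G s)
    (hGL : ∀ s : ℂ, 1 < s.re → G s = (s - 1) * LSeries (fun n ↦ (b n : ℂ)) s)
    {s : ℂ} (hs : θ < s.re) :
    G s = s * (κ + (s - 1) * tailTransform (fun y ↦ partialSum b y - κ * y) s) := by
  set E : ℝ → ℝ := fun y ↦ partialSum b y - κ * y with hEdef
  have hE : Measurable E := (measurable_partialSum b).sub (measurable_const.mul measurable_id)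
  have hU : IsOpen {s : ℂ | θ < s.re} := isOpen_lt continuous_const Complex.continuous_re
  have hpre : IsPreconnected {s : ℂ | θ < s.re} := (convex_halfSpace_re_gt θ).isPreconnected
  have hA : AnalyticOnNhd ℂ G {s : ℂ | θ < s.re} :=
    DifferentiableOn.analyticOnNhd (fun z hz ↦ (hG z hz).differentiableWithinAt) hU
  have hB : AnalyticOnNhd ℂ (fun s ↦ s * (κ + (s - 1) * tailTransform E s)) {s : ℂ | θ < s.re} := by
    refine DifferentiableOn.analyticOnNhd (fun z hz ↦ DifferentiableAt.differentiableWithinAt ?_) hU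
    have := differentiableAt_tailTransform hE hθ hb hz
    fun_prop
  have h2 : (2 : ℂ) ∈ {s : ℂ | θ < s.re} := by
    simp only [mem_ofPred_eq, Complex.re_ofNat]; linarith
  refine hA.eqOn_of_preconnected_of_eventuallyEq hB hpre h2 ?_ hs
  have h3 : {s : ℂ | 1 < s.re} ∈ 𝓝 (2 : ℂ) :=
    (isOpen_lt continuous_const Complex.continuous_re).mem_nhds (by simp)
  filter_upwards [h3] with z hz
  have hz' : 1 < z.re := hz
  rw [hGL z hz]
  have hO : (fun n : ℕ ↦ ∑ k ∈ Finset.Icc 1 n, (b k : ℂ)) =O[atTop] fun n ↦ (n : ℝ) ^ (1 : ℝ) := by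
    refine IsBigO.of_bound (|C| + |κ|) ?_
    filter_upwards [eventually_ge_atTop 1] with n hn
    have hn1 : (1 : ℝ) ≤ n := by exact_mod_cast hn
    have h4 := hb n hn1
    have h5 : (∑ k ∈ Finset.Icc 1 n, (b k : ℂ)) = ((partialSum b n : ℝ) : ℂ) := by
      rw [partialSum, Nat.floor_natCast]; push_cast; rfl
    rw [h5, Complex.norm_real, Real.norm_eq_abs, Real.rpow_one, Real.norm_eq_abs,
      abs_of_nonneg (by linarith : (0 : ℝ) ≤ n)]
    have h6 : (n : ℝ) ^ θ ≤ n := by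
      simpa using Real.rpow_le_rpow_of_exponent_le hn1 hθ1.le
    have h7 : |partialSum b n| ≤ |partialSum b n - κ * n| + |κ * n| := by
      simpa using abs_add_le (partialSum b n - κ * n) (κ * n)
    rw [abs_mul κ, abs_of_nonneg (by linarith : (0 : ℝ) ≤ n)] at h7
    have h8 : C * (n : ℝ) ^ θ ≤ |C| * n :=
      mul_le_mul (le_abs_self C) h6 (by positivity) (abs_nonneg C)
    nlinarith
  rw [LSeries_eq_mul_integral _ zero_le_one hz (hsum z hz) hO]
  have hz1 : z - 1 ≠ 0 := by
    intro h
    have := congrArg Complex.re h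
    simp at this; linarith
  have hI1 := integrableOn_cpow_bound hE hb (s := z) (by linarith)
  have hI2 : IntegrableOn (fun y : ℝ ↦ (κ : ℂ) * (y : ℂ) ^ (-z)) (Ioi 1) :=
    (integrableOn_Ioi_cpow_of_lt (by simpa using hz') one_pos).const_mul _
  have hintegrable : ∫ t in Ioi (1 : ℝ), (∑ k ∈ Finset.Icc 1 ⌊t⌋₊, (b k : ℂ)) * (t : ℂ) ^ (-(z + 1)) =
      tailTransform E z + κ / (z - 1) := by
    have h9 : (κ : ℂ) / (z - 1) = ∫ y in Ioi (1 : ℝ), (κ : ℂ) * (y : ℂ) ^ (-z) := by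
      rw [integral_const_mul, integral_Ioi_cpow_of_lt (by simpa using hz') one_pos]
      rw [Complex.ofReal_one, Complex.one_cpow, show -z + 1 = -(z - 1) by ring, neg_div_neg_eq,
        mul_one_div]
    rw [h9, tailTransform, ← integral_add hI1 hI2]
    refine setIntegral_congr_fun measurableSet_Ioi fun t ht ↦ ?_
    have ht0 : (t : ℂ) ≠ 0 := by
      have : (1 : ℝ) < t := ht
      exact_mod_cast (by linarith : t ≠ 0)
    have h10 : (∑ k ∈ Finset.Icc 1 ⌊t⌋₊, (b k : ℂ)) = ((partialSum b t : ℝ) : ℂ) := by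
      rw [partialSum]; push_cast; rfl
    have h11 : (t : ℂ) ^ (-z) = t * (t : ℂ) ^ (-z - 1) := by
      rw [Complex.cpow_sub _ _ ht0, Complex.cpow_one]; field_simp
    simp only [hEdef]
    rw [h10, h11, show -(z + 1) = -z - 1 by ring]
    push_cast
    ring
  rw [hintegrable]
  field_simp
  ring

/-- `∫₁^∞ (∑_{n ≤ y} b n - κ y) y^{δ-2} dy`. -/
noncomputable def errorIntegral (b : ℕ → ℝ) (κ δ : ℝ) : ℝ :=
  ∫ y in Ioi (1 : ℝ), (partialSum b y - κ * y) * y ^ (δ - 2)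

lemma tailTransform_one_sub (b : ℕ → ℝ) (κ δ : ℝ) :
    tailTransform (fun y ↦ partialSum b y - κ * y) ((1 - δ : ℝ) : ℂ) =
      (errorIntegral b κ δ : ℂ) := by
  rw [tailTransform, errorIntegral, ← integral_complex_ofReal]
  refine setIntegral_congr_fun measurableSet_Ioi fun y hy ↦ ?_
  have hy0 : (0 : ℝ) ≤ y := by have : (1 : ℝ) < y := hy; linarith
  have : (-((1 - δ : ℝ) : ℂ) - 1) = ((δ - 2 : ℝ) : ℂ) := by push_cast; ring
  simp only [this]
  push_cast [Complex.ofReal_cpow hy0]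
  rfl

lemma measurable_partialSum_sub (b : ℕ → ℝ) (κ : ℝ) :
    Measurable fun y ↦ partialSum b y - κ * y :=
  (measurable_partialSum b).sub (measurable_const.mul measurable_id)

lemma integrableOn_Ioc_mul_rpow (κ : ℝ) {x : ℝ} (σ : ℝ) :
    IntegrableOn (fun y : ℝ ↦ κ * y ^ σ) (Ioc 1 x) := by
  refine (ContinuousOn.integrableOn_Icc ?_).mono_set Ioc_subset_Icc_self
  refine continuousOn_const.mul (ContinuousOn.rpow_const continuousOn_id fun y hy ↦ Or.inl ?_)
  have := hy.1
  change y ≠ 0; linarith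

lemma partialSum_mul_rpow_eq (b : ℕ → ℝ) (κ σ : ℝ) {y : ℝ} (hy : 0 < y) :
    partialSum b y * y ^ σ = (partialSum b y - κ * y) * y ^ σ + κ * y ^ (σ + 1) := by
  rw [Real.rpow_add_one hy.ne']; ring

lemma integrableOn_partialSum_Ioc {b : ℕ → ℝ} {κ C θ : ℝ}
    (hb : ∀ y, 1 ≤ y → |partialSum b y - κ * y| ≤ C * y ^ θ) {δ x : ℝ} (hδ : δ < 1 - θ) :
    IntegrableOn (fun y ↦ partialSum b y * y ^ (δ - 2)) (Ioc 1 x) := by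
  have h1 : IntegrableOn (fun y ↦ (partialSum b y - κ * y) * y ^ (δ - 2)) (Ioc 1 x) :=
    (integrableOn_rpow_bound (measurable_partialSum_sub b κ) le_rfl hb
      (by linarith)).mono_set Ioc_subset_Ioi_self
  refine (h1.add (integrableOn_Ioc_mul_rpow κ (δ - 2 + 1))).congr_fun (fun y hy ↦ ?_)
    measurableSet_Ioc
  exact (partialSum_mul_rpow_eq b κ (δ - 2) (by linarith [hy.1])).symm

lemma errorIntegral_split {b : ℕ → ℝ} {κ C θ : ℝ}
    (hb : ∀ y, 1 ≤ y → |partialSum b y - κ * y| ≤ C * y ^ θ) {δ x : ℝ} (hδ0 : 0 < δ)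
    (hδ : δ < 1 - θ) (hx : 1 ≤ x) :
    κ - δ * errorIntegral b κ δ = κ * x ^ δ - δ * (∫ y in Ioc 1 x, partialSum b y * y ^ (δ - 2))
      - δ * ∫ y in Ioi x, (partialSum b y - κ * y) * y ^ (δ - 2) := by
  have h0 := integrableOn_rpow_bound (σ := δ - 2) (measurable_partialSum_sub b κ) le_rfl hb
      (by linarith)
  have h1 : IntegrableOn (fun y ↦ (partialSum b y - κ * y) * y ^ (δ - 2)) (Ioc 1 x) :=
    h0.mono_set Ioc_subset_Ioi_self
  have h2 : IntegrableOn (fun y ↦ (partialSum b y - κ * y) * y ^ (δ - 2)) (Ioi x) :=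
    h0.mono_set (Ioi_subset_Ioi hx)
  have h3 : errorIntegral b κ δ = (∫ y in Ioc 1 x, (partialSum b y - κ * y) * y ^ (δ - 2)) +
      ∫ y in Ioi x, (partialSum b y - κ * y) * y ^ (δ - 2) := by
    rw [errorIntegral, ← Ioc_union_Ioi_eq_Ioi hx]
    exact setIntegral_union Ioc_disjoint_Ioi_same measurableSet_Ioi h1 h2
  have h4 : (∫ y in Ioc 1 x, partialSum b y * y ^ (δ - 2)) =
      (∫ y in Ioc 1 x, (partialSum b y - κ * y) * y ^ (δ - 2)) +
        ∫ y in Ioc 1 x, κ * y ^ (δ - 2 + 1) := by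
    rw [← integral_add h1 (integrableOn_Ioc_mul_rpow κ (δ - 2 + 1))]
    refine setIntegral_congr_fun measurableSet_Ioc fun y hy ↦ ?_
    exact partialSum_mul_rpow_eq b κ (δ - 2) (by linarith [hy.1])
  have h5 : (∫ y in Ioc 1 x, κ * y ^ (δ - 2 + 1)) = κ * ((x ^ δ - 1) / δ) := by
    rw [integral_const_mul, ← intervalIntegral.integral_of_le hx, integral_rpow]
    · rw [Real.one_rpow]; congr 3 <;> ring_nf
    · left; linarith
  rw [h3, h4, h5]
  field_simp
  ring

/-- Bound for the tail of the error integral. -/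
lemma abs_integral_Ioi_error_le {b : ℕ → ℝ} {κ C θ : ℝ}
    (hb : ∀ y, 1 ≤ y → |partialSum b y - κ * y| ≤ C * y ^ θ) {δ x : ℝ}
    (hδ : δ < 1 - θ) (hx : 1 ≤ x) :
    |∫ y in Ioi x, (partialSum b y - κ * y) * y ^ (δ - 2)| ≤
      C * x ^ (θ + δ - 1) / (1 - θ - δ) := by
  have h1 : IntegrableOn (fun y : ℝ ↦ C * y ^ (θ + (δ - 2))) (Ioi x) :=
    (integrableOn_Ioi_rpow_of_lt (by linarith) (by linarith)).const_mul C
  have h2 := norm_integral_le_of_norm_le (μ := volume.restrict (Ioi x))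
    (f := fun y ↦ (partialSum b y - κ * y) * y ^ (δ - 2)) h1 ?_
  · rw [Real.norm_eq_abs] at h2
    refine h2.trans (le_of_eq ?_)
    rw [integral_const_mul, integral_Ioi_rpow_of_lt (by linarith) (by linarith)]
    rw [show θ + (δ - 2) + 1 = -(1 - θ - δ) by ring, neg_div_neg_eq,
      show θ + δ - 1 = -(1 - θ - δ) by ring, mul_div_assoc]
  · refine (ae_restrict_mem measurableSet_Ioi).mono fun y hy ↦ ?_
    have hy1 : (1 : ℝ) ≤ y := hx.trans (le_of_lt hy)
    have hy0 : (0 : ℝ) < y := by linarith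
    rw [norm_mul, Real.norm_eq_abs, Real.norm_eq_abs, abs_of_nonneg (Real.rpow_nonneg hy0.le _),
      Real.rpow_add hy0, ← mul_assoc]
    exact mul_le_mul_of_nonneg_right (hb y hy1) (Real.rpow_nonneg hy0.le _)

lemma partialSum_nonneg {b : ℕ → ℝ} (hb : ∀ n, 0 ≤ b n) (y : ℝ) : 0 ≤ partialSum b y :=
  Finset.sum_nonneg fun n _ ↦ hb n

lemma card_squares_le_partialSum {b : ℕ → ℝ} (hb : ∀ n, 0 ≤ b n)
    (hsq : ∀ m, 0 < m → 1 ≤ b (m ^ 2)) (y : ℝ) (M : ℕ) :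
    ∑ m ∈ Finset.Icc 1 M, (if ((m : ℝ) ^ 2) < y then 1 else 0) ≤ partialSum b y := by
  rw [← Finset.sum_filter]
  have hinj : Set.InjOn (fun m : ℕ ↦ m ^ 2)
      (((Finset.Icc 1 M).filter fun m : ℕ ↦ (m : ℝ) ^ 2 < y) : Set ℕ) :=
    fun a _ c _ h ↦ Nat.pow_left_injective two_ne_zero h
  calc ∑ m ∈ (Finset.Icc 1 M).filter fun m : ℕ ↦ (m : ℝ) ^ 2 < y, (1 : ℝ)
      ≤ ∑ m ∈ (Finset.Icc 1 M).filter fun m : ℕ ↦ (m : ℝ) ^ 2 < y, b (m ^ 2) := by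
        refine Finset.sum_le_sum fun m hm ↦ hsq m ?_
        simp only [Finset.mem_filter, Finset.mem_Icc] at hm; omega
    _ = ∑ n ∈ ((Finset.Icc 1 M).filter fun m : ℕ ↦ (m : ℝ) ^ 2 < y).image (fun m ↦ m ^ 2), b n :=
        (Finset.sum_image hinj).symm
    _ ≤ partialSum b y := by
        refine Finset.sum_le_sum_of_subset_of_nonneg ?_ fun n _ _ ↦ hb n
        intro n hn
        simp only [Finset.mem_image, Finset.mem_filter, Finset.mem_Icc] at hn
        obtain ⟨m, ⟨hm, hmy⟩, rfl⟩ := hn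
        rw [Finset.mem_Ioc]
        exact ⟨by have := hm.1; positivity, Nat.le_floor (by push_cast; exact hmy.le)⟩

lemma integral_partialSum_ge {b : ℕ → ℝ} {κ C θ : ℝ}
    (hb : ∀ y, 1 ≤ y → |partialSum b y - κ * y| ≤ C * y ^ θ) {δ x : ℝ} (hδ0 : 0 ≤ δ)
    (hδ : δ < 1 - θ) (hb0 : ∀ n, 0 ≤ b n)
    (hsq : ∀ m, 0 < m → 1 ≤ b (m ^ 2)) (M : ℕ) (hx : (M : ℝ) ^ 2 ≤ x) :
    ∑ m ∈ Finset.Icc 1 M, (1 / (m : ℝ) ^ 2 - 1 / x) ≤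
      ∫ y in Ioc 1 x, partialSum b y * y ^ (δ - 2) := by
  have hterm : ∀ m ∈ Finset.Icc 1 M, (1 / (m : ℝ) ^ 2 - 1 / x) =
      ∫ y in Ioc (1 : ℝ) x, (Ioc ((m : ℝ) ^ 2) x).indicator (fun y : ℝ ↦ y ^ (-2 : ℝ)) y := by
    intro m hm
    rw [Finset.mem_Icc] at hm
    have hm1 : (1 : ℝ) ≤ m := by exact_mod_cast hm.1
    have hmM : (m : ℝ) ≤ M := by exact_mod_cast hm.2
    have hm2 : (1 : ℝ) ≤ (m : ℝ) ^ 2 := one_le_pow₀ hm1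
    have hmx : (m : ℝ) ^ 2 ≤ x := le_trans (by gcongr) hx
    rw [setIntegral_indicator measurableSet_Ioc,
      inter_eq_self_of_subset_right (Ioc_subset_Ioc_left hm2),
      ← intervalIntegral.integral_of_le hmx, integral_rpow]
    · rw [show (-2 : ℝ) + 1 = -1 by norm_num, Real.rpow_neg_one, Real.rpow_neg_one]
      ring
    · right
      refine ⟨by norm_num, ?_⟩
      rw [uIcc_of_le hmx]
      intro h
      linarith [h.1]
  have hintegrable : ∀ m ∈ Finset.Icc 1 M, Integrable
      ((Ioc ((m : ℝ) ^ 2) x).indicator (fun y : ℝ ↦ y ^ (-2 : ℝ))) (volume.restrict (Ioc 1 x)) := by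
    intro m _
    have := integrableOn_Ioc_mul_rpow 1 (x := x) (-2)
    simp only [one_mul] at this
    exact this.indicator measurableSet_Ioc
  rw [Finset.sum_congr rfl hterm, ← integral_finsetSum _ hintegrable]
  refine setIntegral_mono_on (integrable_finsetSum _ hintegrable)
    (integrableOn_partialSum_Ioc hb hδ) measurableSet_Ioc fun y hy ↦ ?_
  have hy1 : (1 : ℝ) ≤ y := hy.1.le
  have hy0 : (0 : ℝ) < y := by linarith
  have h1 : ∀ m ∈ Finset.Icc 1 M, (Ioc ((m : ℝ) ^ 2) x).indicator (fun y : ℝ ↦ y ^ (-2 : ℝ)) y =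
      (if ((m : ℝ) ^ 2) < y then 1 else 0) * y ^ (-2 : ℝ) := by
    intro m _
    by_cases h : ((m : ℝ) ^ 2) < y
    · rw [indicator_of_mem (show y ∈ Ioc _ _ from ⟨h, hy.2⟩), if_pos h, one_mul]
    · rw [indicator_of_notMem (fun h' ↦ h h'.1), if_neg h, zero_mul]
  rw [Finset.sum_congr rfl h1, ← Finset.sum_mul]
  refine mul_le_mul (card_squares_le_partialSum hb0 hsq y M) ?_ (by positivity)
    (partialSum_nonneg hb0 y)
  exact Real.rpow_le_rpow_of_exponent_le hy1 (by linarith)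

lemma partialSum_natCast (b : ℕ → ℝ) (N : ℕ) :
    partialSum b N = ∑ n ∈ Finset.Ioc 0 N, b n := by
  rw [partialSum, Nat.floor_natCast]

lemma partialSum_of_lt_one (b : ℕ → ℝ) {y : ℝ} (hy : y < 1) : partialSum b y = 0 := by
  rw [partialSum, Nat.floor_eq_zero.mpr hy]; simp

/-- The Dirichlet hyperbola identity. -/
lemma partialSum_mul (f g : ArithmeticFunction ℝ) (y : ℝ) {N : ℕ} (hN : 1 ≤ N) :
    partialSum (f * g : ArithmeticFunction ℝ) y =
      ∑ n ∈ Finset.Ioc 0 N, g n * partialSum f (y / n) +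
      ∑ m ∈ Finset.Ioc 0 (⌊y⌋₊ / N), f m * (partialSum g (y / m) - partialSum g N) := by
  let g₁ : ArithmeticFunction ℝ := ⟨fun n ↦ if n ≤ N then g n else 0, by simp⟩
  let g₂ : ArithmeticFunction ℝ := ⟨fun n ↦ if n ≤ N then 0 else g n, by simp⟩
  have hg₁ : ∀ n, g₁ n = if n ≤ N then g n else 0 := fun _ ↦ rfl
  have hg₂ : ∀ n, g₂ n = if n ≤ N then 0 else g n := fun _ ↦ rfl
  have hg : f * g = g₁ * f + f * g₂ := by
    rw [mul_comm g₁ f, ← mul_add]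
    congr 1
    ext n
    rw [ArithmeticFunction.add_apply, hg₁, hg₂]
    split_ifs <;> simp
  have hdiv : ∀ n : ℕ, ⌊y / n⌋₊ = ⌊y⌋₊ / n := fun n ↦ Nat.floor_div_natCast y n
  rw [hg, partialSum]
  simp only [ArithmeticFunction.add_apply, Finset.sum_add_distrib]
  rw [ArithmeticFunction.sum_Ioc_mul_eq_sum_sum, ArithmeticFunction.sum_Ioc_mul_eq_sum_sum]
  congr 1
  · have h1 : ∑ n ∈ Finset.Ioc 0 ⌊y⌋₊, g₁ n * ∑ m ∈ Finset.Ioc 0 (⌊y⌋₊ / n), f m =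
        ∑ n ∈ (Finset.Ioc 0 N) ∩ (Finset.Ioc 0 ⌊y⌋₊), g n * partialSum f (y / n) := by
      rw [← Finset.filter_mem_eq_inter, Finset.sum_filter]
      rw [← Finset.sum_filter, Finset.filter_mem_eq_inter, Finset.inter_comm,
        ← Finset.filter_mem_eq_inter, Finset.sum_filter]
      refine Finset.sum_congr rfl fun n hn ↦ ?_
      rw [Finset.mem_Ioc] at hn
      simp only [Finset.mem_Ioc, hg₁, hn.1, true_and, partialSum, hdiv]
      split_ifs <;> simp
    rw [h1]
    refine Finset.sum_subset Finset.inter_subset_left fun n hn hn' ↦ ?_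
    have h2 : ¬ n ≤ ⌊y⌋₊ := fun h ↦ hn' (Finset.mem_inter.mpr
      ⟨hn, Finset.mem_Ioc.mpr ⟨(Finset.mem_Ioc.mp hn).1, h⟩⟩)
    rw [partialSum, hdiv, Nat.div_eq_of_lt (not_le.mp h2)]
    simp
  · have hle : ⌊y⌋₊ / N ≤ ⌊y⌋₊ := Nat.div_le_self _ _
    symm
    refine Finset.sum_subset_zero_on_sdiff (Finset.Ioc_subset_Ioc_right hle) ?_ ?_
    · intro m hm
      rw [Finset.mem_sdiff, Finset.mem_Ioc, Finset.mem_Ioc] at hm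
      obtain ⟨⟨hm0, hm1⟩, hm2⟩ := hm
      have hm3 : ⌊y⌋₊ / N < m := by by_contra h; exact hm2 ⟨hm0, not_lt.mp h⟩
      have h4 : ⌊y⌋₊ / m ≤ N := by
        rw [Nat.div_lt_iff_lt_mul (by omega)] at hm3
        rw [← Nat.lt_succ_iff, Nat.div_lt_iff_lt_mul hm0]
        nlinarith
      rw [Finset.sum_eq_zero, mul_zero]
      intro k hk
      rw [hg₂, if_pos ((Finset.mem_Ioc.mp hk).2.trans h4)]
    · intro m hm
      rw [Finset.mem_Ioc] at hm
      have h4 : N ≤ ⌊y⌋₊ / m := by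
        rw [Nat.le_div_iff_mul_le hm.1, mul_comm]
        exact (Nat.le_div_iff_mul_le (by omega)).mp hm.2
      congr 1
      rw [partialSum, hdiv, partialSum_natCast, ← Finset.sum_Ioc_consecutive _ (Nat.zero_le N) h4,
        add_sub_cancel_left]
      rw [← Finset.sum_Ioc_consecutive _ (Nat.zero_le N) h4,
        Finset.sum_eq_zero (s := Finset.Ioc 0 N), zero_add]
      · refine Finset.sum_congr rfl fun k hk ↦ ?_
        rw [hg₂, if_neg (not_le.mpr (Finset.mem_Ioc.mp hk).1)]
      · intro k hk
        rw [hg₂, if_pos (Finset.mem_Ioc.mp hk).2]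

/-- If the summatory function of `g` is `O(y ^ τ)`, `τ ≤ 1/2`, then `∑ g n / n` converges,
with an explicit rate. -/
lemma exists_sum_div_approx {g : ℕ → ℝ} {B τ : ℝ} (hτ : τ ≤ 1 / 2)
    (hg : ∀ y, 1 ≤ y → |partialSum g y| ≤ B * y ^ τ) :
    ∃ M : ℝ, ∀ N : ℕ, 1 ≤ N →
      |M - ∑ n ∈ Finset.Ioc 0 N, g n / n| ≤ 3 * B * (N : ℝ) ^ (τ - 1) := by
  have hg' : ∀ y, 1 ≤ y → |partialSum g y - 0 * y| ≤ B * y ^ τ := by simpa using hg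
  have hB : 0 ≤ B := by simpa using (abs_nonneg _).trans (hg 1 le_rfl)
  refine ⟨errorIntegral g 0 0, fun N hN ↦ ?_⟩
  have hN1 : (1 : ℝ) ≤ N := by exact_mod_cast hN
  have hN0 : (0 : ℝ) < N := by linarith
  have h0 := integrableOn_rpow_bound (σ := 0 - 2) (measurable_partialSum_sub g 0) le_rfl hg'
      (by linarith)
  have h1 : IntegrableOn (fun y ↦ (partialSum g y - 0 * y) * y ^ ((0 : ℝ) - 2)) (Ioc 1 (N : ℝ)) :=
    h0.mono_set Ioc_subset_Ioi_self
  have h2 : IntegrableOn (fun y ↦ (partialSum g y - 0 * y) * y ^ ((0 : ℝ) - 2)) (Ioi (N : ℝ)) :=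
    h0.mono_set (Ioi_subset_Ioi hN1)
  have h3 : errorIntegral g 0 0 =
      (∫ y in Ioc 1 (N : ℝ), (partialSum g y - 0 * y) * y ^ ((0 : ℝ) - 2)) +
      ∫ y in Ioi (N : ℝ), (partialSum g y - 0 * y) * y ^ ((0 : ℝ) - 2) := by
    rw [errorIntegral, ← Ioc_union_Ioi_eq_Ioi hN1]
    exact setIntegral_union Ioc_disjoint_Ioi_same measurableSet_Ioi h1 h2
  let c : ℕ → ℝ := fun n ↦ if n = 0 then 0 else g n
  have hc : ∀ m : ℕ, ∑ k ∈ Finset.Icc 0 m, c k = ∑ k ∈ Finset.Ioc 0 m, g k := by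
    intro m
    rw [← Finset.add_sum_Ioc_eq_sum_Icc (Nat.zero_le m)]
    simp only [c, if_true, zero_add]
    refine Finset.sum_congr rfl fun k hk ↦ ?_
    rw [if_neg (Finset.mem_Ioc.mp hk).1.ne']
  have h4 := sum_mul_eq_sub_integral_mul₀' (f := fun t : ℝ ↦ t⁻¹) c (by simp [c]) N
    (fun t ht ↦ (differentiableAt_inv (by have := ht.1; linarith))) ?_
  · have h5 : ∑ k ∈ Finset.Icc 0 N, (fun t : ℝ ↦ t⁻¹) (k : ℝ) * c k =
        ∑ n ∈ Finset.Ioc 0 N, g n / n := by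
      rw [← Finset.add_sum_Ioc_eq_sum_Icc (Nat.zero_le N)]
      simp only [c, if_true, mul_zero, zero_add]
      refine Finset.sum_congr rfl fun k hk ↦ ?_
      rw [if_neg (Finset.mem_Ioc.mp hk).1.ne']; ring
    have h6 : ∫ t in Ioc (1 : ℝ) N, deriv (fun t : ℝ ↦ t⁻¹) t * ∑ k ∈ Finset.Icc 0 ⌊t⌋₊, c k =
        - ∫ y in Ioc 1 (N : ℝ), (partialSum g y - 0 * y) * y ^ ((0 : ℝ) - 2) := by
      rw [← integral_neg]
      refine setIntegral_congr_fun measurableSet_Ioc fun y hy ↦ ?_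
      have hy0 : (0 : ℝ) < y := by linarith [hy.1]
      simp only [hc, deriv_inv]
      rw [partialSum, zero_sub, Real.rpow_neg hy0.le]
      norm_cast
      ring
    rw [h5, h6, hc] at h4
    rw [h3, h4]
    have h7 := abs_integral_Ioi_error_le hg' (δ := 0) (by linarith) hN1
    have h8 := hg N hN1
    rw [partialSum_natCast] at h8
    set I := ∫ y in Ioi (N : ℝ), (partialSum g y - 0 * y) * y ^ ((0 : ℝ) - 2)
    set J := ∫ y in Ioc 1 (N : ℝ), (partialSum g y - 0 * y) * y ^ ((0 : ℝ) - 2)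
    have h9 : |(N : ℝ)⁻¹ * ∑ k ∈ Finset.Ioc 0 N, g k| ≤ B * (N : ℝ) ^ (τ - 1) := by
      rw [abs_mul, abs_of_pos (inv_pos.mpr hN0), Real.rpow_sub_one hN0.ne']
      calc (N : ℝ)⁻¹ * |∑ k ∈ Finset.Ioc 0 N, g k| ≤ (N : ℝ)⁻¹ * (B * N ^ τ) := by gcongr
        _ = _ := by ring
    have h10 : |I| ≤ 2 * B * (N : ℝ) ^ (τ - 1) := by
      refine h7.trans ?_
      rw [add_zero, sub_zero, div_le_iff₀ (by linarith)]
      have : 0 ≤ B * (N : ℝ) ^ (τ - 1) := by positivity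
      nlinarith
    have e : J + I - ((N : ℝ)⁻¹ * ∑ k ∈ Finset.Ioc 0 N, g k - -J) =
        I - (N : ℝ)⁻¹ * ∑ k ∈ Finset.Ioc 0 N, g k := by ring
    simp only [e]
    calc _ ≤ |I| + |(N : ℝ)⁻¹ * ∑ k ∈ Finset.Ioc 0 N, g k| := abs_sub _ _
      _ ≤ _ := by linarith
  · refine ContinuousOn.integrableOn_Icc ?_
    have : deriv (fun t : ℝ ↦ t⁻¹) = fun t ↦ -(t ^ 2)⁻¹ := by ext; simp
    rw [this]
    refine ContinuousOn.neg (ContinuousOn.inv₀ (by fun_prop) fun t ht ↦ ?_)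
    have : t ≠ 0 := by have := ht.1; linarith
    positivity

/-- The hyperbola method with an error term. -/
lemma abs_partialSum_mul_sub_le {f g : ArithmeticFunction ℝ} {α A B K M τ ρ : ℝ}
    (hα : 0 ≤ α) (hαA : α ≤ A) (hτ0 : 0 ≤ τ) (hτ : τ ≤ 1 / 2)
    (hf : ∀ y, 1 ≤ y → |partialSum f y - α * y| ≤ A * y ^ τ)
    (hg : ∀ y, 1 ≤ y → |partialSum g y| ≤ B * y ^ τ)
    (hM : ∀ N : ℕ, 1 ≤ N → |M - ∑ n ∈ Finset.Ioc 0 N, g n / n| ≤ 3 * B * (N : ℝ) ^ (τ - 1))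
    (hρ : 0 ≤ ρ) (hK : 0 ≤ K)
    (hwf : ∀ N : ℕ, ∑ n ∈ Finset.Ioc 0 N, |f n| / (n : ℝ) ^ τ ≤ K * (N : ℝ) ^ ρ)
    (hwg : ∀ N : ℕ, ∑ n ∈ Finset.Ioc 0 N, |g n| / (n : ℝ) ^ τ ≤ K * (N : ℝ) ^ ρ)
    {y : ℝ} (hy : 1 ≤ y) {N : ℕ} (hN : 1 ≤ N) :
    |partialSum (f * g : ArithmeticFunction ℝ) y - α * M * y| ≤
      K * A * y ^ τ * (N : ℝ) ^ ρ + 3 * α * B * y * (N : ℝ) ^ (τ - 1) +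
        2 * K * B * y ^ τ * (y / N) ^ ρ := by
  have hy0 : 0 < y := by linarith
  have hN1 : (1 : ℝ) ≤ N := by exact_mod_cast hN
  have hN0 : (0 : ℝ) < N := by linarith
  have hB : 0 ≤ B := by simpa using (abs_nonneg _).trans (hg 1 le_rfl)
  have hA : 0 ≤ A := hα.trans hαA
  have hf' : ∀ z, 0 < z → |partialSum f z - α * z| ≤ A * z ^ τ := by
    intro z hz
    rcases le_or_gt 1 z with h | h
    · exact hf z h
    · rw [partialSum_of_lt_one _ h, zero_sub, abs_neg, abs_of_nonneg (by positivity)]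
      have : z ≤ z ^ τ := by
        simpa using Real.rpow_le_rpow_of_exponent_ge hz h.le (show τ ≤ 1 by linarith)
      exact mul_le_mul hαA this hz.le hA
  rw [partialSum_mul f g y hN]
  set T := ∑ n ∈ Finset.Ioc 0 N, g n / n with hT
  have e : ∑ n ∈ Finset.Ioc 0 N, g n * partialSum f (y / n) +
      ∑ m ∈ Finset.Ioc 0 (⌊y⌋₊ / N), f m * (partialSum g (y / m) - partialSum g N) - α * M * y =
      ∑ n ∈ Finset.Ioc 0 N, g n * (partialSum f (y / n) - α * (y / n)) - α * y * (M - T) +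
      ∑ m ∈ Finset.Ioc 0 (⌊y⌋₊ / N), f m * (partialSum g (y / m) - partialSum g N) := by
    have : ∑ n ∈ Finset.Ioc 0 N, g n * (partialSum f (y / n) - α * (y / n)) =
        ∑ n ∈ Finset.Ioc 0 N, g n * partialSum f (y / n) - α * y * T := by
      rw [hT, Finset.mul_sum, ← Finset.sum_sub_distrib]
      refine Finset.sum_congr rfl fun n _ ↦ ?_
      ring
    rw [this]; ring
  rw [e]
  have b1 : |∑ n ∈ Finset.Ioc 0 N, g n * (partialSum f (y / n) - α * (y / n))| ≤
      K * A * y ^ τ * (N : ℝ) ^ ρ := by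
    calc _ ≤ ∑ n ∈ Finset.Ioc 0 N, |g n * (partialSum f (y / n) - α * (y / n))| :=
          Finset.abs_sum_le_sum_abs _ _
      _ ≤ ∑ n ∈ Finset.Ioc 0 N, A * y ^ τ * (|g n| / (n : ℝ) ^ τ) := by
          refine Finset.sum_le_sum fun n hn ↦ ?_
          have hn0 : (0 : ℝ) < n := by exact_mod_cast (Finset.mem_Ioc.mp hn).1
          rw [abs_mul]
          calc |g n| * |partialSum f (y / n) - α * (y / n)| ≤ |g n| * (A * (y / n) ^ τ) := by
                gcongr; exact hf' _ (by positivity)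
            _ = _ := by rw [Real.div_rpow hy0.le hn0.le]; ring
      _ = A * y ^ τ * ∑ n ∈ Finset.Ioc 0 N, (|g n| / (n : ℝ) ^ τ) := by rw [Finset.mul_sum]
      _ ≤ A * y ^ τ * (K * (N : ℝ) ^ ρ) := by gcongr; exact hwg N
      _ = _ := by ring
  have b2 : |α * y * (M - T)| ≤ 3 * α * B * y * (N : ℝ) ^ (τ - 1) := by
    rw [abs_mul, abs_of_nonneg (by positivity : 0 ≤ α * y)]
    calc α * y * |M - T| ≤ α * y * (3 * B * (N : ℝ) ^ (τ - 1)) := by gcongr; exact hM N hN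
      _ = _ := by ring
  have b3 : |∑ m ∈ Finset.Ioc 0 (⌊y⌋₊ / N), f m * (partialSum g (y / m) - partialSum g N)| ≤
      2 * K * B * y ^ τ * (y / N) ^ ρ := by
    calc _ ≤ ∑ m ∈ Finset.Ioc 0 (⌊y⌋₊ / N), |f m * (partialSum g (y / m) - partialSum g N)| :=
          Finset.abs_sum_le_sum_abs _ _
      _ ≤ ∑ m ∈ Finset.Ioc 0 (⌊y⌋₊ / N), 2 * B * y ^ τ * (|f m| / (m : ℝ) ^ τ) := by
          refine Finset.sum_le_sum fun m hm ↦ ?_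
          rw [Finset.mem_Ioc] at hm
          have hm0 : (0 : ℝ) < m := by exact_mod_cast hm.1
          have hmN : (N : ℝ) ≤ y / m := by
            rw [le_div_iff₀ hm0]
            have h1 := (Nat.le_div_iff_mul_le (by omega)).mp hm.2
            have h2 : ((m * N : ℕ) : ℝ) ≤ y := (Nat.le_floor_iff hy0.le).mp h1
            push_cast at h2; linarith
          have c1 := hg (y / m) (hN1.trans hmN)
          have c2 := hg N hN1
          have c3 : (N : ℝ) ^ τ ≤ (y / m) ^ τ := Real.rpow_le_rpow hN0.le hmN hτ0
          have c4 : B * (N : ℝ) ^ τ ≤ B * (y / m) ^ τ := by gcongr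
          rw [abs_mul]
          calc |f m| * |partialSum g (y / m) - partialSum g N|
              ≤ |f m| * (2 * B * (y / m) ^ τ) := by
                gcongr
                refine (abs_sub _ _).trans ?_
                linarith
            _ = _ := by rw [Real.div_rpow hy0.le hm0.le]; ring
      _ = 2 * B * y ^ τ * ∑ m ∈ Finset.Ioc 0 (⌊y⌋₊ / N), (|f m| / (m : ℝ) ^ τ) := by
          rw [Finset.mul_sum]
      _ ≤ 2 * B * y ^ τ * (K * ((⌊y⌋₊ / N : ℕ) : ℝ) ^ ρ) := by gcongr; exact hwf _
      _ ≤ 2 * B * y ^ τ * (K * (y / N) ^ ρ) := by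
          gcongr
          refine Nat.cast_div_le.trans ?_
          gcongr
          exact Nat.floor_le hy0.le
      _ = _ := by ring
  calc _ ≤ |∑ n ∈ Finset.Ioc 0 N, g n * (partialSum f (y / n) - α * (y / n)) - α * y * (M - T)| +
        |∑ m ∈ Finset.Ioc 0 (⌊y⌋₊ / N), f m * (partialSum g (y / m) - partialSum g N)| :=
        abs_add_le _ _
    _ ≤ _ := by
        have := abs_sub (∑ n ∈ Finset.Ioc 0 N, g n * (partialSum f (y / n) - α * (y / n)))
          (α * y * (M - T))
        linarith

lemma exists_nat_between {z : ℝ} (hz : 1 ≤ z) : ∃ N : ℕ, 1 ≤ N ∧ z ≤ N ∧ (N : ℝ) ≤ 2 * z := by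
  refine ⟨⌈z⌉₊, ?_, Nat.le_ceil z, ?_⟩
  · exact Nat.one_le_ceil_iff.mpr (by linarith)
  · have := Nat.ceil_lt_add_one (show 0 ≤ z by linarith)
    linarith

/-- The convolution of two bounded sequences. -/
lemma exists_partialSum_mul_approx {f g : ArithmeticFunction ℝ} {α A B : ℝ}
    (hα : 0 ≤ α) (hα1 : α ≤ 1) (hA : 1 ≤ A) (hAB : A ≤ B)
    (hf : ∀ y, 1 ≤ y → |partialSum f y - α * y| ≤ A)
    (hg : ∀ y, 1 ≤ y → |partialSum g y| ≤ B)
    (hf1 : ∀ n, |f n| ≤ 1) (hg1 : ∀ n, |g n| ≤ 1) :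
    ∃ M : ℝ, ∀ y, 1 ≤ y → |partialSum (f * g : ArithmeticFunction ℝ) y - α * M * y| ≤
      7 * √(A * B) * y ^ (1 / 2 : ℝ) := by
  have hg' : ∀ y, 1 ≤ y → |partialSum g y| ≤ B * y ^ (0 : ℝ) := by simpa using hg
  have hf' : ∀ y, 1 ≤ y → |partialSum f y - α * y| ≤ A * y ^ (0 : ℝ) := by simpa using hf
  obtain ⟨M, hM⟩ := exists_sum_div_approx (by norm_num) hg'
  refine ⟨M, fun y hy ↦ ?_⟩
  have hy0 : 0 < y := by linarith
  have hA0 : 0 < A := by linarith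
  have hB0 : 0 < B := by linarith
  have hw : ∀ f : ArithmeticFunction ℝ, (∀ n, |f n| ≤ 1) → ∀ N : ℕ,
      ∑ n ∈ Finset.Ioc 0 N, |f n| / (n : ℝ) ^ (0 : ℝ) ≤ 1 * (N : ℝ) ^ (1 : ℝ) := by
    intro f hf N
    calc _ ≤ ∑ n ∈ Finset.Ioc 0 N, (1 : ℝ) :=
          Finset.sum_le_sum fun n _ ↦ by simpa using hf n
      _ = _ := by simp
  have hz : 1 ≤ √(B * y / A) := by
    rw [Real.one_le_sqrt, one_le_div (by linarith)]
    nlinarith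
  obtain ⟨N, hN, hzN, hNz⟩ := exists_nat_between hz
  have key := abs_partialSum_mul_sub_le hα (hα1.trans hA) le_rfl (by norm_num) hf' hg' hM
    zero_le_one zero_le_one (hw f hf1) (hw g hg1) hy hN
  refine key.trans ?_
  rw [Real.rpow_zero, zero_sub, Real.rpow_neg_one, Real.rpow_one, Real.rpow_one,
    ← Real.sqrt_eq_rpow]
  set z := √(B * y / A) with hzdef
  have hz0 : 0 < z := by linarith
  have hN0 : (0 : ℝ) < N := by linarith
  have h1 : A * z = √(A * B) * √y := by
    rw [hzdef, ← Real.sqrt_mul (by positivity)]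
    rw [show A * B * y = A ^ 2 * (B * y / A) by field_simp, Real.sqrt_mul (by positivity),
      Real.sqrt_sq (by linarith)]
  have h2 : B * y / z = √(A * B) * √y := by
    rw [← h1, div_eq_iff hz0.ne', mul_assoc, hzdef, Real.mul_self_sqrt (by positivity)]
    field_simp
  have h3 : B * y / N ≤ B * y / z := by
    have : 0 ≤ B * y := by positivity
    gcongr
  have h4 : 3 * α * B * y * (N : ℝ)⁻¹ ≤ 3 * (B * y / N) := by
    have : 0 ≤ B * y / N := by positivity
    calc 3 * α * B * y * (N : ℝ)⁻¹ = α * (3 * (B * y / N)) := by ring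
      _ ≤ 1 * (3 * (B * y / N)) := by gcongr
      _ = _ := by ring
  have h5 : 2 * 1 * B * 1 * (y / N) = 2 * (B * y / N) := by ring
  have h6 : 1 * A * 1 * N ≤ 2 * (A * z) := by nlinarith
  rw [h5]
  nlinarith

lemma sum_rpow_neg_half_le (N : ℕ) :
    ∑ n ∈ Finset.Ioc 0 N, 1 / (n : ℝ) ^ (1 / 2 : ℝ) ≤ 2 * (N : ℝ) ^ (1 / 2 : ℝ) := by
  simp_rw [← Real.sqrt_eq_rpow]
  induction N with
  | zero => simp
  | succ n ih =>
    rw [Finset.sum_Ioc_succ_top (Nat.zero_le n)]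
    have hs : (0 : ℝ) < √((n + 1 : ℕ) : ℝ) := Real.sqrt_pos.mpr (by positivity)
    have h1 : √((n + 1 : ℕ) : ℝ) ^ 2 = n + 1 := by
      rw [Real.sq_sqrt (by positivity)]; push_cast; ring
    have h2 : √(n : ℝ) ^ 2 = n := Real.sq_sqrt (by positivity)
    have h3 : 1 / √((n + 1 : ℕ) : ℝ) ≤ 2 * √((n + 1 : ℕ) : ℝ) - 2 * √(n : ℝ) := by
      rw [div_le_iff₀ hs]
      nlinarith [sq_nonneg (√((n + 1 : ℕ) : ℝ) - √(n : ℝ))]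
    linarith

lemma one_add_log_le {x : ℝ} (hx : 0 < x) : 1 + Real.log x ≤ 32 * x ^ (1 / 32 : ℝ) := by
  have h := Real.add_one_le_exp (Real.log x * (1 / 32))
  rw [← Real.rpow_def_of_pos hx] at h
  linarith

/-- Weighted absolute sums of a convolution of two bounded sequences. -/
lemma sum_abs_mul_div_sqrt_le {f g : ArithmeticFunction ℝ} (hf : ∀ n, |f n| ≤ 1)
    (hg : ∀ n, |g n| ≤ 1) (N : ℕ) :
    ∑ n ∈ Finset.Ioc 0 N, |(f * g) n| / (n : ℝ) ^ (1 / 2 : ℝ) ≤ 64 * (N : ℝ) ^ (17 / 32 : ℝ) := by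
  rcases Nat.eq_zero_or_pos N with rfl | hN
  · simp
  have hN0 : (0 : ℝ) < N := by exact_mod_cast hN
  let w : ArithmeticFunction ℝ := ⟨fun n ↦ 1 / (n : ℝ) ^ (1 / 2 : ℝ), by simp⟩
  have hw : ∀ n, w n = 1 / (n : ℝ) ^ (1 / 2 : ℝ) := fun _ ↦ rfl
  have h1 : ∀ n, |(f * g) n| / (n : ℝ) ^ (1 / 2 : ℝ) ≤ (w * w) n := by
    intro n
    rw [ArithmeticFunction.mul_apply, ArithmeticFunction.mul_apply]
    calc _ ≤ (∑ x ∈ n.divisorsAntidiagonal, |f x.1 * g x.2|) / (n : ℝ) ^ (1 / 2 : ℝ) := by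
          gcongr; exact Finset.abs_sum_le_sum_abs _ _
      _ = ∑ x ∈ n.divisorsAntidiagonal, |f x.1 * g x.2| / (n : ℝ) ^ (1 / 2 : ℝ) := by
          rw [Finset.sum_div]
      _ ≤ _ := by
          refine Finset.sum_le_sum fun x hx ↦ ?_
          have hxn : (n : ℝ) = x.1 * x.2 := by
            exact_mod_cast (Nat.mem_divisorsAntidiagonal.mp hx).1.symm
          rw [hw, hw, hxn, Real.mul_rpow (by positivity) (by positivity), abs_mul, ← mul_div_mul_comm]
          have : |f x.1| * |g x.2| ≤ 1 * 1 :=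
            mul_le_mul (hf _) (hg _) (abs_nonneg _) zero_le_one
          gcongr
  calc _ ≤ ∑ n ∈ Finset.Ioc 0 N, (w * w) n := Finset.sum_le_sum fun n _ ↦ h1 n
    _ = ∑ n ∈ Finset.Ioc 0 N, w n * ∑ m ∈ Finset.Ioc 0 (N / n), w m :=
        ArithmeticFunction.sum_Ioc_mul_eq_sum_sum _ _ _
    _ ≤ ∑ n ∈ Finset.Ioc 0 N, 2 * (N : ℝ) ^ (1 / 2 : ℝ) * ((n : ℝ)⁻¹) := by
        refine Finset.sum_le_sum fun n hn ↦ ?_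
        have hn0 : (0 : ℝ) < n := by exact_mod_cast (Finset.mem_Ioc.mp hn).1
        calc w n * ∑ m ∈ Finset.Ioc 0 (N / n), w m
            ≤ w n * (2 * ((N / n : ℕ) : ℝ) ^ (1 / 2 : ℝ)) := by
              have : 0 ≤ w n := by rw [hw]; positivity
              gcongr
              exact sum_rpow_neg_half_le _
          _ ≤ w n * (2 * ((N : ℝ) / n) ^ (1 / 2 : ℝ)) := by
              have : 0 ≤ w n := by rw [hw]; positivity
              gcongr
              exact Nat.cast_div_le
          _ = 2 * (N : ℝ) ^ (1 / 2 : ℝ) * ((n : ℝ)⁻¹) := by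
              rw [hw, Real.div_rpow hN0.le hn0.le, ← Real.sqrt_eq_rpow, ← Real.sqrt_eq_rpow]
              have : √(n : ℝ) ^ 2 = n := Real.sq_sqrt hn0.le
              have h0 : 0 < √(n : ℝ) := Real.sqrt_pos.mpr hn0
              nth_rewrite 3 [← this]
              field_simp
    _ = 2 * (N : ℝ) ^ (1 / 2 : ℝ) * ∑ n ∈ Finset.Ioc 0 N, ((n : ℝ)⁻¹) := by rw [Finset.mul_sum]
    _ ≤ 2 * (N : ℝ) ^ (1 / 2 : ℝ) * (1 + Real.log N) := by
        gcongr
        have := harmonic_le_one_add_log N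
        rw [harmonic_eq_sum_Icc] at this
        push_cast at this
        exact this
    _ ≤ 2 * (N : ℝ) ^ (1 / 2 : ℝ) * (32 * (N : ℝ) ^ (1 / 32 : ℝ)) := by
        gcongr; exact one_add_log_le hN0
    _ = 64 * ((N : ℝ) ^ (1 / 2 : ℝ) * (N : ℝ) ^ (1 / 32 : ℝ)) := by ring
    _ = _ := by rw [← Real.rpow_add hN0]; norm_num

/-- The fourfold convolution estimate. -/
lemma exists_partialSum_mul_mul_approx {a c : ArithmeticFunction ℝ} {α q₁ q₂ : ℝ}
    (hα : 0 ≤ α) (hα1 : α ≤ 1) (hq₁ : 1 ≤ q₁) (hq₂ : 1 ≤ q₂)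
    (ha : ∀ y, 1 ≤ y → |partialSum a y - α * y| ≤ 7 * √q₁ * y ^ (1 / 2 : ℝ))
    (hc : ∀ y, 1 ≤ y → |partialSum c y| ≤ 7 * (q₂ * √q₁) * y ^ (1 / 2 : ℝ))
    (hwa : ∀ N : ℕ,
      ∑ n ∈ Finset.Ioc 0 N, |a n| / (n : ℝ) ^ (1 / 2 : ℝ) ≤ 64 * (N : ℝ) ^ (17 / 32 : ℝ))
    (hwc : ∀ N : ℕ,
      ∑ n ∈ Finset.Ioc 0 N, |c n| / (n : ℝ) ^ (1 / 2 : ℝ) ≤ 64 * (N : ℝ) ^ (17 / 32 : ℝ)) :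
    ∃ κ : ℝ, ∀ y, 1 ≤ y → |partialSum (a * c : ArithmeticFunction ℝ) y - κ * y| ≤
      1813 * (q₁ * q₂) ^ (17 / 32 : ℝ) * y ^ (49 / 64 : ℝ) := by
  obtain ⟨M, hM⟩ := exists_sum_div_approx le_rfl hc
  refine ⟨α * M, fun y hy ↦ ?_⟩
  have hy0 : 0 < y := by linarith
  have hs1 : 1 ≤ √q₁ := by rwa [Real.one_le_sqrt]
  have hsy : 1 ≤ √y := by rwa [Real.one_le_sqrt]
  have hz : 1 ≤ q₂ * √y := by nlinarith
  obtain ⟨N, hN, hzN, hNz⟩ := exists_nat_between hz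
  have hN0 : (0 : ℝ) < N := by linarith
  have key := abs_partialSum_mul_sub_le hα (show α ≤ 7 * √q₁ by linarith) (by norm_num) le_rfl
    ha hc hM (by norm_num) (by norm_num) hwa hwc hy hN
  refine key.trans ?_
  have hq10 : 0 < q₁ := by linarith
  have hq20 : 0 < q₂ := by linarith
  have e1 : √q₁ = q₁ ^ (1 / 2 : ℝ) := Real.sqrt_eq_rpow _
  have e2 : √y = y ^ (1 / 2 : ℝ) := Real.sqrt_eq_rpow _
  have hq1 : q₁ ^ (1 / 2 : ℝ) ≤ q₁ ^ (17 / 32 : ℝ) :=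
    Real.rpow_le_rpow_of_exponent_le hq₁ (by norm_num)
  have t0 : (q₁ * q₂) ^ (17 / 32 : ℝ) = q₁ ^ (17 / 32 : ℝ) * q₂ ^ (17 / 32 : ℝ) :=
    Real.mul_rpow hq10.le hq20.le
  have t1 : (N : ℝ) ^ (17 / 32 : ℝ) ≤ 2 * (q₂ ^ (17 / 32 : ℝ) * y ^ (17 / 64 : ℝ)) := by
    calc (N : ℝ) ^ (17 / 32 : ℝ) ≤ (2 * (q₂ * √y)) ^ (17 / 32 : ℝ) := by gcongr
      _ = 2 ^ (17 / 32 : ℝ) * (q₂ ^ (17 / 32 : ℝ) * y ^ (17 / 64 : ℝ)) := by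
          rw [Real.mul_rpow (by norm_num) (by positivity), Real.mul_rpow hq20.le (by positivity),
            e2, ← Real.rpow_mul hy0.le]
          norm_num
      _ ≤ _ := by
          gcongr
          calc (2 : ℝ) ^ (17 / 32 : ℝ) ≤ 2 ^ (1 : ℝ) :=
                Real.rpow_le_rpow_of_exponent_le (by norm_num) (by norm_num)
            _ = 2 := by norm_num
  have t2 : (N : ℝ) ^ ((1 / 2 : ℝ) - 1) ≤ q₂ ^ (-(1 / 2) : ℝ) * y ^ (-(1 / 4) : ℝ) := by
    calc (N : ℝ) ^ ((1 / 2 : ℝ) - 1) ≤ (q₂ * √y) ^ ((1 / 2 : ℝ) - 1) :=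
          Real.rpow_le_rpow_of_nonpos (by positivity) hzN (by norm_num)
      _ = _ := by
          rw [Real.mul_rpow hq20.le (by positivity), e2, ← Real.rpow_mul hy0.le]
          norm_num
  have t3 : (y / N) ^ (17 / 32 : ℝ) ≤ q₂ ^ (-(17 / 32) : ℝ) * y ^ (17 / 64 : ℝ) := by
    calc (y / N) ^ (17 / 32 : ℝ) ≤ (y / (q₂ * √y)) ^ (17 / 32 : ℝ) := by gcongr
      _ = (q₂ ^ (-1 : ℝ) * y ^ (1 / 2 : ℝ)) ^ (17 / 32 : ℝ) := by
          congr 1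
          rw [Real.rpow_neg_one, ← e2]
          have h1 : √y ≠ 0 := by positivity
          rw [div_eq_iff (by positivity)]
          have := Real.mul_self_sqrt hy0.le
          field_simp
          rw [sq, this]
      _ = _ := by
          rw [Real.mul_rpow (by positivity) (by positivity), ← Real.rpow_mul hq20.le,
            ← Real.rpow_mul hy0.le]
          norm_num
  have u1 : y ^ (1 / 2 : ℝ) * y ^ (17 / 64 : ℝ) = y ^ (49 / 64 : ℝ) := by
    rw [← Real.rpow_add hy0]; norm_num
  have u2 : y * y ^ (-(1 / 4) : ℝ) ≤ y ^ (49 / 64 : ℝ) := by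
    rw [← Real.rpow_one_add' hy0.le (by norm_num)]
    exact Real.rpow_le_rpow_of_exponent_le hy (by norm_num)
  have u3 : q₂ * q₂ ^ (-(1 / 2) : ℝ) ≤ q₂ ^ (17 / 32 : ℝ) := by
    rw [← Real.rpow_one_add' hq20.le (by norm_num)]
    exact Real.rpow_le_rpow_of_exponent_le hq₂ (by norm_num)
  have u4 : q₂ * q₂ ^ (-(17 / 32) : ℝ) ≤ q₂ ^ (17 / 32 : ℝ) := by
    rw [← Real.rpow_one_add' hq20.le (by norm_num)]
    exact Real.rpow_le_rpow_of_exponent_le hq₂ (by norm_num)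
  rw [t0, e1]
  set P := q₁ ^ (17 / 32 : ℝ)
  set R := q₂ ^ (17 / 32 : ℝ)
  set Y := y ^ (49 / 64 : ℝ)
  have v1 : 64 * (7 * q₁ ^ (1 / 2 : ℝ)) * y ^ (1 / 2 : ℝ) * (N : ℝ) ^ (17 / 32 : ℝ) ≤
      896 * (P * R * Y) := by
    calc _ ≤ 64 * (7 * P) * y ^ (1 / 2 : ℝ) * (2 * (R * y ^ (17 / 64 : ℝ))) := by gcongr
      _ = 896 * (P * R * (y ^ (1 / 2 : ℝ) * y ^ (17 / 64 : ℝ))) := by ring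
      _ = _ := by rw [u1]
  have v2 : 3 * α * (7 * (q₂ * q₁ ^ (1 / 2 : ℝ))) * y * (N : ℝ) ^ ((1 / 2 : ℝ) - 1) ≤
      21 * (P * R * Y) := by
    calc _ ≤ 3 * 1 * (7 * (q₂ * P)) * y * (q₂ ^ (-(1 / 2) : ℝ) * y ^ (-(1 / 4) : ℝ)) := by gcongr
      _ = 21 * (P * (q₂ * q₂ ^ (-(1 / 2) : ℝ)) * (y * y ^ (-(1 / 4) : ℝ))) := by ring
      _ ≤ 21 * (P * R * Y) := by gcongr
  have v3 : 2 * 64 * (7 * (q₂ * q₁ ^ (1 / 2 : ℝ))) * y ^ (1 / 2 : ℝ) * (y / N) ^ (17 / 32 : ℝ) ≤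
      896 * (P * R * Y) := by
    calc _ ≤ 2 * 64 * (7 * (q₂ * P)) * y ^ (1 / 2 : ℝ) *
          (q₂ ^ (-(17 / 32) : ℝ) * y ^ (17 / 64 : ℝ)) := by gcongr
      _ = 896 * (P * (q₂ * q₂ ^ (-(17 / 32) : ℝ)) * (y ^ (1 / 2 : ℝ) * y ^ (17 / 64 : ℝ))) := by
          ring
      _ ≤ 896 * (P * R * Y) := by rw [u1]; gcongr
  linarith

end

section

open Filter Topology MeasureTheory Set Asymptotics
open scoped ArithmeticFunction.zeta

/-- Completely multiplicative functions with values in `{0, 1, -1}`. -/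
structure IsSignFunction (f : ArithmeticFunction ℝ) : Prop where
  map_one : f 1 = 1
  map_mul : ∀ m n, f (m * n) = f m * f n
  values : ∀ n, f n = 0 ∨ f n = 1 ∨ f n = -1

namespace IsSignFunction

variable {f g : ArithmeticFunction ℝ}

lemma map_pow (hf : IsSignFunction f) (n k : ℕ) : f (n ^ k) = f n ^ k := by
  induction k with
  | zero => simp [hf.map_one]
  | succ k ih => rw [pow_succ, hf.map_mul, ih, pow_succ]

lemma abs_le_one (hf : IsSignFunction f) (n : ℕ) : |f n| ≤ 1 := by
  rcases hf.values n with h | h | h <;> rw [h] <;> norm_num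

lemma isMultiplicative (hf : IsSignFunction f) : f.IsMultiplicative :=
  ⟨hf.map_one, fun _ ↦ hf.map_mul _ _⟩

lemma pmul (hf : IsSignFunction f) (hg : IsSignFunction g) : IsSignFunction (f.pmul g) where
  map_one := by simp [hf.map_one, hg.map_one]
  map_mul m n := by
    simp only [ArithmeticFunction.pmul_apply, hf.map_mul, hg.map_mul]; ring
  values n := by
    rw [ArithmeticFunction.pmul_apply]
    rcases hf.values n with h | h | h <;> rcases hg.values n with h' | h' | h' <;>
      rw [h, h'] <;> norm_num

end IsSignFunction

lemma ArithmeticFunction.mul_prime_pow (f g : ArithmeticFunction ℝ) {p : ℕ} (hp : p.Prime) (k : ℕ) :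
    (f * g) (p ^ k) = ∑ i ∈ Finset.range (k + 1), f (p ^ (k - i)) * g (p ^ i) := by
  rw [mul_comm, ArithmeticFunction.mul_apply,
    Nat.sum_divisorsAntidiagonal (f := fun x y ↦ g x * f y), Nat.sum_divisors_prime_pow hp]
  refine Finset.sum_congr rfl fun i hi ↦ ?_
  rw [Nat.pow_div (by simpa [Nat.lt_succ_iff] using hi) hp.pos, mul_comm]

/-- Nonnegativity of a multiplicative function, and values at squares, from prime powers. -/
lemma ArithmeticFunction.IsMultiplicative.nonneg_and_one_le_sq {h : ArithmeticFunction ℝ}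
    (hm : h.IsMultiplicative) (h0 : ∀ p, p.Prime → ∀ k, 0 ≤ h (p ^ k))
    (h1 : ∀ p, p.Prime → ∀ k, Even k → 1 ≤ h (p ^ k)) :
    (∀ n, 0 ≤ h n) ∧ ∀ m, 0 < m → 1 ≤ h (m ^ 2) := by
  constructor
  · intro n
    rcases Nat.eq_zero_or_pos n with rfl | hn
    · simp
    rw [hm.multiplicative_factorization h hn.ne']
    exact Finset.prod_nonneg fun p hp ↦ h0 p (Nat.prime_of_mem_primeFactors hp) _
  · intro m hm0
    rw [hm.multiplicative_factorization h (by positivity)]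
    refine Finset.prod_induction _ (fun x : ℝ ↦ 1 ≤ x) (fun x y hx hy ↦ one_le_mul_of_one_le_of_one_le hx hy)
      le_rfl fun p hp ↦ h1 p (Nat.prime_of_mem_primeFactors hp) _ ?_
    rw [Nat.factorization_pow]
    simp

lemma zeta_mul_prime_pow {f : ArithmeticFunction ℝ} (hf : IsSignFunction f) {p : ℕ}
    (hp : p.Prime) (k : ℕ) :
    ((ζ : ArithmeticFunction ℝ) * f) (p ^ k) = ∑ i ∈ Finset.range (k + 1), f p ^ i := by
  rw [ArithmeticFunction.mul_prime_pow _ _ hp]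
  refine Finset.sum_congr rfl fun i _ ↦ ?_
  rw [ArithmeticFunction.natCoe_apply, ArithmeticFunction.zeta_apply_ne
    (pow_ne_zero _ hp.ne_zero), hf.map_pow]
  simp

lemma geom_sum_sign {x : ℝ} (hx : x = 0 ∨ x = 1 ∨ x = -1) (k : ℕ) :
    0 ≤ ∑ i ∈ Finset.range (k + 1), x ^ i ∧
      (Even k → 1 ≤ ∑ i ∈ Finset.range (k + 1), x ^ i) ∧
      (x = -1 → ¬ Even k → ∑ i ∈ Finset.range (k + 1), x ^ i = 0) := by
  rcases hx with rfl | rfl | rfl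
  · simp [zero_pow_eq]
  · simp only [one_pow, Finset.sum_const, Finset.card_range, nsmul_eq_mul, mul_one, Nat.cast_add, Nat.cast_one]
    have : (0 : ℝ) ≤ k := Nat.cast_nonneg k
    exact ⟨by linarith, fun _ ↦ by linarith, fun h ↦ by norm_num at h⟩
  · rw [neg_one_geom_sum]
    simp only [Nat.even_add_one]
    split_ifs <;> simp_all

lemma zeta_mul_nonneg {f : ArithmeticFunction ℝ} (hf : IsSignFunction f) :
    (∀ n, 0 ≤ ((ζ : ArithmeticFunction ℝ) * f) n) ∧
      ∀ m, 0 < m → 1 ≤ ((ζ : ArithmeticFunction ℝ) * f) (m ^ 2) := by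
  refine (ArithmeticFunction.isMultiplicative_zeta.natCast.mul
    hf.isMultiplicative).nonneg_and_one_le_sq ?_ ?_
  · intro p hp k
    rw [zeta_mul_prime_pow hf hp]
    exact (geom_sum_sign (hf.values p) k).1
  · intro p hp k
    rw [zeta_mul_prime_pow hf hp]
    exact (geom_sum_sign (hf.values p) k).2.1

lemma mul_pmul_prime_pow {f g : ArithmeticFunction ℝ} (hf : IsSignFunction f)
    (hg : IsSignFunction g) {p : ℕ} (hp : p.Prime) (k : ℕ) :
    (g * f.pmul g) (p ^ k) = g p ^ k * ∑ i ∈ Finset.range (k + 1), f p ^ i := by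
  rw [ArithmeticFunction.mul_prime_pow _ _ hp, Finset.mul_sum]
  refine Finset.sum_congr rfl fun i hi ↦ ?_
  have hik : i ≤ k := by simpa [Nat.lt_succ_iff] using hi
  rw [(hf.pmul hg).map_pow, hg.map_pow, ArithmeticFunction.pmul_apply, mul_pow]
  calc g p ^ (k - i) * (f p ^ i * g p ^ i) = g p ^ (k - i + i) * f p ^ i := by
        rw [pow_add]; ring
    _ = _ := by rw [Nat.sub_add_cancel hik]

lemma fourfold_prime_pow_aux {f g : ArithmeticFunction ℝ} (hf : IsSignFunction f)
    (hg : IsSignFunction g) {p : ℕ} (hp : p.Prime) (h : 0 ≤ g p ∨ f p = -1) (k : ℕ) :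
    0 ≤ (((ζ : ArithmeticFunction ℝ) * f) * (g * f.pmul g)) (p ^ k) ∧
      (Even k → 1 ≤ (((ζ : ArithmeticFunction ℝ) * f) * (g * f.pmul g)) (p ^ k)) := by
  rw [ArithmeticFunction.mul_prime_pow _ _ hp]
  have hterm : ∀ i, 0 ≤ ((ζ : ArithmeticFunction ℝ) * f) (p ^ (k - i)) *
      (g * f.pmul g) (p ^ i) := by
    intro i
    refine mul_nonneg ((zeta_mul_nonneg hf).1 _) ?_
    rw [mul_pmul_prime_pow hf hg hp]
    have hs := geom_sum_sign (hf.values p) i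
    rcases h with h | h
    · exact mul_nonneg (pow_nonneg h _) hs.1
    · by_cases hi : Even i
      · exact mul_nonneg (hi.pow_nonneg _) hs.1
      · rw [hs.2.2 h hi, mul_zero]
  refine ⟨Finset.sum_nonneg fun i _ ↦ hterm i, fun hk ↦ ?_⟩
  refine le_trans ?_ (Finset.single_le_sum (fun i _ ↦ hterm i)
    (Finset.mem_range.mpr (Nat.succ_pos k) : 0 ∈ Finset.range (k + 1)))
  rw [zeta_mul_prime_pow hf hp, mul_pmul_prime_pow hf hg hp]
  simpa using (geom_sum_sign (hf.values p) k).2.1 hk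

lemma fourfold_nonneg {f g : ArithmeticFunction ℝ} (hf : IsSignFunction f)
    (hg : IsSignFunction g) :
    (∀ n, 0 ≤ (((ζ : ArithmeticFunction ℝ) * f) * (g * f.pmul g)) n) ∧
      ∀ m, 0 < m → 1 ≤ (((ζ : ArithmeticFunction ℝ) * f) * (g * f.pmul g)) (m ^ 2) := by
  have key : ∀ p, p.Prime → ∀ k, 0 ≤ (((ζ : ArithmeticFunction ℝ) * f) * (g * f.pmul g)) (p ^ k) ∧
      (Even k → 1 ≤ (((ζ : ArithmeticFunction ℝ) * f) * (g * f.pmul g)) (p ^ k)) := by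
    intro p hp k
    by_cases h : g p = -1
    · have e : ((ζ : ArithmeticFunction ℝ) * f) * (g * f.pmul g) =
          ((ζ : ArithmeticFunction ℝ) * g) * (f * g.pmul f) := by
        rw [ArithmeticFunction.pmul_comm g f, mul_mul_mul_comm]
      rw [e]
      exact fourfold_prime_pow_aux hg hf hp (Or.inr h) k
    · refine fourfold_prime_pow_aux hf hg hp (Or.inl ?_) k
      rcases hg.values p with h' | h' | h' <;> [simp [h']; simp [h']; exact absurd h' h]
  refine ((ArithmeticFunction.isMultiplicative_zeta.natCast.mul
    hf.isMultiplicative).mul (hg.isMultiplicative.mul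
      (hf.pmul hg).isMultiplicative)).nonneg_and_one_le_sq ?_ ?_
  · exact fun p hp k ↦ (key p hp k).1
  · exact fun p hp k ↦ (key p hp k).2

/-- The real part of a Dirichlet character, as an arithmetic function. -/
noncomputable def charFun {q : ℕ} (χ : DirichletCharacter ℂ q) : ArithmeticFunction ℝ :=
  ⟨fun n ↦ if n = 0 then 0 else (χ n).re, by simp⟩

section charFun

variable {q : ℕ} {χ : DirichletCharacter ℂ q}

lemma charFun_apply (χ : DirichletCharacter ℂ q) {n : ℕ} (hn : n ≠ 0) :
    charFun χ n = (χ n).re := if_neg hn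

lemma ofReal_charFun (hχ : χ.IsQuadratic) {n : ℕ} (hn : n ≠ 0) :
    ((charFun χ n : ℝ) : ℂ) = χ n := by
  rw [charFun_apply χ hn]
  rcases hχ n with h | h | h <;> rw [h] <;> simp

lemma isSignFunction_charFun (hχ : χ.IsQuadratic) : IsSignFunction (charFun χ) where
  map_one := by rw [charFun_apply χ one_ne_zero]; simp
  map_mul m n := by
    rcases eq_or_ne m 0 with rfl | hm
    · simp
    rcases eq_or_ne n 0 with rfl | hn
    · simp
    have h : ((charFun χ (m * n) : ℝ) : ℂ) = ((charFun χ m * charFun χ n : ℝ) : ℂ) := by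
      push_cast
      rw [ofReal_charFun hχ (mul_ne_zero hm hn), ofReal_charFun hχ hm, ofReal_charFun hχ hn]
      simp
    exact_mod_cast h
  values n := by
    rcases eq_or_ne n 0 with rfl | hn
    · simp
    rw [charFun_apply χ hn]
    rcases hχ n with h | h | h <;> rw [h] <;> simp

lemma sum_Ioc_char_eq_zero [NeZero q] (hχ : χ ≠ 1) (N : ℕ) :
    ∑ n ∈ Finset.Ioc N (N + q), χ n = 0 := by
  have hinj : Set.InjOn (fun n : ℕ ↦ (n : ZMod q)) (Finset.Ioc N (N + q)) := by
    intro a ha b hb hab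
    simp only [Finset.coe_Ioc, mem_Ioc] at ha hb
    have h := (ZMod.natCast_eq_natCast_iff a b q).mp hab
    rcases le_total a b with h' | h'
    · have := (Nat.modEq_iff_dvd' h').mp h
      have := Nat.eq_zero_of_dvd_of_lt this (by omega)
      omega
    · have := (Nat.modEq_iff_dvd' h').mp h.symm
      have := Nat.eq_zero_of_dvd_of_lt this (by omega)
      omega
  have himg : (Finset.Ioc N (N + q)).image (fun n : ℕ ↦ (n : ZMod q)) = Finset.univ := by
    apply Finset.eq_univ_of_card
    rw [Finset.card_image_of_injOn hinj, Nat.card_Ioc, ZMod.card]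
    omega
  rw [← MulChar.sum_eq_zero_of_ne_one hχ, ← himg, Finset.sum_image hinj]

lemma abs_partialSum_charFun_le [NeZero q] (hχ : χ ≠ 1) (hχ2 : χ.IsQuadratic) (y : ℝ) :
    |partialSum (charFun χ) y| ≤ q := by
  rw [partialSum]
  generalize ⌊y⌋₊ = N
  induction N using Nat.strong_induction_on with
  | _ N ih =>
    rcases lt_or_ge N q with h | h
    · calc _ ≤ ∑ n ∈ Finset.Ioc 0 N, |charFun χ n| := Finset.abs_sum_le_sum_abs _ _
        _ ≤ ∑ n ∈ Finset.Ioc 0 N, (1 : ℝ) :=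
            Finset.sum_le_sum fun n _ ↦ (isSignFunction_charFun hχ2).abs_le_one n
        _ = N := by simp
        _ ≤ q := by exact_mod_cast h.le
    · obtain ⟨k, rfl⟩ := Nat.exists_eq_add_of_le' h
      rw [← Finset.sum_Ioc_consecutive _ (Nat.zero_le k) (Nat.le_add_right k q)]
      have h0 : ∑ n ∈ Finset.Ioc k (k + q), charFun χ n = 0 := by
        have : ((∑ n ∈ Finset.Ioc k (k + q), charFun χ n : ℝ) : ℂ) = 0 := by
          push_cast
          rw [← sum_Ioc_char_eq_zero hχ k]
          refine Finset.sum_congr rfl fun n hn ↦ ?_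
          rw [ofReal_charFun hχ2]
          have := (Finset.mem_Ioc.mp hn).1
          omega
        exact_mod_cast this
      rw [h0, add_zero]
      exact ih k (by have := NeZero.pos q; omega)

lemma LSeries_charFun (hχ : χ.IsQuadratic) (s : ℂ) :
    LSeries (fun n ↦ ((charFun χ n : ℝ) : ℂ)) s = LSeries (fun n ↦ χ n) s :=
  LSeries_congr (fun hn ↦ ofReal_charFun hχ hn) s

end charFun

lemma LSeriesSummable_of_abs_le_one {f : ArithmeticFunction ℝ} (hf : ∀ n, |f n| ≤ 1) {s : ℂ}
    (hs : 1 < s.re) : LSeriesSummable (fun n ↦ (f n : ℂ)) s :=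
  LSeriesSummable_of_bounded_of_one_lt_re (m := 1)
    (fun n _ ↦ by simpa using hf n) hs

/-- Complexification of an arithmetic function. -/
noncomputable def ArithmeticFunction.toComplex (f : ArithmeticFunction ℝ) : ArithmeticFunction ℂ :=
  ⟨fun n ↦ (f n : ℂ), by simp⟩

lemma ArithmeticFunction.toComplex_mul (f g : ArithmeticFunction ℝ) :
    (f * g).toComplex = f.toComplex * g.toComplex := by
  ext n
  change (((f * g) n : ℝ) : ℂ) = _
  rw [ArithmeticFunction.mul_apply, ArithmeticFunction.mul_apply]
  push_cast
  rfl

lemma LSeriesSummable_mul_real {f g : ArithmeticFunction ℝ} {s : ℂ}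
    (hf : LSeriesSummable (fun n ↦ (f n : ℂ)) s) (hg : LSeriesSummable (fun n ↦ (g n : ℂ)) s) :
    LSeriesSummable (fun n ↦ ((f * g : ArithmeticFunction ℝ) n : ℂ)) s := by
  have := ArithmeticFunction.LSeriesSummable_mul (f := f.toComplex) (g := g.toComplex) hf hg
  rw [← ArithmeticFunction.toComplex_mul] at this
  exact this

lemma LSeries_mul_real {f g : ArithmeticFunction ℝ} {s : ℂ}
    (hf : LSeriesSummable (fun n ↦ (f n : ℂ)) s) (hg : LSeriesSummable (fun n ↦ (g n : ℂ)) s) :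
    LSeries (fun n ↦ ((f * g : ArithmeticFunction ℝ) n : ℂ)) s =
      LSeries (fun n ↦ (f n : ℂ)) s * LSeries (fun n ↦ (g n : ℂ)) s := by
  have := ArithmeticFunction.LSeries_mul' (f := f.toComplex) (g := g.toComplex) hf hg
  rw [← ArithmeticFunction.toComplex_mul] at this
  exact this

/-- The entire function `(s - 1) ζ(s)`. -/
noncomputable def zetaOne : ℂ → ℂ := DirichletCharacter.LFunctionTrivChar₁ 1

lemma differentiable_zetaOne : Differentiable ℂ zetaOne :=
  DirichletCharacter.differentiable_LFunctionTrivChar₁ 1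

lemma zetaOne_one : zetaOne 1 = 1 := by
  simp [zetaOne, DirichletCharacter.LFunctionTrivChar₁]

lemma abs_zeta_le_one (n : ℕ) : |(ζ : ArithmeticFunction ℝ) n| ≤ 1 := by
  rw [ArithmeticFunction.natCoe_apply, ArithmeticFunction.zeta_apply]
  split_ifs <;> simp

lemma zetaOne_eq_LSeries {s : ℂ} (hs : 1 < s.re) :
    zetaOne s = (s - 1) * LSeries (fun n ↦ ((ζ : ArithmeticFunction ℝ) n : ℂ)) s := by
  have hs1 : s ≠ 1 := by rintro rfl; simp at hs
  have h : LSeries (fun n ↦ ((ζ : ArithmeticFunction ℝ) n : ℂ)) s = riemannZeta s := by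
    rw [← ArithmeticFunction.LSeries_zeta_eq_riemannZeta hs]
    refine LSeries_congr (fun hn ↦ ?_) s
    rw [ArithmeticFunction.natCoe_apply]
    push_cast
    rfl
  rw [h, zetaOne, DirichletCharacter.LFunctionTrivChar₁, Function.update_of_ne hs1,
    DirichletCharacter.LFunctionTrivChar, DirichletCharacter.LFunction_modOne_eq]

lemma partialSum_zeta {y : ℝ} : partialSum (ζ : ArithmeticFunction ℝ) y = ⌊y⌋₊ := by
  rw [partialSum]
  simp_rw [ArithmeticFunction.natCoe_apply]
  rw_mod_cast [ArithmeticFunction.sum_Ioc_zeta]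

lemma abs_partialSum_zeta_sub_le {y : ℝ} (hy : 1 ≤ y) :
    |partialSum (ζ : ArithmeticFunction ℝ) y - 1 * y| ≤ 1 := by
  rw [partialSum_zeta, abs_le]
  have h1 := Nat.floor_le (show 0 ≤ y by linarith)
  have h2 := Nat.lt_floor_add_one y
  constructor <;> linarith

/-- `continuation_formula` at a real point left of `1`. -/
lemma continuation_formula_real {b : ℕ → ℝ} {κ C θ : ℝ} (hθ : 0 ≤ θ) (hθ1 : θ < 1)
    (hb : ∀ y, 1 ≤ y → |partialSum b y - κ * y| ≤ C * y ^ θ)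
    (hsum : ∀ s : ℂ, 1 < s.re → LSeriesSummable (fun n ↦ (b n : ℂ)) s)
    {G : ℂ → ℂ} (hG : Differentiable ℂ G)
    (hGL : ∀ s : ℂ, 1 < s.re → G s = (s - 1) * LSeries (fun n ↦ (b n : ℂ)) s)
    {δ : ℝ} (hδ : δ < 1 - θ) :
    G ((1 - δ : ℝ) : ℂ) = (((1 - δ) * (κ - δ * errorIntegral b κ δ) : ℝ) : ℂ) := by
  rw [continuation_formula hθ hθ1 hb hsum (fun s _ ↦ hG s) hGL
    (by rw [Complex.ofReal_re]; linarith), tailTransform_one_sub]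
  push_cast
  ring

lemma exists_zetaOne_eq_ofReal {δ : ℝ} (hδ0 : 0 ≤ δ) (hδ : δ < 1) :
    ∃ z : ℝ, 0 < z ∧ zetaOne ((1 - δ : ℝ) : ℂ) = z := by
  refine ⟨_, ?_, continuation_formula_real (κ := 1) (C := 1) le_rfl one_pos
    (fun y hy ↦ by simpa using abs_partialSum_zeta_sub_le hy)
    (fun s hs ↦ LSeriesSummable_of_abs_le_one abs_zeta_le_one hs) differentiable_zetaOne
    (fun s hs ↦ zetaOne_eq_LSeries hs) (by linarith)⟩
  have h : errorIntegral (ζ : ArithmeticFunction ℝ) 1 δ ≤ 0 := by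
    refine setIntegral_nonpos measurableSet_Ioi fun y hy ↦ ?_
    have hy0 : (0 : ℝ) ≤ y := by have : (1 : ℝ) < y := hy; linarith
    refine mul_nonpos_of_nonpos_of_nonneg ?_ (by positivity)
    rw [partialSum_zeta]
    linarith [Nat.floor_le hy0]
  have : 0 ≤ δ * -errorIntegral (ζ : ArithmeticFunction ℝ) 1 δ := by
    apply mul_nonneg hδ0; linarith
  apply mul_pos <;> linarith

lemma LFunction_im_eq_zero {q : ℕ} [NeZero q] {χ : DirichletCharacter ℂ q} (hχ : χ ≠ 1)
    (hχ2 : χ.IsQuadratic) {δ : ℝ} (hδ0 : 0 ≤ δ) (hδ : δ < 1) :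
    (DirichletCharacter.LFunction χ ((1 - δ : ℝ) : ℂ)).im = 0 := by
  have hcont : Continuous fun δ : ℝ ↦ (DirichletCharacter.LFunction χ ((1 - δ : ℝ) : ℂ)).im :=
    Complex.continuous_im.comp ((DirichletCharacter.differentiable_LFunction hχ).continuous.comp
      (by fun_prop))
  have hpos : ∀ δ : ℝ, δ ∈ Ioo (0 : ℝ) 1 →
      (DirichletCharacter.LFunction χ ((1 - δ : ℝ) : ℂ)).im = 0 := by
    intro δ hδ
    have h := continuation_formula_real (b := charFun χ) (κ := 0) (C := q) le_rfl one_pos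
      (fun y hy ↦ by simpa using abs_partialSum_charFun_le hχ hχ2 y)
      (fun s hs ↦ LSeriesSummable_of_abs_le_one (isSignFunction_charFun hχ2).abs_le_one hs)
      (G := fun s ↦ (s - 1) * DirichletCharacter.LFunction χ s)
      ((differentiable_id.sub_const 1).mul (DirichletCharacter.differentiable_LFunction hχ))
      (fun s hs ↦ by rw [LSeries_charFun hχ2, DirichletCharacter.LFunction_eq_LSeries χ hs])
      (δ := δ) (by linarith [hδ.2])
    have h1 : ((1 - δ : ℝ) : ℂ) - 1 = ((-δ : ℝ) : ℂ) := by push_cast; ring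
    simp only [h1] at h
    have h2 := congrArg Complex.im h
    rw [Complex.im_ofReal_mul, Complex.ofReal_im] at h2
    exact (mul_eq_zero.mp h2).resolve_left (neg_ne_zero.mpr hδ.1.ne')
  have hcl : IsClosed {δ : ℝ | (DirichletCharacter.LFunction χ ((1 - δ : ℝ) : ℂ)).im = 0} :=
    isClosed_eq hcont continuous_const
  have : Icc (0 : ℝ) 1 ⊆ {δ : ℝ | (DirichletCharacter.LFunction χ ((1 - δ : ℝ) : ℂ)).im = 0} := by
    rw [← closure_Ioo (zero_ne_one' ℝ)]
    exact hcl.closure_subset_iff.mpr hpos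
  exact this ⟨hδ0, hδ.le⟩

/-- The value `L(1 - δ, χ)` (its real part) for real `δ`. -/
noncomputable def realL {q : ℕ} [NeZero q] (χ : DirichletCharacter ℂ q) (δ : ℝ) : ℝ :=
  (DirichletCharacter.LFunction χ ((1 - δ : ℝ) : ℂ)).re

/-- The convolution `1 * χ` of a quadratic character. -/
noncomputable def convChar {q : ℕ} (χ : DirichletCharacter ℂ q) : ArithmeticFunction ℝ :=
  (ζ : ArithmeticFunction ℝ) * charFun χ

section realL

variable {q : ℕ} [NeZero q] {χ : DirichletCharacter ℂ q}

lemma ofReal_realL (hχ : χ ≠ 1) (hχ2 : χ.IsQuadratic) {δ : ℝ} (hδ0 : 0 ≤ δ) (hδ : δ < 1) :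
    DirichletCharacter.LFunction χ ((1 - δ : ℝ) : ℂ) = (realL χ δ : ℝ) := by
  apply Complex.ext
  · rw [Complex.ofReal_re]; rfl
  · rw [Complex.ofReal_im, LFunction_im_eq_zero hχ hχ2 hδ0 hδ]

lemma continuous_realL (hχ : χ ≠ 1) : Continuous (realL χ) :=
  Complex.continuous_re.comp ((DirichletCharacter.differentiable_LFunction hχ).continuous.comp
    (by fun_prop))

lemma one_le_modulus_cast : (1 : ℝ) ≤ q := by
  exact_mod_cast Nat.one_le_iff_ne_zero.mpr (NeZero.ne q)

omit [NeZero q] in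
lemma LSeriesSummable_zeta_mul (hχ2 : χ.IsQuadratic) {s : ℂ} (hs : 1 < s.re) :
    LSeriesSummable (fun n ↦ ((convChar χ) n : ℂ)) s :=
  LSeriesSummable_mul_real (LSeriesSummable_of_abs_le_one abs_zeta_le_one hs)
    (LSeriesSummable_of_abs_le_one (isSignFunction_charFun hχ2).abs_le_one hs)

lemma zetaOne_mul_LFunction_eq (hχ2 : χ.IsQuadratic) {s : ℂ} (hs : 1 < s.re) :
    zetaOne s * DirichletCharacter.LFunction χ s = (s - 1) *
      LSeries (fun n ↦ ((convChar χ) n : ℂ)) s := by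
  rw [convChar, LSeries_mul_real (LSeriesSummable_of_abs_le_one abs_zeta_le_one hs)
    (LSeriesSummable_of_abs_le_one (isSignFunction_charFun hχ2).abs_le_one hs),
    zetaOne_eq_LSeries hs, LSeries_charFun hχ2, DirichletCharacter.LFunction_eq_LSeries χ hs]
  ring

/-- The summatory function of `1 * χ` is `L(1, χ) y + O(√(q y))`. -/
lemma abs_partialSum_zeta_mul_sub_le (hχ : χ ≠ 1) (hχ2 : χ.IsQuadratic) {y : ℝ} (hy : 1 ≤ y) :
    |partialSum (convChar χ) y - realL χ 0 * y| ≤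
      7 * √q * y ^ (1 / 2 : ℝ) := by
  have hq := one_le_modulus_cast (q := q)
  obtain ⟨M, hM⟩ := exists_partialSum_mul_approx (f := (ζ : ArithmeticFunction ℝ))
    (g := charFun χ) zero_le_one le_rfl le_rfl hq
    (fun y hy ↦ abs_partialSum_zeta_sub_le hy)
    (fun y _ ↦ abs_partialSum_charFun_le hχ hχ2 y) abs_zeta_le_one
    (isSignFunction_charFun hχ2).abs_le_one
  have h := continuation_formula_real (by norm_num) (by norm_num) hM
    (fun s hs ↦ LSeriesSummable_zeta_mul hχ2 hs)
    (differentiable_zetaOne.mul (DirichletCharacter.differentiable_LFunction hχ))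
    (fun s hs ↦ zetaOne_mul_LFunction_eq hχ2 hs) (δ := 0) (by norm_num)
  simp only [Pi.mul_apply] at h
  rw [ofReal_realL hχ hχ2 le_rfl one_pos] at h
  simp only [sub_zero, Complex.ofReal_one, zetaOne_one, one_mul, zero_mul] at h
  have h' : realL χ 0 = M := by exact_mod_cast h
  have := hM y hy
  rw [h']
  simpa only [one_mul, convChar] using this

lemma zetaOne_mul_realL_eq (hχ : χ ≠ 1) (hχ2 : χ.IsQuadratic) {δ : ℝ} (hδ0 : 0 ≤ δ)
    (hδ : δ < 1 / 2) : ∃ z : ℝ, 0 < z ∧ z * realL χ δ =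
      realL χ 0 - δ * errorIntegral (convChar χ) (realL χ 0) δ := by
  obtain ⟨z, hz, hz'⟩ := exists_zetaOne_eq_ofReal hδ0 (by linarith)
  have h := continuation_formula_real (θ := 1 / 2) (by norm_num) (by norm_num)
    (fun y hy ↦ abs_partialSum_zeta_mul_sub_le hχ hχ2 hy)
    (fun s hs ↦ LSeriesSummable_zeta_mul hχ2 hs)
    (differentiable_zetaOne.mul (DirichletCharacter.differentiable_LFunction hχ))
    (fun s hs ↦ zetaOne_mul_LFunction_eq hχ2 hs) (δ := δ) (by linarith)
  simp only [Pi.mul_apply] at h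
  rw [ofReal_realL hχ hχ2 hδ0 (by linarith), hz'] at h
  have h' : z * realL χ δ = (1 - δ) * (realL χ 0 -
    δ * errorIntegral (convChar χ) (realL χ 0) δ) := by
    exact_mod_cast h
  refine ⟨z / (1 - δ), div_pos hz (by linarith), ?_⟩
  have : 1 - δ ≠ 0 := by linarith
  field_simp
  linarith

lemma realL_zero_pos (hχ : χ ≠ 1) (hχ2 : χ.IsQuadratic) : 0 < realL χ 0 := by
  have hne : realL χ 0 ≠ 0 := by
    intro h0
    have h := ofReal_realL hχ hχ2 le_rfl one_pos
    rw [h0] at h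
    simp only [sub_zero, Complex.ofReal_one, Complex.ofReal_zero] at h
    exact DirichletCharacter.LFunction_apply_one_ne_zero hχ h
  refine lt_of_le_of_ne ?_ hne.symm
  by_contra! hneg
  set c := -realL χ 0 with hc
  have hc0 : 0 < c := by linarith
  set K := 7 * √(q : ℝ) with hK
  have hK0 : 0 ≤ K := by positivity
  set t := K / c + 1 with ht
  have ht1 : 1 ≤ t := by rw [ht]; have : 0 ≤ K / c := by positivity
                         linarith
  have h := abs_partialSum_zeta_mul_sub_le hχ hχ2 (y := t ^ 2) (one_le_pow₀ ht1)
  have hpos : 0 ≤ partialSum (convChar χ) (t ^ 2) :=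
    partialSum_nonneg (zeta_mul_nonneg (isSignFunction_charFun hχ2)).1 _
  rw [← Real.sqrt_eq_rpow, Real.sqrt_sq (by linarith)] at h
  have h2 := (abs_le.mp h).2
  have h3 : c * t = K + c := by rw [ht]; field_simp
  nlinarith

/-- `L(1, χ) ≤ log q + 5.53`. -/
lemma realL_zero_le (hχ : χ ≠ 1) (hχ2 : χ.IsQuadratic) : realL χ 0 ≤ Real.log q + 5.53 := by
  have hq := one_le_modulus_cast (q := q)
  set y : ℝ := (49 / 4 : ℝ) * q with hy
  have hy1 : 1 ≤ y := by linarith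
  have h := abs_partialSum_zeta_mul_sub_le hχ hχ2 hy1
  have hS : partialSum (convChar χ) y ≤ y * (1 + Real.log y) := by
    have hfl : 1 ≤ ⌊y⌋₊ := Nat.le_floor (by exact_mod_cast hy1)
    rw [convChar, partialSum_mul _ _ y hfl, Nat.div_self hfl]
    have h1 : ∑ m ∈ Finset.Ioc 0 1, (ζ : ArithmeticFunction ℝ) m *
        (partialSum (charFun χ) (y / m) - partialSum (charFun χ) (⌊y⌋₊ : ℝ)) = 0 := by
      rw [show Finset.Ioc 0 1 = {1} by rfl, Finset.sum_singleton]
      simp [partialSum]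
    rw [h1, add_zero]
    have h2 : ∀ n ∈ Finset.Ioc 0 ⌊y⌋₊, charFun χ n *
        partialSum (ζ : ArithmeticFunction ℝ) (y / n) ≤ y * (n : ℝ)⁻¹ := by
      intro n _
      have hyn : 0 ≤ y / n := by positivity
      rw [partialSum_zeta]
      have h3 := (abs_le.mp ((isSignFunction_charFun hχ2).abs_le_one n)).2
      have h4 := Nat.floor_le hyn
      rw [div_eq_mul_inv] at h4 ⊢
      nlinarith [Nat.cast_nonneg (α := ℝ) ⌊y * (n : ℝ)⁻¹⌋₊]
    refine (Finset.sum_le_sum h2).trans ?_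
    rw [← Finset.mul_sum]
    have h5 := harmonic_floor_le_one_add_log y hy1
    rw [harmonic_eq_sum_Icc] at h5
    push_cast at h5
    exact mul_le_mul_of_nonneg_left h5 (by linarith)
  have hsq : y ^ (1 / 2 : ℝ) = 7 / 2 * √q := by
    rw [← Real.sqrt_eq_rpow, hy, Real.sqrt_mul (by norm_num),
      show (49 / 4 : ℝ) = (7 / 2) ^ 2 by norm_num, Real.sqrt_sq (by norm_num)]
  rw [hsq] at h
  have hqq : √(q : ℝ) * √q = q := Real.mul_self_sqrt (by linarith)
  have h2 := (abs_le.mp h).1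
  have hlog : Real.log y = 2 * Real.log (7 / 2) + Real.log q := by
    rw [hy, Real.log_mul (by norm_num) (by linarith),
      show (49 / 4 : ℝ) = (7 / 2) ^ 2 by norm_num, Real.log_pow]
    norm_num
  have hl7 : Real.log (7 / 2) ≤ 1.263 := by
    have h78 : Real.log (7 / 8) ≤ 7 / 8 - 1 := Real.log_le_sub_one_of_pos (by norm_num)
    rw [show (7 / 2 : ℝ) = 2 ^ 2 * (7 / 8) by norm_num, Real.log_mul (by norm_num) (by norm_num),
      Real.log_pow]
    have := Real.log_two_lt_d9
    push_cast
    linarith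
  have : y * realL χ 0 ≤ y * (Real.log q + 5.53) := by nlinarith
  exact le_of_mul_le_mul_left this (by linarith)

end realL

/-- The fourfold convolution `1 * χ₁ * χ₂ * χ₁χ₂`. -/
noncomputable def fourfold {q₁ q₂ : ℕ} (χ₁ : DirichletCharacter ℂ q₁)
    (χ₂ : DirichletCharacter ℂ q₂) : ArithmeticFunction ℝ :=
  convChar χ₁ * (charFun χ₂ * (charFun χ₁).pmul (charFun χ₂))

section fourfold

variable {q₁ q₂ : ℕ} [NeZero q₁] [NeZero q₂] [NeZero (q₁ * q₂)] {χ₁ : DirichletCharacter ℂ q₁}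
  {χ₂ : DirichletCharacter ℂ q₂} {χ₃ : DirichletCharacter ℂ (q₁ * q₂)}

omit [NeZero q₁] [NeZero q₂] [NeZero (q₁ * q₂)] in
lemma fourfold_nonneg' (h₁ : χ₁.IsQuadratic) (h₂ : χ₂.IsQuadratic) :
    (∀ n, 0 ≤ fourfold χ₁ χ₂ n) ∧ ∀ m : ℕ, 0 < m → 1 ≤ fourfold χ₁ χ₂ (m ^ 2) := by
  have h := fourfold_nonneg (isSignFunction_charFun h₁) (isSignFunction_charFun h₂)
  rw [fourfold, convChar]
  exact h

omit [NeZero q₁] [NeZero q₂] [NeZero (q₁ * q₂)] in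
lemma LSeriesSummable_fourfold (h₁ : χ₁.IsQuadratic) (h₂ : χ₂.IsQuadratic)
    {s : ℂ} (hs : 1 < s.re) : LSeriesSummable (fun n ↦ (fourfold χ₁ χ₂ n : ℂ)) s :=
  LSeriesSummable_mul_real (LSeriesSummable_zeta_mul h₁ hs)
    (LSeriesSummable_mul_real
      (LSeriesSummable_of_abs_le_one (isSignFunction_charFun h₂).abs_le_one hs)
      (LSeriesSummable_of_abs_le_one
        ((isSignFunction_charFun h₁).pmul (isSignFunction_charFun h₂)).abs_le_one hs))

/-- `(s - 1) ζ(s) L(s, χ₁) L(s, χ₂) L(s, χ₃)`. -/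
noncomputable def fourfoldL (χ₁ : DirichletCharacter ℂ q₁) (χ₂ : DirichletCharacter ℂ q₂)
    (χ₃ : DirichletCharacter ℂ (q₁ * q₂)) : ℂ → ℂ := fun s ↦
  zetaOne s * (DirichletCharacter.LFunction χ₁ s * (DirichletCharacter.LFunction χ₂ s *
    DirichletCharacter.LFunction χ₃ s))

lemma differentiable_fourfoldL (hχ₁ : χ₁ ≠ 1) (hχ₂ : χ₂ ≠ 1) (hχ₃ : χ₃ ≠ 1) :
    Differentiable ℂ (fourfoldL χ₁ χ₂ χ₃) :=
  differentiable_zetaOne.mul ((DirichletCharacter.differentiable_LFunction hχ₁).mul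
    ((DirichletCharacter.differentiable_LFunction hχ₂).mul
      (DirichletCharacter.differentiable_LFunction hχ₃)))

lemma fourfoldL_eq_LSeries (h₁ : χ₁.IsQuadratic) (h₂ : χ₂.IsQuadratic) (h₃ : χ₃.IsQuadratic)
    (hprod : charFun χ₃ = (charFun χ₁).pmul (charFun χ₂)) {s : ℂ} (hs : 1 < s.re) :
    fourfoldL χ₁ χ₂ χ₃ s = (s - 1) * LSeries (fun n ↦ (fourfold χ₁ χ₂ n : ℂ)) s := by
  rw [fourfold, ← hprod, LSeries_mul_real (LSeriesSummable_zeta_mul h₁ hs)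
    (LSeriesSummable_mul_real
      (LSeriesSummable_of_abs_le_one (isSignFunction_charFun h₂).abs_le_one hs)
      (LSeriesSummable_of_abs_le_one (isSignFunction_charFun h₃).abs_le_one hs)),
    LSeries_mul_real (LSeriesSummable_of_abs_le_one (isSignFunction_charFun h₂).abs_le_one hs)
      (LSeriesSummable_of_abs_le_one (isSignFunction_charFun h₃).abs_le_one hs),
    ← mul_assoc, ← zetaOne_mul_LFunction_eq h₁ hs, LSeries_charFun h₂, LSeries_charFun h₃,
    ← DirichletCharacter.LFunction_eq_LSeries χ₂ hs,
    ← DirichletCharacter.LFunction_eq_LSeries χ₃ hs, fourfoldL]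
  ring

lemma abs_partialSum_fourfold_sub_le (hχ₁ : χ₁ ≠ 1) (hχ₂ : χ₂ ≠ 1) (hχ₃ : χ₃ ≠ 1)
    (h₁ : χ₁.IsQuadratic) (h₂ : χ₂.IsQuadratic) (h₃ : χ₃.IsQuadratic)
    (hprod : charFun χ₃ = (charFun χ₁).pmul (charFun χ₂)) (hlam : realL χ₁ 0 ≤ 1)
    {y : ℝ} (hy : 1 ≤ y) :
    |partialSum (fourfold χ₁ χ₂) y - realL χ₁ 0 * realL χ₂ 0 * realL χ₃ 0 * y| ≤
      1813 * ((q₁ : ℝ) * q₂) ^ (17 / 32 : ℝ) * y ^ (49 / 64 : ℝ) := by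
  have hq₁ := one_le_modulus_cast (q := q₁)
  have hq₂ := one_le_modulus_cast (q := q₂)
  have hs1 := (isSignFunction_charFun h₁).abs_le_one
  have hs2 := (isSignFunction_charFun h₂).abs_le_one
  have hs3 := ((isSignFunction_charFun h₁).pmul (isSignFunction_charFun h₂)).abs_le_one
  obtain ⟨M', hM'⟩ := exists_partialSum_mul_approx (f := charFun χ₂)
    (g := (charFun χ₁).pmul (charFun χ₂)) (α := 0) le_rfl zero_le_one hq₂
    (le_mul_of_one_le_left (by linarith) hq₁)
    (fun y _ ↦ by simpa using abs_partialSum_charFun_le hχ₂ h₂ y)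
    (fun y _ ↦ by
      rw [← hprod]; exact_mod_cast abs_partialSum_charFun_le hχ₃ h₃ y) hs2 hs3
  have hsq : √((q₂ : ℝ) * (q₁ * q₂)) = q₂ * √(q₁ : ℝ) := by
    rw [show (q₂ : ℝ) * (q₁ * q₂) = q₂ ^ 2 * q₁ by ring, Real.sqrt_mul (by positivity),
      Real.sqrt_sq (by linarith)]
  obtain ⟨κ, hκ⟩ := exists_partialSum_mul_mul_approx
    (a := convChar χ₁)
    (c := charFun χ₂ * (charFun χ₁).pmul (charFun χ₂)) (q₁ := q₁) (q₂ := q₂)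
    (realL_zero_pos hχ₁ h₁).le hlam hq₁ hq₂ (fun y hy ↦ abs_partialSum_zeta_mul_sub_le hχ₁ h₁ hy)
    (fun y hy ↦ by simpa only [hsq, zero_mul, sub_zero] using hM' y hy)
    (sum_abs_mul_div_sqrt_le abs_zeta_le_one hs1) (sum_abs_mul_div_sqrt_le hs2 hs3)
  have h := continuation_formula_real (by norm_num) (by norm_num) hκ
    (fun s hs ↦ LSeriesSummable_fourfold h₁ h₂ hs)
    (differentiable_fourfoldL hχ₁ hχ₂ hχ₃)
    (fun s hs ↦ fourfoldL_eq_LSeries h₁ h₂ h₃ hprod hs) (δ := 0) (by norm_num)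
  rw [fourfoldL, ofReal_realL hχ₁ h₁ le_rfl one_pos, ofReal_realL hχ₂ h₂ le_rfl one_pos,
    ofReal_realL hχ₃ h₃ le_rfl one_pos] at h
  simp only [sub_zero, Complex.ofReal_one, zetaOne_one, one_mul, zero_mul] at h
  have h' : realL χ₁ 0 * realL χ₂ 0 * realL χ₃ 0 = κ := by
    rw [mul_assoc]; exact_mod_cast h
  rw [h']
  exact hκ y hy

end fourfold

end

section

open Filter Topology MeasureTheory Set Asymptotics

lemma sum_inv_sq_twenty_ge (x : ℝ) :
    1.596 - 20 / x ≤ ∑ m ∈ Finset.Icc 1 20, (1 / ((m : ℕ) : ℝ) ^ 2 - 1 / x) := by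
  rw [Finset.sum_sub_distrib]
  have h1 : (1.596 : ℝ) ≤ ∑ m ∈ Finset.Icc 1 20, 1 / ((m : ℕ) : ℝ) ^ 2 := by
    norm_num [Finset.sum_Icc_succ_top]
  have h2 : ∑ m ∈ Finset.Icc 1 20, 1 / x = 20 / x := by
    simp; ring
  rw [h2]
  linarith

lemma pow_le_exp_of_le {n : ℕ} {t : ℝ} (h : (n : ℝ) ≤ t) : (2.7 : ℝ) ^ n ≤ Real.exp t := by
  have h1 : (2.7 : ℝ) ≤ Real.exp 1 := by linarith [Real.exp_one_gt_d9]
  calc (2.7 : ℝ) ^ n ≤ Real.exp 1 ^ n := by gcongr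
    _ = Real.exp n := by rw [← Real.exp_nat_mul, mul_one]
    _ ≤ _ := Real.exp_le_exp.mpr h

/-- A quadratic character whose `L`-function is tiny at `1` has a real zero close to `1`. -/
lemma exists_realL_eq_zero {q : ℕ} [NeZero q] {χ : DirichletCharacter ℂ q} (hχ : χ ≠ 1)
    (hχ2 : χ.IsQuadratic) {ℓ : ℝ} (hℓ : 26 ≤ ℓ) (hq : ℓ ≤ Real.log q)
    (hlam : realL χ 0 ≤ 0.4757 / ℓ * Real.exp (-(Real.log q / ℓ))) :
    ∃ δ ∈ Ioo (0 : ℝ) (0.15 / ℓ), realL χ δ = 0 := by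
  have hq1 := one_le_modulus_cast (q := q)
  have hℓ0 : 0 < ℓ := by linarith
  set t := Real.log q with ht
  have hqt : (q : ℝ) = Real.exp t := (Real.exp_log (by linarith)).symm
  set δ := 0.15 / ℓ with hδ
  have hδ0 : 0 < δ := by positivity
  have hδ1 : δ ≤ 0.006 := by rw [hδ, div_le_iff₀ hℓ0]; linarith
  have hpos := realL_zero_pos hχ hχ2
  suffices hneg : realL χ δ < 0 by
    obtain ⟨d, hd, hd0⟩ := intermediate_value_Ioo' hδ0.le (continuous_realL hχ).continuousOn
      (show (0 : ℝ) ∈ Ioo (realL χ δ) (realL χ 0) from ⟨hneg, hpos⟩)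
    exact ⟨d, hd, hd0⟩
  obtain ⟨z, hz, hzL⟩ := zetaOne_mul_realL_eq hχ hχ2 hδ0.le (by linarith)
  have hb := fun y hy ↦ abs_partialSum_zeta_mul_sub_le hχ hχ2 (y := y) hy
  have hnn := zeta_mul_nonneg (isSignFunction_charFun hχ2)
  set x : ℝ := Real.exp (1.5 * t) with hx
  have hx1 : 1 ≤ x := Real.one_le_exp (by linarith)
  have hx39 : (2.7 : ℝ) ^ 39 ≤ x := pow_le_exp_of_le (by push_cast; linarith)
  have hx400 : ((20 : ℕ) : ℝ) ^ 2 ≤ x := by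
    refine le_trans ?_ hx39
    norm_num
  have hsplit := errorIntegral_split hb hδ0 (by linarith) hx1
  have herr := abs_integral_Ioi_error_le hb (by linarith : δ < 1 - 1 / 2) hx1
  have hlow := integral_partialSum_ge hb hδ0.le (by linarith : δ < 1 - 1 / 2) hnn.1 hnn.2 20 hx400
  have hlow' := (sum_inv_sq_twenty_ge x).trans hlow
  have hxδ : realL χ 0 * x ^ δ ≤ δ * 1.53 := by
    have e1 : x ^ δ = Real.exp (0.225 * (t / ℓ)) := by
      rw [hx, ← Real.exp_mul, hδ]; congr 1; field_simp; ring
    have hu : 1 ≤ t / ℓ := (one_le_div hℓ0).mpr hq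
    have e2 : Real.exp (-(t / ℓ)) * x ^ δ ≤ Real.exp (-0.775) := by
      rw [e1, ← Real.exp_add, Real.exp_le_exp]; linarith
    have e3 : Real.exp (-0.775) ≤ 1 / 2.075 := by
      rw [Real.exp_neg, one_div]
      apply inv_anti₀ (by norm_num)
      have := Real.quadratic_le_exp_of_nonneg (x := 0.775) (by norm_num)
      norm_num at this ⊢
      linarith
    calc realL χ 0 * x ^ δ ≤ 0.4757 / ℓ * Real.exp (-(t / ℓ)) * x ^ δ := by gcongr
      _ = 0.4757 / ℓ * (Real.exp (-(t / ℓ)) * x ^ δ) := by ring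
      _ ≤ 0.4757 / ℓ * (1 / 2.075) := by gcongr; exact e2.trans e3
      _ ≤ δ * 1.53 := by
        rw [hδ, div_mul_eq_mul_div, div_mul_eq_mul_div]
        exact div_le_div_of_nonneg_right (by norm_num) hℓ0.le
  have herr' : 7 * √q * x ^ (1 / 2 + δ - 1) / (1 - 1 / 2 - δ) ≤ 0.04 := by
    have e1 : √(q : ℝ) * x ^ (1 / 2 + δ - 1) ≤ Real.exp (-6.2) := by
      rw [hx, ← Real.exp_mul, Real.sqrt_eq_rpow, hqt, ← Real.exp_mul, ← Real.exp_add,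
        Real.exp_le_exp]
      nlinarith
    have e2 : Real.exp (-6.2) ≤ 1 / 2.7 ^ 6 := by
      rw [Real.exp_neg, one_div]
      exact inv_anti₀ (by norm_num) (pow_le_exp_of_le (by norm_num))
    rw [div_le_iff₀ (by linarith), mul_assoc]
    have := e1.trans e2
    norm_num at this ⊢
    linarith
  have hx20 : 20 / x ≤ 0.01 := by
    rw [div_le_iff₀ (by linarith)]
    norm_num at hx400
    linarith
  have h1 := (abs_le.mp (herr.trans herr')).1
  have : z * realL χ δ < 0 := by
    rw [hzL, hsplit]
    nlinarith
  exact neg_of_mul_neg_right this hz.le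

lemma kernel_sub_ge {δ δ' s : ℝ} (hδ0 : 0 < δ) (hδ : δ < δ') (hs : 0 ≤ s) (hs' : s * δ' ≤ 0.9) :
    0.01 * (δ' - δ) ≤ δ' * Real.exp (-s * δ') - δ * Real.exp (-s * δ) := by
  have h1 : Real.exp (-s * δ) * (1 - s * (δ' - δ)) ≤ Real.exp (-s * δ') := by
    have : Real.exp (-s * δ') = Real.exp (-s * δ) * Real.exp (-s * (δ' - δ)) := by
      rw [← Real.exp_add]; congr 1; ring
    rw [this]
    gcongr
    linarith [Real.add_one_le_exp (-s * (δ' - δ))]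
  have hsδ : s * δ ≤ s * δ' := by gcongr
  have h2 : 0.1 ≤ Real.exp (-s * δ) := by linarith [Real.add_one_le_exp (-s * δ)]
  have h3 : Real.exp (-s * δ) * ((δ' - δ) * (1 - s * δ')) ≤
      δ' * Real.exp (-s * δ') - δ * Real.exp (-s * δ) := by
    nlinarith [mul_le_mul_of_nonneg_left h1 (hδ0.trans hδ).le]
  refine le_trans ?_ h3
  have h4 : 0.1 * (δ' - δ) ≤ (δ' - δ) * (1 - s * δ') := by nlinarith
  nlinarith

lemma kernel_sub_le {δ δ' s : ℝ} (hδ0 : 0 < δ) (hδ : δ < δ') (hs : 0 ≤ s) :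
    |δ' * Real.exp (s * δ') - δ * Real.exp (s * δ)| ≤ (δ' - δ) * Real.exp (s * (δ + δ')) := by
  have h0 : Real.exp (s * δ) ≤ Real.exp (s * δ') := by gcongr
  have h1 : Real.exp (s * δ') * (1 - s * (δ' - δ)) ≤ Real.exp (s * δ) := by
    have : Real.exp (s * δ) = Real.exp (s * δ') * Real.exp (-s * (δ' - δ)) := by
      rw [← Real.exp_add]; congr 1; ring
    rw [this]
    gcongr
    linarith [Real.add_one_le_exp (-s * (δ' - δ))]
  have h2 : Real.exp (s * (δ + δ')) = Real.exp (s * δ) * Real.exp (s * δ') := by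
    rw [← Real.exp_add]; congr 1; ring
  have h3 : 1 + s * δ ≤ Real.exp (s * δ) := by linarith [Real.add_one_le_exp (s * δ)]
  have hpos := Real.exp_pos (s * δ')
  have hpos' := Real.exp_pos (s * δ)
  rw [abs_of_nonneg (by nlinarith), h2]
  calc _ ≤ (δ' - δ) * ((1 + s * δ) * Real.exp (s * δ')) := by nlinarith
    _ ≤ _ := by
      have : 0 ≤ δ' - δ := by linarith
      gcongr

/-- Monotonicity in `δ` of `-x ^ (-δ) * (κ - δ * errorIntegral b κ δ)`. -/
lemma rpow_neg_mul_errorIntegral_sub_ge {b : ℕ → ℝ} {κ C θ : ℝ}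
    (hb : ∀ y, 1 ≤ y → |partialSum b y - κ * y| ≤ C * y ^ θ) (hb0 : ∀ n, 0 ≤ b n)
    (hsq : ∀ m, 0 < m → 1 ≤ b (m ^ 2)) {δ δ' x : ℝ} (hδ0 : 0 < δ) (hδ : δ < δ')
    (hδ' : δ + δ' < 1 - θ) (hx400 : ((20 : ℕ) : ℝ) ^ 2 ≤ x) (hx : Real.log x * δ' ≤ 0.9) :
    (δ' - δ) * (0.015 - C * x ^ (θ - 1) / (1 - θ - δ - δ')) ≤
      x ^ (-δ) * (κ - δ * errorIntegral b κ δ) - x ^ (-δ') * (κ - δ' * errorIntegral b κ δ') := by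
  have hx1 : 1 ≤ x := by norm_num at hx400; linarith
  have hx0 : 0 < x := by linarith
  have hδ'0 : 0 < δ' := by linarith
  have hd : δ < 1 - θ := by linarith
  have hd' : δ' < 1 - θ := by linarith
  rw [errorIntegral_split hb hδ0 hd hx1, errorIntegral_split hb hδ'0 hd' hx1]
  set I := ∫ y in Ioc 1 x, partialSum b y * y ^ (δ - 2)
  set I' := ∫ y in Ioc 1 x, partialSum b y * y ^ (δ' - 2)
  set J := ∫ y in Ioi x, (partialSum b y - κ * y) * y ^ (δ - 2)
  set J' := ∫ y in Ioi x, (partialSum b y - κ * y) * y ^ (δ' - 2)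
  have hcancel : ∀ d : ℝ, x ^ (-d) * x ^ d = 1 := fun d ↦ by
    rw [← Real.rpow_add hx0]; simp
  have hrw : x ^ (-δ) * (κ * x ^ δ - δ * I - δ * J) - x ^ (-δ') * (κ * x ^ δ' - δ' * I' - δ' * J')
      = (δ' * x ^ (-δ') * I' - δ * x ^ (-δ) * I) + (δ' * x ^ (-δ') * J' - δ * x ^ (-δ) * J) := by
    linear_combination κ * hcancel δ - κ * hcancel δ'
  rw [hrw]
  have hintegrable := fun d (hd : d < 1 - θ) ↦ integrableOn_partialSum_Ioc (x := x) hb hd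
  have hint2 := fun d (hd : d < 1 - θ) ↦ integrableOn_rpow_bound (x := x) (σ := d - 2)
    (measurable_partialSum_sub b κ) hx1 hb (by linarith)
  have hI : 0.015 * (δ' - δ) ≤ δ' * x ^ (-δ') * I' - δ * x ^ (-δ) * I := by
    have hlow := (sum_inv_sq_twenty_ge x).trans (integral_partialSum_ge hb le_rfl
      (by linarith : 0 < 1 - θ) hb0 hsq 20 hx400)
    have h20 : 20 / x ≤ 0.05 := by
      rw [div_le_iff₀ (by linarith)]; norm_num at hx400; linarith
    have h1 : 0.01 * (δ' - δ) * (∫ y in Ioc 1 x, partialSum b y * y ^ ((0 : ℝ) - 2)) ≤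
        δ' * x ^ (-δ') * I' - δ * x ^ (-δ) * I := by
      rw [← integral_const_mul, ← integral_const_mul, ← integral_const_mul,
        ← integral_sub ((hintegrable δ' hd').const_mul _) ((hintegrable δ hd).const_mul _)]
      refine setIntegral_mono_on ((hintegrable 0 (by linarith)).const_mul _)
        (((hintegrable δ' hd').const_mul _).sub ((hintegrable δ hd).const_mul _)) measurableSet_Ioc ?_
      intro y hy
      have hy0 : 0 < y := by linarith [hy.1]
      have hS := partialSum_nonneg hb0 y
      have hk := kernel_sub_ge hδ0 hδ (s := Real.log x - Real.log y)
        (by linarith [Real.log_le_log hy0 hy.2])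
        (by nlinarith [Real.log_nonneg hy.1.le])
      have e : ∀ d : ℝ, x ^ (-d) * y ^ (d - 2) =
          Real.exp (-(Real.log x - Real.log y) * d) * y ^ ((0 : ℝ) - 2) := by
        intro d
        rw [Real.rpow_def_of_pos hx0, Real.rpow_def_of_pos hy0, Real.rpow_def_of_pos hy0,
          ← Real.exp_add, ← Real.exp_add]
        congr 1; ring
      have e2 : δ' * x ^ (-δ') * (partialSum b y * y ^ (δ' - 2)) -
          δ * x ^ (-δ) * (partialSum b y * y ^ (δ - 2)) =
          (δ' * Real.exp (-(Real.log x - Real.log y) * δ') -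
            δ * Real.exp (-(Real.log x - Real.log y) * δ)) *
            (partialSum b y * y ^ ((0 : ℝ) - 2)) := by
        linear_combination δ' * partialSum b y * e δ' - δ * partialSum b y * e δ
      rw [e2]
      exact mul_le_mul_of_nonneg_right hk (mul_nonneg hS (by positivity))
    nlinarith
  have hJ : |δ' * x ^ (-δ') * J' - δ * x ^ (-δ) * J| ≤
      (δ' - δ) * (C * x ^ (θ - 1) / (1 - θ - δ - δ')) := by
    rw [← integral_const_mul, ← integral_const_mul,
        ← integral_sub ((hint2 δ' hd').const_mul _) ((hint2 δ hd).const_mul _)]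
    have hp : θ + δ + δ' - 2 < -1 := by linarith
    have hval := integral_Ioi_rpow_of_lt hp hx0
    have hbound : ∀ᵐ y ∂(volume.restrict (Ioi x)),
        ‖δ' * x ^ (-δ') * ((partialSum b y - κ * y) * y ^ (δ' - 2)) -
          δ * x ^ (-δ) * ((partialSum b y - κ * y) * y ^ (δ - 2))‖ ≤
        ((δ' - δ) * C * x ^ (-(δ + δ'))) * y ^ (θ + δ + δ' - 2) := by
      refine (ae_restrict_iff' measurableSet_Ioi).mpr (.of_forall fun y hy ↦ ?_)
      have hxy : x < y := hy
      have hy0 : 0 < y := by linarith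
      have hk := kernel_sub_le hδ0 hδ (s := Real.log y - Real.log x)
        (by linarith [Real.log_le_log hx0 hxy.le])
      have e : ∀ d : ℝ, x ^ (-d) * y ^ (d - 2) =
          Real.exp ((Real.log y - Real.log x) * d) * y ^ ((0 : ℝ) - 2) := by
        intro d
        rw [Real.rpow_def_of_pos hx0, Real.rpow_def_of_pos hy0, Real.rpow_def_of_pos hy0,
          ← Real.exp_add, ← Real.exp_add]
        congr 1; ring
      have e2 : δ' * x ^ (-δ') * ((partialSum b y - κ * y) * y ^ (δ' - 2)) -
          δ * x ^ (-δ) * ((partialSum b y - κ * y) * y ^ (δ - 2)) =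
          (δ' * Real.exp ((Real.log y - Real.log x) * δ') -
            δ * Real.exp ((Real.log y - Real.log x) * δ)) *
            (partialSum b y - κ * y) * y ^ ((0 : ℝ) - 2) := by
        linear_combination δ' * (partialSum b y - κ * y) * e δ' -
          δ * (partialSum b y - κ * y) * e δ
      have e3 : x ^ (-(δ + δ')) * y ^ (θ + δ + δ' - 2) =
          Real.exp ((Real.log y - Real.log x) * (δ + δ')) * y ^ θ * y ^ ((0 : ℝ) - 2) := by
        rw [Real.rpow_def_of_pos hx0, Real.rpow_def_of_pos hy0, Real.rpow_def_of_pos hy0,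
          Real.rpow_def_of_pos hy0, ← Real.exp_add, ← Real.exp_add, ← Real.exp_add]
        congr 1; ring
      rw [e2, Real.norm_eq_abs, abs_mul, abs_mul, abs_of_nonneg (by positivity : 0 ≤ y ^ ((0:ℝ) - 2))]
      have hE := hb y (by linarith)
      calc _ ≤ ((δ' - δ) * Real.exp ((Real.log y - Real.log x) * (δ + δ'))) * (C * y ^ θ) *
            y ^ ((0 : ℝ) - 2) := by
            have : 0 ≤ δ' - δ := by linarith
            gcongr
        _ = _ := by linear_combination -(δ' - δ) * C * e3
    have hle := norm_integral_le_of_norm_le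
      ((integrableOn_Ioi_rpow_of_lt hp hx0).const_mul _) hbound
    rw [integral_const_mul, hval, Real.norm_eq_abs] at hle
    refine hle.trans (le_of_eq ?_)
    have e4 : x ^ (-(δ + δ')) * x ^ (θ + δ + δ' - 2 + 1) = x ^ (θ - 1) := by
      rw [← Real.rpow_add hx0]; congr 1; ring
    have h5 : 1 - θ - δ - δ' ≠ 0 := by linarith
    have h6 : θ + δ + δ' - 2 + 1 ≠ 0 := by linarith
    rw [← e4]
    field_simp
    ring
  linarith [(abs_le.mp hJ).1]

section zeros

variable {q₁ q₂ : ℕ} [NeZero q₁] [NeZero q₂] [NeZero (q₁ * q₂)] {χ₁ : DirichletCharacter ℂ q₁}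
  {χ₂ : DirichletCharacter ℂ q₂} {χ₃ : DirichletCharacter ℂ (q₁ * q₂)}

lemma fourfoldL_re_eq (hχ₁ : χ₁ ≠ 1) (hχ₂ : χ₂ ≠ 1) (hχ₃ : χ₃ ≠ 1)
    (h₁ : χ₁.IsQuadratic) (h₂ : χ₂.IsQuadratic) (h₃ : χ₃.IsQuadratic)
    (hprod : charFun χ₃ = (charFun χ₁).pmul (charFun χ₂)) (hlam : realL χ₁ 0 ≤ 1)
    {δ : ℝ} (hδ : δ < 15 / 64) :
    (fourfoldL χ₁ χ₂ χ₃ ((1 - δ : ℝ) : ℂ)).re =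
      (1 - δ) * (realL χ₁ 0 * realL χ₂ 0 * realL χ₃ 0 -
        δ * errorIntegral (fourfold χ₁ χ₂) (realL χ₁ 0 * realL χ₂ 0 * realL χ₃ 0) δ) := by
  rw [continuation_formula_real (by norm_num) (by norm_num)
    (fun y hy ↦ abs_partialSum_fourfold_sub_le hχ₁ hχ₂ hχ₃ h₁ h₂ h₃ hprod hlam hy)
    (fun s hs ↦ LSeriesSummable_fourfold h₁ h₂ hs)
    (differentiable_fourfoldL hχ₁ hχ₂ hχ₃)
    (fun s hs ↦ fourfoldL_eq_LSeries h₁ h₂ h₃ hprod hs) (by norm_num; linarith),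
    Complex.ofReal_re]

lemma eq_zero_of_realL_eq_zero (hχ₁ : χ₁ ≠ 1) (hχ₂ : χ₂ ≠ 1) (hχ₃ : χ₃ ≠ 1)
    (h₁ : χ₁.IsQuadratic) (h₂ : χ₂.IsQuadratic) (h₃ : χ₃.IsQuadratic)
    (hprod : charFun χ₃ = (charFun χ₁).pmul (charFun χ₂)) (hlam : realL χ₁ 0 ≤ 1)
    {δ : ℝ} (hδ0 : 0 ≤ δ) (hδ : δ < 15 / 64) (h : realL χ₁ δ = 0 ∨ realL χ₂ δ = 0) :
    realL χ₁ 0 * realL χ₂ 0 * realL χ₃ 0 -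
      δ * errorIntegral (fourfold χ₁ χ₂) (realL χ₁ 0 * realL χ₂ 0 * realL χ₃ 0) δ = 0 := by
  have key := fourfoldL_re_eq hχ₁ hχ₂ hχ₃ h₁ h₂ h₃ hprod hlam hδ
  have : fourfoldL χ₁ χ₂ χ₃ ((1 - δ : ℝ) : ℂ) = 0 := by
    rw [fourfoldL, ofReal_realL hχ₁ h₁ hδ0 (by linarith), ofReal_realL hχ₂ h₂ hδ0 (by linarith)]
    rcases h with h | h <;> simp [h]
  rw [this, Complex.zero_re] at key
  exact (mul_eq_zero.mp key.symm).resolve_left (by linarith)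

lemma hasDerivAt_fourfoldL_of_zeros (hχ₁ : χ₁ ≠ 1) (hχ₂ : χ₂ ≠ 1) (hχ₃ : χ₃ ≠ 1)
    (h₁ : χ₁.IsQuadratic) (h₂ : χ₂.IsQuadratic)
    {δ : ℝ} (hδ0 : 0 ≤ δ) (hδ : δ < 1) (hz₁ : realL χ₁ δ = 0) (hz₂ : realL χ₂ δ = 0) :
    HasDerivAt (fun d : ℝ ↦ (fourfoldL χ₁ χ₂ χ₃ ((1 - d : ℝ) : ℂ)).re) 0 δ := by
  have hz₁' : DirichletCharacter.LFunction χ₁ (1 - (δ : ℂ)) = 0 := by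
    have := ofReal_realL hχ₁ h₁ hδ0 hδ
    rw [hz₁] at this; push_cast at this; exact this
  have hz₂' : DirichletCharacter.LFunction χ₂ (1 - (δ : ℂ)) = 0 := by
    have := ofReal_realL hχ₂ h₂ hδ0 hδ
    rw [hz₂] at this; push_cast at this; exact this
  have hd : ∀ f : ℂ → ℂ, Differentiable ℂ f →
      HasDerivAt f (deriv f (1 - (δ : ℂ))) (1 - (δ : ℂ)) := fun f hf ↦ (hf _).hasDerivAt
  have hG := (hd _ differentiable_zetaOne).mul
    ((hd _ (DirichletCharacter.differentiable_LFunction hχ₁)).mul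
      ((hd _ (DirichletCharacter.differentiable_LFunction hχ₂)).mul
        (hd _ (DirichletCharacter.differentiable_LFunction hχ₃))))
  simp only [Pi.mul_apply, hz₁', hz₂', zero_mul, mul_zero, add_zero] at hG
  have hin : HasDerivAt (fun z : ℂ ↦ 1 - z) (-1) (δ : ℂ) := by
    simpa using (hasDerivAt_id (δ : ℂ)).const_sub 1
  have h2 := (hG.comp (δ : ℂ) hin).real_of_complex
  simp only [zero_mul, Complex.zero_re] at h2
  refine h2.congr_of_eventuallyEq (.of_forall fun x ↦ ?_)
  simp [fourfoldL]

/-- In a suitable range next to `1`, the zeros of `L(s, χ₁)` and `L(s, χ₂)` cannot coexist. -/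
lemma not_realL_eq_zero_of_small (hχ₁ : χ₁ ≠ 1) (hχ₂ : χ₂ ≠ 1) (hχ₃ : χ₃ ≠ 1)
    (h₁ : χ₁.IsQuadratic) (h₂ : χ₂.IsQuadratic) (h₃ : χ₃.IsQuadratic)
    (hprod : charFun χ₃ = (charFun χ₁).pmul (charFun χ₂)) (hlam : realL χ₁ 0 ≤ 1)
    (ht : 52 ≤ Real.log (q₁ * q₂)) {δ₁ δ₂ : ℝ} (hδ₁ : 0 < δ₁) (hδ₂ : 0 < δ₂)
    (hs₁ : 4 * Real.log (q₁ * q₂) * δ₁ ≤ 0.9) (hs₂ : 4 * Real.log (q₁ * q₂) * δ₂ ≤ 0.9)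
    (hz₁ : realL χ₁ δ₁ = 0) (hz₂ : realL χ₂ δ₂ = 0) : False := by
  set t := Real.log (q₁ * q₂) with htdef
  have hb := fun y hy ↦ abs_partialSum_fourfold_sub_le hχ₁ hχ₂ hχ₃ h₁ h₂ h₃ hprod hlam (y := y) hy
  have hz := fun δ h0 h1 h ↦ eq_zero_of_realL_eq_zero hχ₁ hχ₂ hχ₃ h₁ h₂ h₃ hprod hlam
    (δ := δ) h0 h1 h
  have hre := fun δ hδ ↦ fourfoldL_re_eq hχ₁ hχ₂ hχ₃ h₁ h₂ h₃ hprod hlam (δ := δ) hδ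
  have hnn := fourfold_nonneg' h₁ h₂
  set κ := realL χ₁ 0 * realL χ₂ 0 * realL χ₃ 0
  set b := fourfold χ₁ χ₂
  have hQ : (q₁ : ℝ) * q₂ = Real.exp t := by
    have := one_le_modulus_cast (q := q₁)
    have := one_le_modulus_cast (q := q₂)
    exact (Real.exp_log (by positivity)).symm
  rw [hQ] at hb
  set x := Real.exp (4 * t) with hx
  have hlogx : Real.log x = 4 * t := Real.log_exp _
  have hx400 : ((20 : ℕ) : ℝ) ^ 2 ≤ x := by
    have := pow_le_exp_of_le (n := 200) (t := 4 * t) (by push_cast; linarith)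
    refine le_trans ?_ this
    norm_num
  have hsmall : ∀ δ : ℝ, 0 < δ → 4 * t * δ ≤ 0.9 → δ < 0.005 := by
    intro δ h0 h; by_contra! hc; nlinarith
  have hmono : ∀ δ δ' : ℝ, 0 < δ → δ < δ' → 4 * t * δ' ≤ 0.9 → 0.01 * (δ' - δ) ≤
      x ^ (-δ) * (κ - δ * errorIntegral b κ δ) - x ^ (-δ') * (κ - δ' * errorIntegral b κ δ') := by
    intro δ δ' h0 hlt h
    have hs := hsmall δ' (h0.trans hlt) h
    refine le_trans ?_ (rpow_neg_mul_errorIntegral_sub_ge hb hnn.1 hnn.2 h0 hlt (by norm_num; linarith)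
      hx400 (by rw [hlogx]; exact h))
    have he : 1813 * Real.exp t ^ (17 / 32 : ℝ) * x ^ ((49 / 64 : ℝ) - 1) ≤ 1813 / 2.7 ^ 21 := by
      rw [hx, ← Real.exp_mul, ← Real.exp_mul, mul_assoc, ← Real.exp_add,
        show (1813 : ℝ) / 2.7 ^ 21 = 1813 * (2.7 ^ 21)⁻¹ from div_eq_mul_inv _ _]
      gcongr
      rw [show t * (17 / 32) + 4 * t * (49 / 64 - 1) = -(t * (13 / 32)) by ring, Real.exp_neg]
      exact inv_anti₀ (by norm_num) (pow_le_exp_of_le (by push_cast; linarith))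
    have he2 : 1813 * Real.exp t ^ (17 / 32 : ℝ) * x ^ ((49 / 64 : ℝ) - 1) /
        (1 - 49 / 64 - δ - δ') ≤ 0.005 := by
      rw [div_le_iff₀ (by linarith)]
      refine he.trans ?_
      norm_num
      linarith
    rw [mul_comm]
    have : 0 ≤ δ' - δ := by linarith
    gcongr
    linarith
  have hH₁ := hz δ₁ hδ₁.le (by linarith [hsmall δ₁ hδ₁ hs₁]) (.inl hz₁)
  have hH₂ := hz δ₂ hδ₂.le (by linarith [hsmall δ₂ hδ₂ hs₂]) (.inr hz₂)
  rcases lt_trichotomy δ₁ δ₂ with h | h | h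
  · have := hmono δ₁ δ₂ hδ₁ h hs₂
    rw [hH₁, hH₂] at this
    linarith
  · subst h
    have hder := hasDerivAt_fourfoldL_of_zeros (χ₃ := χ₃) hχ₁ hχ₂ hχ₃ h₁ h₂ hδ₁.le
      (by linarith [hsmall δ₁ hδ₁ hs₁]) hz₁ hz₂
    have hval : (fourfoldL χ₁ χ₂ χ₃ ((1 - δ₁ : ℝ) : ℂ)).re = 0 := by
      rw [hre _ (by linarith [hsmall δ₁ hδ₁ hs₁]), hH₁, mul_zero]
    have hlo := hder.isLittleO.def (show (0 : ℝ) < 0.005 by norm_num)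
    have hev : ∀ᶠ d in 𝓝[<] δ₁, d ∈ Ioo 0 δ₁ := Ioo_mem_nhdsLT hδ₁
    obtain ⟨d, hd, hdl⟩ := (hev.and (nhdsWithin_le_nhds hlo)).exists
    rw [hval, hre d (by linarith [hsmall δ₁ hδ₁ hs₁, hd.2])] at hdl
    have hm := hmono d δ₁ hd.1 hd.2 hs₁
    rw [hH₁, mul_zero, sub_zero] at hm
    have hxd : x ^ (-d) ≤ 1 :=
      Real.rpow_le_one_of_one_le_of_nonpos (by norm_num at hx400; linarith) (by linarith [hd.1])
    have hxd0 : 0 < x ^ (-d) := by positivity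
    set H := κ - d * errorIntegral b κ d
    have hH0 : 0.01 * (δ₁ - d) ≤ H := by
      have : 0 < H := by
        by_contra! hc
        nlinarith [hd.2]
      nlinarith
    simp only [sub_zero, smul_zero, Real.norm_eq_abs] at hdl
    rw [abs_of_neg (show d - δ₁ < 0 by linarith [hd.2])] at hdl
    have := (abs_le.mp hdl).2
    have hd1 : d < 0.005 := by linarith [hsmall δ₁ hδ₁ hs₁, hd.2]
    nlinarith [hd.2, hd.1]
  · have := hmono δ₂ δ₁ hδ₂ h hs₁
    rw [hH₁, hH₂] at this
    linarith

lemma mul_exp_neg_le (u : ℝ) : u * Real.exp (-u) ≤ Real.exp (-1) := by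
  have h : u ≤ Real.exp (u - 1) := by linarith [Real.add_one_le_exp (u - 1)]
  calc u * Real.exp (-u) ≤ Real.exp (u - 1) * Real.exp (-u) := by gcongr
    _ = _ := by rw [← Real.exp_add]; congr 1; ring

lemma sq_mul_exp_mul_le {U z : ℝ} (hU : 2 ≤ U) (hz : 0.9 ≤ z) (hz' : z ≤ 0.6 * U) :
    1.0016 * (U ^ 2 * Real.exp (-U) * Real.exp z) ≤ 1.56 * z := by
  have he := Real.exp_one_gt_d9
  rcases le_total z 1 with h | h
  · have h1 : U / 2 * Real.exp (-(U / 2)) ≤ Real.exp (-1) := mul_exp_neg_le _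
    have h2 : U ^ 2 * Real.exp (-U) ≤ 4 * (Real.exp (-1) * Real.exp (-1)) := by
      have : U ^ 2 * Real.exp (-U) = 4 * ((U / 2 * Real.exp (-(U / 2))) *
          (U / 2 * Real.exp (-(U / 2)))) := by
        have : Real.exp (-U) = Real.exp (-(U / 2)) * Real.exp (-(U / 2)) := by
          rw [← Real.exp_add]; congr 1; ring
        rw [this]; ring
      rw [this]
      gcongr
    have h3 : Real.exp z * 0.9 ≤ Real.exp 0.9 * z := by
      have e1 : Real.exp 0.9 = Real.exp z * Real.exp (0.9 - z) := by
        rw [← Real.exp_add]; congr 1; ring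
      have e2 := Real.add_one_le_exp (0.9 - z)
      have e3 : 0.9 ≤ Real.exp (0.9 - z) * z := by nlinarith
      rw [e1]
      nlinarith [Real.exp_pos z]
    have h4 : Real.exp (-1) * Real.exp (-1) * Real.exp 0.9 ≤ 1 / 2.98 := by
      rw [← Real.exp_add, ← Real.exp_add, show (-1 + -1 + 0.9 : ℝ) = -(1 + 0.1) by norm_num,
        Real.exp_neg, one_div]
      apply inv_anti₀ (by norm_num)
      rw [Real.exp_add]
      nlinarith [Real.add_one_le_exp (0.1 : ℝ)]
    have hz0 : 0 < z := by linarith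
    calc 1.0016 * (U ^ 2 * Real.exp (-U) * Real.exp z)
        ≤ 1.0016 * (4 * (Real.exp (-1) * Real.exp (-1)) * (Real.exp 0.9 * z / 0.9)) := by
          gcongr
          rw [le_div_iff₀ (by norm_num)]; exact h3
      _ = 1.0016 * 4 / 0.9 * z * (Real.exp (-1) * Real.exp (-1) * Real.exp 0.9) := by ring
      _ ≤ 1.0016 * 4 / 0.9 * z * (1 / 2.98) := by gcongr
      _ ≤ _ := by norm_num; linarith
  · have h1 : 0.4 * U * Real.exp (-(0.4 * U)) ≤ Real.exp (-1) := mul_exp_neg_le _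
    have h3 : Real.exp z * (0.6 * U) ≤ Real.exp (0.6 * U) * z := by
      have e1 : Real.exp (0.6 * U) = Real.exp z * Real.exp (0.6 * U - z) := by
        rw [← Real.exp_add]; congr 1; ring
      have e2 := Real.add_one_le_exp (0.6 * U - z)
      have e3 : 0.6 * U ≤ Real.exp (0.6 * U - z) * z := by nlinarith
      rw [e1]
      nlinarith [Real.exp_pos z]
    have h4 : Real.exp (-1) ≤ 1 / 2.718 := by
      rw [Real.exp_neg, one_div]; apply inv_anti₀ (by norm_num); linarith
    have e5 : Real.exp (-U) * Real.exp (0.6 * U) = Real.exp (-(0.4 * U)) := by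
      rw [← Real.exp_add]; congr 1; ring
    have hz0 : 0 < z := by linarith
    calc 1.0016 * (U ^ 2 * Real.exp (-U) * Real.exp z)
        = 1.0016 / 0.6 * (U * Real.exp (-U) * (Real.exp z * (0.6 * U))) := by ring
      _ ≤ 1.0016 / 0.6 * (U * Real.exp (-U) * (Real.exp (0.6 * U) * z)) := by gcongr
      _ = 1.0016 / 0.6 / 0.4 * z * (0.4 * U * Real.exp (-(0.4 * U))) := by rw [← e5]; ring
      _ ≤ 1.0016 / 0.6 / 0.4 * z * (1 / 2.718) := by gcongr; exact h1.trans h4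
      _ ≤ _ := by norm_num; linarith

/-- A zero close to `1`, but not too close, contradicts the smallness of the residue. -/
lemma not_realL_eq_zero_of_large (hχ₁ : χ₁ ≠ 1) (hχ₂ : χ₂ ≠ 1) (hχ₃ : χ₃ ≠ 1)
    (h₁ : χ₁.IsQuadratic) (h₂ : χ₂.IsQuadratic) (h₃ : χ₃.IsQuadratic)
    (hprod : charFun χ₃ = (charFun χ₁).pmul (charFun χ₂)) {ℓ : ℝ} (hℓ : 26 ≤ ℓ)
    (hq₁ : ℓ ≤ Real.log q₁) (hq₂ : ℓ ≤ Real.log q₂)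
    (hlam₁ : realL χ₁ 0 ≤ 0.4757 / ℓ * Real.exp (-(Real.log q₁ / ℓ)))
    (hlam₂ : realL χ₂ 0 ≤ 0.4757 / ℓ * Real.exp (-(Real.log q₂ / ℓ)))
    (hlam : realL χ₁ 0 ≤ 1) {δ : ℝ} (hδ0 : 0 < δ) (hδ : δ < 0.15 / ℓ)
    (hs : 0.9 ≤ 4 * Real.log (q₁ * q₂) * δ) (hz : realL χ₁ δ = 0 ∨ realL χ₂ δ = 0) : False := by
  have hℓ0 : 0 < ℓ := by linarith
  have hδ1 : δ < 0.006 := hδ.trans_le (by rw [div_le_iff₀ hℓ0]; linarith)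
  have hH := eq_zero_of_realL_eq_zero hχ₁ hχ₂ hχ₃ h₁ h₂ h₃ hprod hlam hδ0.le (by linarith) hz
  have hb := fun y hy ↦ abs_partialSum_fourfold_sub_le hχ₁ hχ₂ hχ₃ h₁ h₂ h₃ hprod hlam (y := y) hy
  have hnn := fourfold_nonneg' h₁ h₂
  have hone₁ := one_le_modulus_cast (q := q₁)
  have hone₂ := one_le_modulus_cast (q := q₂)
  have htadd : Real.log (q₁ * q₂) = Real.log q₁ + Real.log q₂ :=
    Real.log_mul (by linarith) (by linarith)
  have hlam₃ : realL χ₃ 0 ≤ Real.log (q₁ * q₂) + 5.53 := by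
    have := realL_zero_le hχ₃ h₃
    push_cast at this
    exact this
  have hp₁ := realL_zero_pos hχ₁ h₁
  have hp₂ := realL_zero_pos hχ₂ h₂
  have hp₃ := realL_zero_pos hχ₃ h₃
  have hκ : realL χ₁ 0 * realL χ₂ 0 * realL χ₃ 0 ≤
      (0.4757 / ℓ * Real.exp (-(Real.log q₁ / ℓ))) * (0.4757 / ℓ * Real.exp (-(Real.log q₂ / ℓ))) *
        (Real.log (q₁ * q₂) + 5.53) := by gcongr
  set t := Real.log (q₁ * q₂) with htdef
  set κ := realL χ₁ 0 * realL χ₂ 0 * realL χ₃ 0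
  set b := fourfold χ₁ χ₂
  have hQ : (q₁ : ℝ) * q₂ = Real.exp t := (Real.exp_log (by positivity)).symm
  have ht : 52 ≤ t := by linarith
  have hexp : Real.exp (-(Real.log q₁ / ℓ)) * Real.exp (-(Real.log q₂ / ℓ)) =
      Real.exp (-(t / ℓ)) := by
    rw [← Real.exp_add, htadd]; congr 1; ring
  rw [hQ] at hb
  set x := Real.exp (4 * t) with hx
  have hx1 : 1 ≤ x := Real.one_le_exp (by linarith)
  have hx200 : (2.7 : ℝ) ^ 200 ≤ x := pow_le_exp_of_le (by push_cast; linarith)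
  have hx400 : ((20 : ℕ) : ℝ) ^ 2 ≤ x := le_trans (by norm_num) hx200
  have hx20 : 20 / x ≤ 0.001 := by
    rw [div_le_iff₀ (by linarith)]
    have : (20000 : ℝ) ≤ 2.7 ^ 200 := by norm_num
    linarith
  have hsplit := errorIntegral_split hb hδ0 (by norm_num; linarith) hx1
  have herr := abs_integral_Ioi_error_le hb (δ := δ) (by norm_num; linarith) hx1
  have hlow := (sum_inv_sq_twenty_ge x).trans (integral_partialSum_ge hb hδ0.le
    (by norm_num; linarith) hnn.1 hnn.2 20 hx400)
  rw [hH] at hsplit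
  have he : 1813 * Real.exp t ^ (17 / 32 : ℝ) * x ^ ((49 / 64 : ℝ) + δ - 1) ≤ 1813 / 2.7 ^ 19 := by
    rw [hx, ← Real.exp_mul, ← Real.exp_mul, mul_assoc, ← Real.exp_add,
      show (1813 : ℝ) / 2.7 ^ 19 = 1813 * (2.7 ^ 19)⁻¹ from div_eq_mul_inv _ _]
    gcongr
    rw [show t * (17 / 32) + 4 * t * (49 / 64 + δ - 1) = -(t * (13 / 32 - 4 * δ)) by ring,
      Real.exp_neg]
    exact inv_anti₀ (by norm_num) (pow_le_exp_of_le (by push_cast; nlinarith))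
  have he2 : 1813 * Real.exp t ^ (17 / 32 : ℝ) * x ^ ((49 / 64 : ℝ) + δ - 1) /
      (1 - 49 / 64 - δ) ≤ 0.001 := by
    rw [div_le_iff₀ (by linarith)]
    refine he.trans ?_
    norm_num
    linarith
  have hJ := (abs_le.mp (herr.trans he2)).1
  have hge : δ * 1.59 ≤ κ * x ^ δ := by nlinarith
  have hxδ : x ^ δ = Real.exp (4 * t * δ) := by rw [hx, ← Real.exp_mul]
  have hU : 2 ≤ t / ℓ := by rw [le_div_iff₀ hℓ0]; linarith
  have hzU : 4 * t * δ ≤ 0.6 * (t / ℓ) := by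
    calc 4 * t * δ ≤ 4 * t * (0.15 / ℓ) := by gcongr
      _ = _ := by ring
  have hfin := sq_mul_exp_mul_le hU hs hzU
  have hκ' : 4 * t * (κ * x ^ δ) ≤ 1.0016 * ((t / ℓ) ^ 2 * Real.exp (-(t / ℓ)) *
      Real.exp (4 * t * δ)) := by
    rw [hxδ]
    calc 4 * t * (κ * Real.exp (4 * t * δ))
        ≤ 4 * t * ((0.4757 / ℓ * Real.exp (-(Real.log q₁ / ℓ)) *
          (0.4757 / ℓ * Real.exp (-(Real.log q₂ / ℓ))) * (t * 1.1064)) *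
            Real.exp (4 * t * δ)) := by
          gcongr
          refine hκ.trans ?_
          gcongr
          linarith
      _ = (4 * 0.4757 ^ 2 * 1.1064) * ((t / ℓ) ^ 2 * Real.exp (-(t / ℓ)) *
            Real.exp (4 * t * δ)) := by rw [← hexp]; ring
      _ ≤ _ := by gcongr; norm_num
  have : 4 * t * (κ * x ^ δ) ≤ 4 * t * (1.56 * δ) := by linarith
  have := le_of_mul_le_mul_left this (by linarith)
  linarith

/-- Two quadratic characters with distinct nontrivial kernels cannot both have a tiny
`L`-value at `1`. -/
theorem not_both_realL_small (hχ₁ : χ₁ ≠ 1) (hχ₂ : χ₂ ≠ 1) (hχ₃ : χ₃ ≠ 1)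
    (h₁ : χ₁.IsQuadratic) (h₂ : χ₂.IsQuadratic) (h₃ : χ₃.IsQuadratic)
    (hprod : charFun χ₃ = (charFun χ₁).pmul (charFun χ₂)) {ℓ : ℝ} (hℓ : 26 ≤ ℓ)
    (hq₁ : ℓ ≤ Real.log q₁) (hq₂ : ℓ ≤ Real.log q₂)
    (hlam₁ : realL χ₁ 0 ≤ 0.4757 / ℓ * Real.exp (-(Real.log q₁ / ℓ)))
    (hlam₂ : realL χ₂ 0 ≤ 0.4757 / ℓ * Real.exp (-(Real.log q₂ / ℓ))) : False := by
  have hℓ0 : 0 < ℓ := by linarith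
  obtain ⟨δ₁, hδ₁, hz₁⟩ := exists_realL_eq_zero hχ₁ h₁ hℓ hq₁ hlam₁
  obtain ⟨δ₂, hδ₂, hz₂⟩ := exists_realL_eq_zero hχ₂ h₂ hℓ hq₂ hlam₂
  have hone₁ := one_le_modulus_cast (q := q₁)
  have hone₂ := one_le_modulus_cast (q := q₂)
  have htadd : Real.log (q₁ * q₂) = Real.log q₁ + Real.log q₂ :=
    Real.log_mul (by linarith) (by linarith)
  have hlam : realL χ₁ 0 ≤ 1 := by
    refine hlam₁.trans (mul_le_one₀ ?_ (Real.exp_pos _).le ?_)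
    · rw [div_le_one hℓ0]; linarith
    · rw [Real.exp_le_one_iff]
      have : 0 ≤ Real.log q₁ / ℓ := div_nonneg (by linarith) hℓ0.le
      linarith
  have hlarge := fun δ h0 hl hs hz ↦ not_realL_eq_zero_of_large hχ₁ hχ₂ hχ₃ h₁ h₂ h₃ hprod hℓ
    hq₁ hq₂ hlam₁ hlam₂ hlam (δ := δ) h0 hl hs hz
  rcases le_total 0.9 (4 * Real.log (q₁ * q₂) * δ₁) with hc₁ | hc₁
  · exact hlarge δ₁ hδ₁.1 hδ₁.2 hc₁ (.inl hz₁)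
  rcases le_total 0.9 (4 * Real.log (q₁ * q₂) * δ₂) with hc₂ | hc₂
  · exact hlarge δ₂ hδ₂.1 hδ₂.2 hc₂ (.inr hz₂)
  exact not_realL_eq_zero_of_small hχ₁ hχ₂ hχ₃ h₁ h₂ h₃ hprod hlam (by linarith)
    hδ₁.1 hδ₂.1 hc₁ hc₂ hz₁ hz₂

end zeros

end

section

open scoped NumberTheorySymbols

section jacobi

lemma exists_jacobiSym_mul_eq_neg_one {p : ℕ} (hp : p.Prime) (hp2 : p ≠ 2) {c b : ℤ}
    (hc : c ≠ 0) (hpc : ¬ (p : ℤ) ∣ c) (hb : b ≠ 0) :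
    ∃ n : ℕ, Odd n ∧ n.Coprime b.natAbs ∧ J(p * c | n) = -1 := by
  have := Fact.mk hp
  obtain ⟨t, ht⟩ := FiniteField.exists_nonsquare (F := ZMod p) (by simpa [ZMod.ringChar_zmod_n])
  have hpodd : Odd p := hp.odd_of_ne_two hp2
  obtain ⟨k, b', hb', hbk⟩ := Nat.exists_eq_pow_mul_and_not_dvd (Int.natAbs_ne_zero.mpr hb) p
    hp.ne_one
  have hcop : (8 * c.natAbs * b').Coprime p := by
    refine Nat.Coprime.symm ((Nat.Prime.coprime_iff_not_dvd hp).mpr ?_)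
    rw [hp.dvd_mul, hp.dvd_mul]
    rintro ((h | h) | h)
    · have h : p ∣ 2 ^ 3 := h
      exact hp2 ((Nat.prime_dvd_prime_iff_eq hp Nat.prime_two).mp (hp.dvd_of_dvd_pow h))
    · exact hpc (Int.natCast_dvd.mpr h)
    · exact hb' h
  obtain ⟨n, hn1, hnt⟩ := Nat.chineseRemainder hcop 1 t.val
  have h8 : n ≡ 1 [MOD 8] := (hn1.of_mul_right _).of_mul_right _
  have hnb : n ≡ 1 [MOD b'] := hn1.of_mul_left _
  have hnc : n ≡ 1 [MOD 4 * c.natAbs] := by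
    refine hn1.of_dvd ?_
    exact ⟨2 * b', by ring⟩
  have hn4 : n % 4 = 1 := h8.of_dvd (by norm_num : 4 ∣ 8)
  have hnodd : Odd n := Nat.odd_iff.mpr (by omega)
  have hJp : J(p | n) = -1 := by
    rw [jacobiSym.quadratic_reciprocity_one_mod_four' hpodd hn4, 
      jacobiSym.mod_left' (a₂ := (t.val : ℤ)) (by exact_mod_cast hnt),
      ← jacobiSym.legendreSym.to_jacobiSym, legendreSym.eq_neg_one_iff]
    simpa using ht
  refine ⟨n, hnodd, ?_, ?_⟩
  · rw [hbk]
    refine Nat.Coprime.mul_right (Nat.Coprime.pow_right _ ?_) ?_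
    · refine Nat.Coprime.symm ((Nat.Prime.coprime_iff_not_dvd hp).mpr fun h ↦ ?_)
      have : t.val = 0 := by
        have := hnt.symm.trans (Nat.modEq_zero_iff_dvd.mpr h)
        exact Nat.eq_zero_of_dvd_of_lt (Nat.modEq_zero_iff_dvd.mp this) (ZMod.val_lt t)
      rw [ZMod.val_eq_zero] at this
      exact ht (this ▸ IsSquare.zero)
    · simpa [Nat.Coprime] using hnb.gcd_eq
  · rw [jacobiSym.mul_left, hJp, jacobiSym.mod_right c hnodd, hnc]
    rcases Nat.lt_or_ge 1 (4 * c.natAbs) with h | h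
    · rw [Nat.mod_eq_of_lt h, jacobiSym.one_right]; norm_num
    · have := Int.natAbs_ne_zero.mpr hc
      omega

lemma exists_coprime_mod_eight {b : ℤ} (hb : b ≠ 0) {i : ℕ} (hi : i % 2 = 1) :
    ∃ n : ℕ, n % 8 = i % 8 ∧ n.Coprime b.natAbs := by
  obtain ⟨k, b', hb', hbk⟩ := Nat.exists_eq_pow_mul_and_not_dvd (Int.natAbs_ne_zero.mpr hb) 2
    (by norm_num)
  have h2 : (2 : ℕ).Coprime b' := (Nat.Prime.coprime_iff_not_dvd Nat.prime_two).mpr hb'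
  have hcop : (8 : ℕ).Coprime b' := Nat.Coprime.pow_left 3 h2
  obtain ⟨n, h8, hnb⟩ := Nat.chineseRemainder hcop i 1
  refine ⟨n, h8, ?_⟩
  have h8' : n % 8 = i % 8 := h8
  rw [hbk]
  refine Nat.Coprime.mul_right (Nat.Coprime.pow_right _ ?_) ?_
  · exact Nat.coprime_two_right.mpr (Nat.odd_iff.mpr (by omega))
  · simpa [Nat.Coprime] using hnb.gcd_eq

lemma exists_jacobiSym_squarefree_eq_neg_one {c b : ℤ} (hc : Squarefree c) (hc1 : c ≠ 1)
    (hb : b ≠ 0) : ∃ n : ℕ, Odd n ∧ n.Coprime b.natAbs ∧ J(c | n) = -1 := by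
  by_cases h : ∃ p : ℕ, p.Prime ∧ p ≠ 2 ∧ (p : ℤ) ∣ c
  · obtain ⟨p, hp, hp2, c', rfl⟩ := h
    have hc0 : c' ≠ 0 := right_ne_zero_of_mul hc.ne_zero
    refine exists_jacobiSym_mul_eq_neg_one hp hp2 hc0 (fun ⟨d, hd⟩ ↦ ?_) hb
    have := hc p ⟨d, by rw [hd]; ring⟩
    rw [Int.isUnit_iff_natAbs_eq, Int.natAbs_natCast] at this
    exact hp.ne_one this
  · push Not at h
    have hsq : Squarefree c.natAbs := Int.squarefree_natAbs.mpr hc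
    have hsub : c.natAbs.primeFactors ⊆ {2} := fun p hp ↦ by
      have hp' := Nat.prime_of_mem_primeFactors hp
      by_contra hp2
      exact h p hp' (by simpa using hp2) (Int.natCast_dvd.mpr (Nat.dvd_of_mem_primeFactors hp))
    have habs : c.natAbs = 1 ∨ c.natAbs = 2 := by
      have := Nat.prod_primeFactors_of_squarefree hsq
      rcases Finset.subset_singleton_iff.mp hsub with h' | h' <;> rw [h'] at this <;>
        simp at this <;> omega
    have hcases : c = -1 ∨ c = 2 ∨ c = -2 := by omega
    have key : ∀ i : ℕ, i % 2 = 1 → (∀ n : ℕ, n % 8 = i % 8 → J(c | n) = -1) →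
        ∃ n : ℕ, Odd n ∧ n.Coprime b.natAbs ∧ J(c | n) = -1 := fun i hi H ↦ by
      obtain ⟨n, hn, hnb⟩ := exists_coprime_mod_eight hb hi
      exact ⟨n, Nat.odd_iff.mpr (by omega), hnb, H n hn⟩
    rcases hcases with rfl | rfl | rfl
    · refine key 7 rfl fun n hn ↦ ?_
      rw [jacobiSym.at_neg_one (Nat.odd_iff.mpr (by omega)), ZMod.χ₄_nat_three_mod_four (by omega)]
    · refine key 5 rfl fun n hn ↦ ?_
      rw [jacobiSym.at_two (Nat.odd_iff.mpr (by omega)), ZMod.χ₈_nat_mod_eight, hn]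
      rfl
    · refine key 5 rfl fun n hn ↦ ?_
      rw [jacobiSym.at_neg_two (Nat.odd_iff.mpr (by omega)), ZMod.χ₈'_nat_eq_if_mod_eight]
      have h1 : n % 8 = 5 := hn
      have h2 : n % 2 = 1 := by omega
      simp [h1, h2]

/-- An integer which is not a square is a quadratic non-residue in the sense of the Jacobi symbol
for some odd modulus. -/
lemma exists_jacobiSym_eq_neg_one {a : ℤ} (ha : ¬ IsSquare a) :
    ∃ n : ℕ, Odd n ∧ J(a | n) = -1 := by
  have ha0 : a ≠ 0 := fun h ↦ ha (h ▸ IsSquare.zero)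
  obtain ⟨c, b, hcb, hc⟩ := Nat.sq_mul_squarefree a.natAbs
  have hb0 : (b : ℤ) ≠ 0 := by
    rintro h
    have : b = 0 := by exact_mod_cast h
    rw [this] at hcb
    exact ha0 (Int.natAbs_eq_zero.mp (by simpa using hcb.symm))
  have hac : a = (b : ℤ) ^ 2 * (a.sign * c) := by
    have h1 : (b : ℤ) ^ 2 * c = a.natAbs := by exact_mod_cast hcb
    calc a = a.sign * a.natAbs := (Int.sign_mul_natAbs a).symm
      _ = _ := by rw [← h1]; ring
  have hsq : Squarefree (a.sign * c : ℤ) := by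
    rw [← Int.squarefree_natAbs, Int.natAbs_mul, Int.natAbs_sign_of_ne_zero ha0]
    simpa using hc
  have h1 : (a.sign * c : ℤ) ≠ 1 := fun h ↦ ha (by rw [hac, h, mul_one]; exact IsSquare.sq _)
  obtain ⟨n, hn, hnb, hJ⟩ := exists_jacobiSym_squarefree_eq_neg_one hsq h1 hb0
  refine ⟨n, hn, ?_⟩
  rw [hac, jacobiSym.mul_left, hJ, jacobiSym.sq_one']
  · norm_num
  · rw [Int.gcd_comm]
    simpa [Int.gcd, Nat.Coprime] using hnb

end jacobi

section IsRealCharacter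

/-- `X` is a completely multiplicative function with values in `{0, 1, -1}`, periodic
modulo `q`, and vanishing exactly at the integers not coprime to `q`. -/
structure IsRealCharacter (q : ℕ) (X : ℕ → ℤ) : Prop where
  map_one : X 1 = 1
  map_mul (m n : ℕ) : X (m * n) = X m * X n
  map_mod (n : ℕ) : X (n % q) = X n
  eq_zero (n : ℕ) : X n = 0 ↔ ¬ n.Coprime q
  values (n : ℕ) : X n = 0 ∨ X n = 1 ∨ X n = -1

namespace IsRealCharacter

variable {q : ℕ} {X : ℕ → ℤ}

/-- The Dirichlet character attached to a real character on the natural numbers. -/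
noncomputable def toDirichletCharacter [NeZero q] (h : IsRealCharacter q X) :
    DirichletCharacter ℂ q where
  toFun a := (X a.val : ℂ)
  map_one' := by
    have := h.map_mod 1
    rw [← ZMod.val_natCast, Nat.cast_one, h.map_one] at this
    rw [this]; simp
  map_mul' a b := by
    rw [ZMod.val_mul, h.map_mod, h.map_mul]; push_cast; rfl
  map_nonunit' a ha := by
    have : X a.val = 0 := by
      rw [h.eq_zero, ← ZMod.isUnit_iff_coprime]
      simpa using ha
    simp [this]

variable [NeZero q] (h : IsRealCharacter q X)
include h

lemma toDirichletCharacter_natCast (n : ℕ) : h.toDirichletCharacter n = X n := by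
  change (X (n : ZMod q).val : ℂ) = X n
  rw [ZMod.val_natCast, h.map_mod]

lemma isQuadratic : h.toDirichletCharacter.IsQuadratic := fun a ↦ by
  change (X a.val : ℂ) = 0 ∨ (X a.val : ℂ) = 1 ∨ (X a.val : ℂ) = -1
  rcases h.values a.val with h | h | h <;> simp [h]

lemma charFun_toDirichletCharacter {n : ℕ} (hn : n ≠ 0) :
    charFun h.toDirichletCharacter n = X n := by
  rw [charFun_apply _ hn, h.toDirichletCharacter_natCast]; simp

lemma toDirichletCharacter_ne_one {n : ℕ} (hn : X n = -1) : h.toDirichletCharacter ≠ 1 := by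
  intro h1
  have h2 := h.toDirichletCharacter_natCast n
  rw [h1, hn] at h2
  by_cases hu : IsUnit (n : ZMod q)
  · rw [MulChar.one_apply hu] at h2; norm_num at h2
  · rw [MulChar.map_nonunit _ hu] at h2; norm_num at h2

omit h [NeZero q] in
lemma mul {q₁ q₂ : ℕ} {X₁ X₂ : ℕ → ℤ} (h₁ : IsRealCharacter q₁ X₁) (h₂ : IsRealCharacter q₂ X₂) :
    IsRealCharacter (q₁ * q₂) (fun n ↦ X₁ n * X₂ n) where
  map_one := by simp [h₁.map_one, h₂.map_one]
  map_mul m n := by simp only [h₁.map_mul, h₂.map_mul]; ring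
  map_mod n := by
    rw [← h₁.map_mod (n % _), Nat.mod_mul_right_mod, h₁.map_mod, ← h₂.map_mod (n % _),
      Nat.mod_mul_left_mod, h₂.map_mod]
  eq_zero n := by
    rw [mul_eq_zero, h₁.eq_zero, h₂.eq_zero, Nat.coprime_mul_iff_right]; tauto
  values n := by
    rcases h₁.values n with h | h | h <;> rcases h₂.values n with h' | h' | h' <;> simp [h, h']

end IsRealCharacter

end IsRealCharacter

end

section kroneckerFun

open scoped NumberTheorySymbols

/-- The Kronecker symbol `(D / n)` of a negative fundamental discriminant `D`. -/
noncomputable def kroneckerFun (D : ℤ) (n : ℕ) : ℤ :=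
  if D % 4 = 1 then J(n | D.natAbs) else if n % 2 = 0 then 0 else J(D / 4 | n)

variable {D : ℤ}

lemma kroneckerFun_odd (hD : IsFundamentalDiscriminant D) (hD0 : D < 0) {n : ℕ} (hn : Odd n) :
    kroneckerFun D n = J(D | n) := by
  have hn2 := Nat.odd_iff.mp hn
  rw [kroneckerFun]
  split_ifs with h h'
  · have h3 : D.natAbs % 4 = 3 := by omega
    have hD' : D = -(D.natAbs : ℤ) := by omega
    have hodd : Odd D.natAbs := Nat.odd_iff.mpr (by omega)
    conv_rhs => rw [hD', jacobiSym.neg _ hn]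
    rcases (by omega : n % 4 = 1 ∨ n % 4 = 3) with h4 | h4
    · rw [ZMod.χ₄_nat_one_mod_four h4, one_mul, jacobiSym.quadratic_reciprocity_one_mod_four h4 hodd]
    · rw [ZMod.χ₄_nat_three_mod_four h4, jacobiSym.quadratic_reciprocity_three_mod_four h4 h3]
      ring
  · omega
  · rw [jacobiSym.div_four_left _ hn2]
    rcases hD.2 with h1 | ⟨m, rfl, -⟩
    · exact absurd h1.1 h
    · omega

lemma kroneckerFun_two (hD0 : D < 0) (h : kroneckerFun D 2 = 1) :
    D % 8 = 1 := by
  by_cases h1 : D % 4 = 1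
  · rw [kroneckerFun, if_pos h1] at h
    push_cast at h
    rw [jacobiSym.at_two (Nat.odd_iff.mpr (by omega)), ZMod.χ₈_nat_eq_if_mod_eight,
      if_neg (by omega)] at h
    by_cases h8 : D.natAbs % 8 = 1 ∨ D.natAbs % 8 = 7
    · omega
    · rw [if_neg h8] at h
      norm_num at h
  · simp [kroneckerFun, h1] at h

lemma isRealCharacter_kroneckerFun (hD : IsFundamentalDiscriminant D) (hD0 : D < 0) :
    IsRealCharacter D.natAbs (kroneckerFun D) := by
  rcases hD.2 with ⟨h1, -⟩ | ⟨m, hm, -, hm4⟩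
  · have : NeZero D.natAbs := ⟨by omega⟩
    have hK : kroneckerFun D = fun n : ℕ ↦ J(n | D.natAbs) := by
      funext n; rw [kroneckerFun, if_pos h1]
    rw [hK]
    refine ⟨?_, fun m n ↦ ?_, fun n ↦ ?_, fun n ↦ ?_, fun n ↦ ?_⟩
    · push_cast; exact jacobiSym.one_left _
    · push_cast; exact jacobiSym.mul_left _ _ _
    · rw [Int.natCast_mod]; exact (jacobiSym.mod_left _ _).symm
    · rw [jacobiSym.eq_zero_iff_not_coprime, Int.gcd_natCast_natCast, Nat.Coprime]
    · exact jacobiSym.trichotomy _ _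
  · have hD4 : ¬ D % 4 = 1 := by omega
    have hK : kroneckerFun D = fun n : ℕ ↦ if n % 2 = 0 then 0 else J(m | n) := by
      funext n; rw [kroneckerFun, if_neg hD4, hm, Int.mul_ediv_cancel_left _ (by norm_num)]
    have hq : D.natAbs = 4 * m.natAbs := by omega
    rw [hK]
    refine ⟨?_, fun a b ↦ ?_, fun n ↦ ?_, fun n ↦ ?_, fun n ↦ ?_⟩
    · simp
    · rcases Nat.mod_two_eq_zero_or_one a with ha | ha <;>
        rcases Nat.mod_two_eq_zero_or_one b with hb | hb <;>
        rw [Nat.mul_mod, ha, hb]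
      · simp
      · simp
      · simp
      · have : NeZero a := ⟨by omega⟩
        have : NeZero b := ⟨by omega⟩
        simp [jacobiSym.mul_right]
    · have : n % D.natAbs % 2 = n % 2 := Nat.mod_mod_of_dvd _ ⟨2 * m.natAbs, by omega⟩
      rw [this]
      split_ifs with h
      · rfl
      · rw [hq, ← jacobiSym.mod_right _ (Nat.odd_iff.mpr (by omega))]
    · split_ifs with h
      · simp only [true_iff, hq]
        intro h'
        have := Nat.Coprime.coprime_mul_right_right h'
        have h2 : ¬ n.Coprime 2 := by
          rw [Nat.coprime_two_right]; exact fun h'' ↦ by have := Nat.odd_iff.mp h''; omega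
        exact h2 (Nat.Coprime.of_dvd_right (by norm_num) this)
      · have : NeZero n := ⟨by omega⟩
        rw [jacobiSym.eq_zero_iff_not_coprime, hq, Nat.coprime_mul_iff_right]
        have h4 : n.Coprime 4 := by
          change n.Coprime (2 ^ 2)
          exact Nat.Coprime.pow_right _ (Nat.coprime_two_right.mpr (Nat.odd_iff.mpr (by omega)))
        simp only [h4, true_and, Int.gcd, Int.natAbs_natCast, Nat.coprime_iff_gcd_eq_one, ne_eq]
        rw [Nat.gcd_comm]
    · split_ifs with h
      · simp
      · exact jacobiSym.trichotomy _ _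

lemma exists_kroneckerFun_eq_neg_one (hD : IsFundamentalDiscriminant D) (hD0 : D < 0) :
    ∃ n, kroneckerFun D n = -1 := by
  obtain ⟨n, hn, h⟩ := exists_jacobiSym_eq_neg_one (a := D) fun h ↦ by
    have := h.nonneg; omega
  exact ⟨n, by rw [kroneckerFun_odd hD hD0 hn, h]⟩

/-- Squarefree integers are determined up to sign by their product being a square. -/
lemma natAbs_eq_of_isSquare_mul {a b : ℤ} (ha : Squarefree a) (hb : Squarefree b)
    (h : IsSquare (a * b)) : a.natAbs = b.natAbs := by
  have key : ∀ a b : ℤ, Squarefree a → IsSquare (a * b) → a.natAbs ∣ b.natAbs := by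
    intro a b ha h
    obtain ⟨c, hc⟩ := h
    have h1 : a ∣ c := (ha.dvd_pow_iff_dvd two_ne_zero).mp ⟨b, by rw [sq, ← hc]⟩
    obtain ⟨d, rfl⟩ := h1
    rw [Int.natAbs_dvd_natAbs]
    refine ⟨d * d, mul_left_cancel₀ ha.ne_zero ?_⟩
    rw [hc]; ring
  exact Nat.dvd_antisymm (key a b ha h) (key b a hb (mul_comm a b ▸ h))

lemma IsFundamentalDiscriminant.not_isSquare_mul {D₁ D₂ : ℤ} (h₁ : IsFundamentalDiscriminant D₁)
    (h₂ : IsFundamentalDiscriminant D₂) (hD₁ : D₁ < 0) (hD₂ : D₂ < 0) (hne : D₁ ≠ D₂) :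
    ¬ IsSquare (D₁ * D₂) := by
  have cancel : ∀ x : ℤ, IsSquare (4 * x) → IsSquare x := by
    rintro x ⟨c, hc⟩
    have h2 : c % 2 = 0 := by
      rcases Int.emod_two_eq_zero_or_one c with h | h
      · exact h
      · have : (c * c) % 2 = 1 := by rw [Int.mul_emod, h]; rfl
        omega
    obtain ⟨d, rfl⟩ := Int.dvd_of_emod_eq_zero h2
    exact ⟨d, by linarith [hc]⟩
  intro h
  rcases h₁.2 with ⟨h1, hs1⟩ | ⟨m₁, rfl, hs1, hm1⟩ <;>
    rcases h₂.2 with ⟨h2, hs2⟩ | ⟨m₂, rfl, hs2, hm2⟩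
  · have := natAbs_eq_of_isSquare_mul hs1 hs2 h
    omega
  · have := natAbs_eq_of_isSquare_mul hs1 hs2 (cancel _ (by convert h using 1; ring))
    omega
  · have := natAbs_eq_of_isSquare_mul hs1 hs2 (cancel _ (by convert h using 1; ring))
    omega
  · have := natAbs_eq_of_isSquare_mul hs1 hs2 (cancel _ (cancel _ (by convert h using 1; ring)))
    omega

lemma exists_kroneckerFun_mul_eq_neg_one {D₁ D₂ : ℤ} (h₁ : IsFundamentalDiscriminant D₁)
    (h₂ : IsFundamentalDiscriminant D₂) (hD₁ : D₁ < 0) (hD₂ : D₂ < 0) (hne : D₁ ≠ D₂) :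
    ∃ n, kroneckerFun D₁ n * kroneckerFun D₂ n = -1 := by
  obtain ⟨n, hn, h⟩ := exists_jacobiSym_eq_neg_one (h₁.not_isSquare_mul h₂ hD₁ hD₂ hne)
  exact ⟨n, by rw [kroneckerFun_odd h₁ hD₁ hn, kroneckerFun_odd h₂ hD₂ hn, ← jacobiSym.mul_left, h]⟩

/-- The Kronecker character of a negative fundamental discriminant. -/
noncomputable def kroneckerChar (hD : IsFundamentalDiscriminant D) (hD0 : D < 0)
    [NeZero D.natAbs] : DirichletCharacter ℂ D.natAbs :=
  (isRealCharacter_kroneckerFun hD hD0).toDirichletCharacter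

/-- Two distinct negative fundamental discriminants cannot both have a Kronecker character with
a very small value of the `L`-function at `1`. -/
theorem not_both_realL_kroneckerChar_small {D₁ D₂ : ℤ} [NeZero D₁.natAbs] [NeZero D₂.natAbs]
    (h₁ : IsFundamentalDiscriminant D₁) (h₂ : IsFundamentalDiscriminant D₂)
    (hD₁ : D₁ < 0) (hD₂ : D₂ < 0) (hne : D₁ ≠ D₂) {ℓ : ℝ} (hℓ : 26 ≤ ℓ)
    (hq₁ : ℓ ≤ Real.log D₁.natAbs) (hq₂ : ℓ ≤ Real.log D₂.natAbs)
    (hlam₁ : realL (kroneckerChar h₁ hD₁) 0 ≤ 0.4757 / ℓ * Real.exp (-(Real.log D₁.natAbs / ℓ)))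
    (hlam₂ : realL (kroneckerChar h₂ hD₂) 0 ≤ 0.4757 / ℓ * Real.exp (-(Real.log D₂.natAbs / ℓ))) :
    False := by
  have : NeZero (D₁.natAbs * D₂.natAbs) := ⟨mul_ne_zero (NeZero.ne _) (NeZero.ne _)⟩
  have hX₁ := isRealCharacter_kroneckerFun h₁ hD₁
  have hX₂ := isRealCharacter_kroneckerFun h₂ hD₂
  obtain ⟨n₁, hn₁⟩ := exists_kroneckerFun_eq_neg_one h₁ hD₁
  obtain ⟨n₂, hn₂⟩ := exists_kroneckerFun_eq_neg_one h₂ hD₂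
  obtain ⟨n₃, hn₃⟩ := exists_kroneckerFun_mul_eq_neg_one h₁ h₂ hD₁ hD₂ hne
  refine not_both_realL_small (χ₃ := (hX₁.mul hX₂).toDirichletCharacter)
    (hX₁.toDirichletCharacter_ne_one hn₁) (hX₂.toDirichletCharacter_ne_one hn₂)
    ((hX₁.mul hX₂).toDirichletCharacter_ne_one hn₃) hX₁.isQuadratic hX₂.isQuadratic
    (hX₁.mul hX₂).isQuadratic ?_ hℓ hq₁ hq₂ hlam₁ hlam₂
  ext n
  rcases eq_or_ne n 0 with rfl | hn
  · simp
  rw [ArithmeticFunction.pmul_apply, IsRealCharacter.charFun_toDirichletCharacter _ hn,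
    hX₁.charFun_toDirichletCharacter hn, hX₂.charFun_toDirichletCharacter hn]
  push_cast; rfl

end kroneckerFun

section ImaginaryQuadratic

/-- The ring `ℤ[ω]` with `ω² = a + bω`. -/
abbrev QuadInt (a b : ℤ) : Type := QuadraticAlgebra ℤ a b

/-- The algebra `ℚ[ω]` with `ω² = a + bω`. -/
abbrev QuadRat (a b : ℤ) : Type := QuadraticAlgebra ℚ (a : ℚ) (b : ℚ)

/-- `(a, b)` are the coefficients of a quadratic equation `ω² = a + bω` of negative fundamental
discriminant `D = b² + 4a`, normalized so that `b ∈ {0, 1}`. -/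
class FundamentalCoeffs (a b : ℤ) : Prop where
  neg : b ^ 2 + 4 * a < 0
  cases : (b = 1 ∧ Squarefree (b ^ 2 + 4 * a)) ∨
    (b = 0 ∧ Squarefree a ∧ (a % 4 = 2 ∨ a % 4 = 3))

lemma exists_fundamentalCoeffs {D : ℤ} (hD : IsFundamentalDiscriminant D) (hD0 : D < 0) :
    ∃ a b : ℤ, FundamentalCoeffs a b ∧ D = b ^ 2 + 4 * a := by
  rcases hD.2 with ⟨h, hs⟩ | ⟨m, hm, hs, hm4⟩
  · have h' : D = 1 ^ 2 + 4 * ((D - 1) / 4) := by omega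
    exact ⟨(D - 1) / 4, 1, ⟨h' ▸ hD0, Or.inl ⟨rfl, h' ▸ hs⟩⟩, h'⟩
  · exact ⟨m, 0, ⟨by omega, Or.inr ⟨rfl, hs, hm4⟩⟩, by omega⟩

lemma Rat.exists_eq_intCast_of_squarefree_mul_sq {n : ℤ} (hn : Squarefree n) {s : ℚ} {k : ℤ}
    (h : n * s ^ 2 = k) : ∃ t : ℤ, s = t := by
  have hd : (s.den : ℤ) ≠ 0 := by exact_mod_cast s.den_nz
  have h1 : n * s.num ^ 2 = k * (s.den : ℤ) ^ 2 := by
    have h2 : s * s.den = s.num := Rat.mul_den_eq_num s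
    have h3 : (n : ℚ) * (s.num : ℚ) ^ 2 = k * (s.den : ℚ) ^ 2 := by
      rw [← h2, ← h]; ring
    exact_mod_cast h3
  have hcop : IsCoprime ((s.den : ℤ) * s.den) (s.num ^ 2) := by
    have : IsCoprime (s.den : ℤ) s.num := by
      rw [Int.isCoprime_iff_gcd_eq_one, Int.gcd_comm]
      exact s.reduced
    rw [← sq]
    exact this.pow
  have hdvd : (s.den : ℤ) * s.den ∣ n := hcop.dvd_of_dvd_mul_right ⟨k, by rw [h1]; ring⟩
  have hu := hn _ hdvd
  have : s.den = 1 := by simpa [Int.isUnit_iff_natAbs_eq] using hu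
  exact ⟨s.num, (Rat.den_eq_one_iff s |>.mp this).symm⟩

namespace FundamentalCoeffs

variable (a b : ℤ) [hab : FundamentalCoeffs a b]

instance : Fact (∀ r : ℚ, r ^ 2 ≠ (a : ℚ) + (b : ℚ) * r) := ⟨fun r hr ↦ by
  have h : ((b ^ 2 + 4 * a : ℤ) : ℚ) < 0 := by exact_mod_cast hab.neg
  push_cast at h
  nlinarith [sq_nonneg (2 * r - b)]⟩

/-- The inclusion of `ℤ[ω]` into `ℚ[ω]`. -/
def toQuadRat : QuadInt a b →+* QuadRat a b where
  toFun z := ⟨z.re, z.im⟩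
  map_one' := by ext <;> simp [QuadraticAlgebra.re_one, QuadraticAlgebra.im_one]
  map_mul' z w := by ext <;> simp
  map_zero' := by ext <;> simp
  map_add' z w := by ext <;> simp

omit hab in
lemma toQuadRat_injective : Function.Injective (toQuadRat a b) := fun z w h ↦ by
  have h1 := congrArg QuadraticAlgebra.re h
  have h2 := congrArg QuadraticAlgebra.im h
  simp only [toQuadRat, RingHom.coe_mk, MonoidHom.coe_mk, OneHom.coe_mk, Int.cast_inj] at h1 h2
  exact QuadraticAlgebra.ext h1 h2

instance : NumberField (QuadRat a b) where
  to_charZero := inferInstance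
  to_finiteDimensional := by
    convert (inferInstance : Module.Finite ℚ (QuadRat a b))

omit hab in
lemma finrank_quadRat : Module.finrank ℚ (QuadRat a b) = 2 := by
  convert QuadraticAlgebra.finrank_eq_two (a : ℚ) (b : ℚ)

lemma exists_eq_intCast_of_isIntegral {t : ℚ}
    (h : IsIntegral ℤ (QuadraticAlgebra.C t : QuadRat a b)) : ∃ n : ℤ, t = n := by
  have h1 : IsIntegral ℤ t := by
    rw [QuadraticAlgebra.C_eq_algebraMap] at h
    exact (isIntegral_algebraMap_iff QuadraticAlgebra.algebraMap_injective).mp h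
  obtain ⟨n, hn⟩ := IsIntegrallyClosed.isIntegral_iff.mp h1
  exact ⟨n, by rw [← hn]; simp⟩

lemma exists_eq_intCast_of_trace_norm {x y : ℚ} {T n : ℤ} (hT : 2 * x + b * y = T)
    (hn : x * x + b * x * y - a * y * y = n) : ∃ u v : ℤ, x = u ∧ y = v := by
  rcases hab.cases with ⟨hb, hsq⟩ | ⟨hb, hsq, h4⟩
  · have h1 : ((b ^ 2 + 4 * a : ℤ) : ℚ) * y ^ 2 = ((T ^ 2 - 4 * n : ℤ) : ℚ) := by
      push_cast; rw [← hT, ← hn]; ring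
    obtain ⟨v, hv⟩ := Rat.exists_eq_intCast_of_squarefree_mul_sq hsq h1
    have h2 : (1 + 4 * a) * v ^ 2 = T ^ 2 - 4 * n := by
      rw [hv, hb] at h1; exact_mod_cast h1
    have h3 : (T - v) % 2 = 0 := by
      have : (T - v) * (T + v) = 4 * (a * v ^ 2 + n) := by linear_combination -h2
      by_contra h
      have h4 : (T + v) % 2 = 1 := by omega
      have h5 : (T - v) % 2 = 1 := by omega
      have h6 : ((T - v) * (T + v)) % 2 = 1 := by rw [Int.mul_emod, h4, h5]; rfl
      omega
    refine ⟨(T - v) / 2, v, ?_, hv⟩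
    obtain ⟨w, hw⟩ := Int.dvd_of_emod_eq_zero h3
    rw [hw, Int.mul_ediv_cancel_left _ (by norm_num)]
    have hw' : (T : ℚ) - v = 2 * w := by exact_mod_cast hw
    rw [hb, hv] at hT
    push_cast at hT
    linarith
  · have hb' : (b : ℚ) = 0 := by rw [hb]; simp
    rw [hb'] at hT hn
    have h1 : (a : ℚ) * (2 * y) ^ 2 = ((T ^ 2 - 4 * n : ℤ) : ℚ) := by
      push_cast; rw [← hT, ← hn]; ring
    obtain ⟨v, hv⟩ := Rat.exists_eq_intCast_of_squarefree_mul_sq hsq h1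
    have h2 : a * v ^ 2 = T ^ 2 - 4 * n := by
      rw [hv] at h1; exact_mod_cast h1
    have h5 : ∀ y : ℤ, y % 2 = 1 → y ^ 2 % 4 = 1 := fun y hy ↦ by
      rcases (by omega : y % 4 = 1 ∨ y % 4 = 3) with h | h <;> rw [sq, Int.mul_emod, h] <;> rfl
    have h6 : ∀ y : ℤ, y % 2 = 0 → y ^ 2 % 4 = 0 := fun y hy ↦ by
      rcases (by omega : y % 4 = 0 ∨ y % 4 = 2) with h | h <;> rw [sq, Int.mul_emod, h] <;> rfl
    have h7 : a * v ^ 2 % 4 = ((a % 4) * (v ^ 2 % 4)) % 4 := Int.mul_emod _ _ _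
    have hvT : v % 2 = 0 ∧ T % 2 = 0 := by
      rcases Int.emod_two_eq_zero_or_one v with hv2 | hv2 <;>
        rcases Int.emod_two_eq_zero_or_one T with hT2 | hT2
      · exact ⟨hv2, hT2⟩
      · rw [h6 v hv2] at h7
        have := h5 T hT2
        omega
      · rw [h5 v hv2] at h7
        have := h6 T hT2
        omega
      · rw [h5 v hv2] at h7
        have := h5 T hT2
        omega
    obtain ⟨v', rfl⟩ := Int.dvd_of_emod_eq_zero hvT.1
    obtain ⟨T', rfl⟩ := Int.dvd_of_emod_eq_zero hvT.2
    push_cast at hv hT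
    exact ⟨T', v', by linarith, by linarith⟩

lemma exists_toQuadRat_eq {x : QuadRat a b} (hx : IsIntegral ℤ x) : ∃ z, toQuadRat a b z = x := by
  have hs : IsIntegral ℤ (star x) :=
    hx.map (starRingEnd (QuadRat a b)).toIntAlgHom
  obtain ⟨T, hT⟩ := exists_eq_intCast_of_isIntegral a b (t := QuadraticAlgebra.trace x) (by
    rw [QuadraticAlgebra.C_eq_algebraMap, QuadraticAlgebra.algebraMap_trace_eq_add_star]; exact hx.add hs)
  obtain ⟨n, hn⟩ := exists_eq_intCast_of_isIntegral a b (t := QuadraticAlgebra.norm x) (by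
    rw [QuadraticAlgebra.C_eq_algebraMap, QuadraticAlgebra.algebraMap_norm_eq_mul_star]; exact hx.mul hs)
  rw [QuadraticAlgebra.trace_def] at hT
  rw [QuadraticAlgebra.norm_def] at hn
  obtain ⟨u, v, hu, hv⟩ := exists_eq_intCast_of_trace_norm a b hT hn
  exact ⟨⟨u, v⟩, QuadraticAlgebra.ext hu.symm hv.symm⟩

lemma isIntegral_toQuadRat (z : QuadInt a b) : IsIntegral ℤ (toQuadRat a b z) :=
  (Algebra.IsIntegral.isIntegral (R := ℤ) z).map (toQuadRat a b).toIntAlgHom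

/-- The ring of integers of `ℚ[ω]` is `ℤ[ω]`. -/
noncomputable def ringOfIntegersEquiv : 𝓞 (QuadRat a b) ≃+* QuadInt a b :=
  letI := (toQuadRat a b).toAlgebra
  haveI : IsIntegralClosure (QuadInt a b) ℤ (QuadRat a b) :=
    { algebraMap_injective := toQuadRat_injective a b
      isIntegral_iff := fun {_} ↦ ⟨exists_toQuadRat_eq a b, fun ⟨z, hz⟩ ↦
        hz ▸ isIntegral_toQuadRat a b z⟩ }
  RingOfIntegers.equiv (QuadInt a b)

omit hab in
lemma trace_quadInt (z : QuadInt a b) : Algebra.trace ℤ (QuadInt a b) z = 2 * z.re + b * z.im := by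
  rw [Algebra.trace_eq_matrix_trace (QuadraticAlgebra.basis a b), Matrix.trace_fin_two,
    Algebra.leftMulMatrix_eq_repr_mul, Algebra.leftMulMatrix_eq_repr_mul]
  simp [QuadraticAlgebra.basis]
  ring

omit hab in
lemma discr_quadInt : Algebra.discr ℤ (QuadraticAlgebra.basis a b) = b ^ 2 + 4 * a := by
  rw [Algebra.discr_def, Matrix.det_fin_two]
  simp only [Algebra.traceMatrix_apply, Algebra.traceForm_apply, trace_quadInt]
  simp [QuadraticAlgebra.basis]
  ring

lemma discr_quadRat : NumberField.discr (QuadRat a b) = b ^ 2 + 4 * a := by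
  let e := (ringOfIntegersEquiv a b).symm.toIntAlgEquiv
  rw [← discr_quadInt, Algebra.discr_eq_discr_of_algEquiv _ e]
  exact (NumberField.discr_eq_discr _ ((QuadraticAlgebra.basis a b).map e.toLinearEquiv)).symm

end FundamentalCoeffs

end ImaginaryQuadratic

section

open Filter Topology

section ClassNumberFormula

namespace FundamentalCoeffs

variable (a b : ℤ) [hab : FundamentalCoeffs a b]

instance : IsTotallyComplex (QuadRat a b) where
  isComplex v := by
    rw [← InfinitePlace.not_isReal_iff_isComplex]
    intro hv
    have h1 := InfinitePlace.isReal_iff.mp hv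
    set φ := v.embedding
    let w : QuadRat a b := ⟨0, 1⟩
    have hw : w * w = ((a : ℤ) : QuadRat a b) + ((b : ℤ) : QuadRat a b) * w := by
      ext <;> simp [w]
    have h2 := congrArg φ hw
    rw [map_mul, map_add, map_mul, map_intCast, map_intCast] at h2
    have h3 := ComplexEmbedding.IsReal.coe_embedding_apply h1 w
    rw [← h3] at h2
    have h4 : (h1.embedding w) * (h1.embedding w) = a + b * (h1.embedding w) := by
      exact_mod_cast h2
    have h : ((b ^ 2 + 4 * a : ℤ) : ℝ) < 0 := by exact_mod_cast hab.neg
    push_cast at h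
    nlinarith [sq_nonneg (2 * (h1.embedding w) - b)]

lemma nrComplexPlaces_quadRat : InfinitePlace.nrComplexPlaces (QuadRat a b) = 1 := by
  have h := IsTotallyComplex.finrank (K := QuadRat a b)
  have h2 : Module.finrank ℚ (QuadRat a b) = 2 := by convert finrank_quadRat a b
  omega

lemma regulator_quadRat : Units.regulator (QuadRat a b) = 1 := by
  have hcard : Fintype.card (InfinitePlace (QuadRat a b)) = 1 := by
    rw [InfinitePlace.card_eq_nrRealPlaces_add_nrComplexPlaces, nrComplexPlaces_quadRat,
      IsTotallyComplex.nrRealPlaces_eq_zero]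
  have hrank : Units.rank (QuadRat a b) = 0 := by
    rw [Units.rank, hcard]
  classical
  rw [Units.regulator_eq_regOfFamily_fundSystem, Units.regOfFamily_eq_det',
    Matrix.det_eq_one_of_card_eq_zero, abs_one]
  rw [← Fintype.card_congr (Units.equivFinRank (QuadRat a b)), Fintype.card_fin, hrank]

lemma tendsto_card_ideal_div : ∃ c : ℝ,
    c ≤ Real.pi * classNumber (QuadRat a b) / √|((b ^ 2 + 4 * a : ℤ) : ℝ)| ∧
    Tendsto (fun s : ℝ ↦
      (Nat.card {I : Ideal (𝓞 (QuadRat a b)) // (Ideal.absNorm I : ℝ) ≤ s} : ℝ) / s) atTop (𝓝 c) := by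
  refine ⟨_, ?_, NumberField.Ideal.tendsto_norm_le_div_atTop (QuadRat a b)⟩
  rw [nrComplexPlaces_quadRat, regulator_quadRat, IsTotallyComplex.nrRealPlaces_eq_zero,
    discr_quadRat]
  have hw : (2 : ℝ) ≤ Units.torsionOrder (QuadRat a b) := by
    have h1 := Units.even_torsionOrder (QuadRat a b)
    have h2 := Units.torsionOrder_ne_zero (QuadRat a b)
    have : 2 ≤ Units.torsionOrder (QuadRat a b) := Nat.le_of_dvd (by omega) h1.two_dvd
    exact_mod_cast this
  have hD : 0 < √|((b ^ 2 + 4 * a : ℤ) : ℝ)| := by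
    rw [Real.sqrt_pos, abs_pos]
    exact_mod_cast hab.neg.ne
  rw [div_le_div_iff₀ (by positivity) hD]
  have hp : 0 ≤ Real.pi * classNumber (QuadRat a b) * √|((b ^ 2 + 4 * a : ℤ) : ℝ)| := by positivity
  push_cast at hp ⊢
  nlinarith

end FundamentalCoeffs

end ClassNumberFormula

end

section

open Filter Topology
open scoped ArithmeticFunction.zeta

section IdealCount

variable {R : Type*} [CommRing R] [IsDedekindDomain R] [Module.Free ℤ R] [Module.Finite ℤ R]
  [CharZero R]

variable (R) in
/-- The number of ideals of norm `n`. -/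
noncomputable def idealCount (n : ℕ) : ℕ := Nat.card {I : Ideal R // Ideal.absNorm I = n}

lemma finite_absNorm_eq {n : ℕ} : Finite {I : Ideal R // Ideal.absNorm I = n} :=
  Set.Finite.to_subtype (Ideal.finite_setOfPred_absNorm_eq n)

omit [Module.Finite ℤ R] [CharZero R] in
lemma Ideal.mul_sup_span_natCast {I I' : Ideal R} {m n : ℕ} (hI : Ideal.absNorm I = m)
    (hI' : Ideal.absNorm I' = n) (h : m.Coprime n) : I * I' ⊔ Ideal.span {(m : R)} = I := by
  have hm : Ideal.span {(m : R)} ≤ I := by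
    rw [Ideal.span_singleton_le_iff_mem, ← hI]; exact Ideal.absNorm_mem I
  apply le_antisymm (sup_le Ideal.mul_le_left hm)
  have htop : I' ⊔ Ideal.span {(m : R)} = ⊤ := by
    rw [Ideal.eq_top_iff_one]
    have hn : (n : R) ∈ I' := by rw [← hI']; exact Ideal.absNorm_mem I'
    have hmm : (m : R) ∈ Ideal.span {(m : R)} := Ideal.mem_span_singleton_self _
    obtain ⟨u, v, huv⟩ := Nat.isCoprime_iff_coprime.mpr h
    have h1 : (1 : R) = (v : R) * n + (u : R) * m := by
      have : ((u * m + v * n : ℤ) : R) = ((1 : ℤ) : R) := by rw [huv]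
      push_cast at this
      rw [← this]; ring
    rw [h1]
    exact Ideal.add_mem _ (Ideal.mem_sup_left (Ideal.mul_mem_left _ _ hn))
      (Ideal.mem_sup_right (Ideal.mul_mem_left _ _ hmm))
  have h2 : I * (I' ⊔ Ideal.span {(m : R)}) = I := by rw [htop, Ideal.mul_top]
  rw [Ideal.mul_sup] at h2
  exact h2.ge.trans (sup_le_sup_left Ideal.mul_le_right _)

lemma idealCount_mul_le {m n : ℕ} (h : m.Coprime n) :
    idealCount R m * idealCount R n ≤ idealCount R (m * n) := by
  have := finite_absNorm_eq (R := R) (n := m * n)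
  rw [idealCount, idealCount, ← Nat.card_prod]
  refine Nat.card_le_card_of_injective (fun x ↦ ⟨x.1.1 * x.2.1, by
    rw [map_mul, x.1.2, x.2.2]⟩) ?_
  rintro ⟨⟨I, hI⟩, ⟨I', hI'⟩⟩ ⟨⟨J, hJ⟩, ⟨J', hJ'⟩⟩ hxy
  simp only [Subtype.mk.injEq] at hxy
  have h1 : I = J := by
    rw [← Ideal.mul_sup_span_natCast hI hI' h, hxy, Ideal.mul_sup_span_natCast hJ hJ' h]
  have h2 : I' = J' := by
    rw [← Ideal.mul_sup_span_natCast hI' hI h.symm, mul_comm, hxy, mul_comm,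
      Ideal.mul_sup_span_natCast hJ' hJ h.symm]
  simp [h1, h2]

omit [Module.Finite ℤ R] [CharZero R] in
lemma absNorm_ker_eq {p : ℕ} (φ : R →+* ZMod p) : Ideal.absNorm (RingHom.ker φ) = p := by
  have hs : Function.Surjective φ := ZMod.ringHom_surjective φ
  have e := RingHom.quotientKerEquivOfSurjective hs
  rw [Ideal.absNorm_apply, Submodule.cardQuot_apply]
  exact (Nat.card_congr e.toEquiv).trans (Nat.card_zmod p)

lemma one_le_idealCount {n : ℕ} (I : Ideal R) (hI : Ideal.absNorm I = n) : 1 ≤ idealCount R n := by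
  have := finite_absNorm_eq (R := R) (n := n)
  have : Nonempty {I : Ideal R // Ideal.absNorm I = n} := ⟨⟨I, hI⟩⟩
  exact Nat.card_pos

lemma one_le_idealCount_pow {p : ℕ} (φ : R →+* ZMod p) (k : ℕ) : 1 ≤ idealCount R (p ^ k) :=
  one_le_idealCount (RingHom.ker φ ^ k) (by rw [map_pow, absNorm_ker_eq])

lemma succ_le_idealCount_pow {p : ℕ} (hp : p.Prime) {φ ψ : R →+* ZMod p}
    (hker : RingHom.ker φ ≠ RingHom.ker ψ) (k : ℕ) : k + 1 ≤ idealCount R (p ^ k) := by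
  have := Fact.mk hp
  have := finite_absNorm_eq (R := R) (n := p ^ k)
  set P := RingHom.ker φ
  set Q := RingHom.ker ψ
  have hP : P.IsPrime := RingHom.ker_isPrime φ
  have hQ : Q.IsMaximal := RingHom.ker_isMaximal_of_surjective ψ (ZMod.ringHom_surjective ψ)
  have hnorm : ∀ {I : Ideal R}, Ideal.absNorm I = p → I ≠ ⊥ := fun hI h ↦ by
    rw [h, Ideal.absNorm_bot] at hI; exact hp.ne_zero hI.symm
  have hP0 := hnorm (absNorm_ker_eq φ)
  have hQ0 := hnorm (absNorm_ker_eq ψ)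
  have key : ∀ i j : ℕ, i < j → j ≤ k → P ^ i * Q ^ (k - i) ≠ P ^ j * Q ^ (k - j) := by
    intro i j hij hj heq
    obtain ⟨d, rfl⟩ : ∃ d, j = i + d := ⟨j - i, by omega⟩
    have h1 : k - i = d + (k - (i + d)) := by omega
    rw [h1, pow_add, pow_add, ← mul_assoc] at heq
    have h2 := mul_right_cancel₀ (pow_ne_zero _ hQ0) heq
    have h3 := mul_left_cancel₀ (pow_ne_zero _ hP0) h2
    have h4 : Q ^ d ≤ P := h3 ▸ Ideal.pow_le_self (by omega)
    have h5 := hP.le_of_pow_le h4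
    exact hker (hQ.eq_of_le hP.ne_top h5).symm
  have hinj : Function.Injective (fun i : Fin (k + 1) ↦
      (⟨P ^ (i : ℕ) * Q ^ (k - i), by
        rw [map_mul, map_pow, map_pow, absNorm_ker_eq, absNorm_ker_eq, ← pow_add]
        congr 1; omega⟩ : {I : Ideal R // Ideal.absNorm I = p ^ k})) := by
    intro i j hij
    simp only [Subtype.mk.injEq] at hij
    rcases lt_trichotomy i j with h | h | h
    · exact absurd hij (key i j h (by omega))
    · exact h
    · exact absurd hij.symm (key j i h (by omega))
  calc k + 1 = Nat.card (Fin (k + 1)) := (Nat.card_fin _).symm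
    _ ≤ _ := Nat.card_le_card_of_injective _ hinj

end IdealCount

section Roots

open scoped NumberTheorySymbols

variable (a b : ℤ) [hab : FundamentalCoeffs a b]

/-- The ring homomorphism `ℤ[ω] → A` given by a root of the equation of `ω`. -/
noncomputable def QuadInt.toRing {a b : ℤ} {A : Type*} [CommRing A] (x : A)
    (hx : x * x = a + b * x) : QuadInt a b →+* A :=
  (QuadraticAlgebra.lift ⟨x, by simpa [zsmul_eq_mul] using hx⟩ : QuadInt a b →ₐ[ℤ] A).toRingHom

lemma QuadInt.toRing_omega {a b : ℤ} {A : Type*} [CommRing A] (x : A)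
    (hx : x * x = a + b * x) : QuadInt.toRing x hx QuadraticAlgebra.omega = x := by
  simp [QuadInt.toRing]

lemma isFundamentalDiscriminant_of_coeffs : IsFundamentalDiscriminant (b ^ 2 + 4 * a) := by
  have h0 := hab.neg
  refine ⟨by omega, ?_⟩
  rcases hab.cases with ⟨hb, hs⟩ | ⟨hb, hs, h4⟩
  · refine Or.inl ⟨?_, hs⟩
    rw [hb]; omega
  · exact Or.inr ⟨a, by rw [hb]; ring, hs, h4⟩

lemma exists_root_of_kroneckerFun_eq_zero {p : ℕ} (hp : p.Prime)
    (h : kroneckerFun (b ^ 2 + 4 * a) p = 0) : ∃ x : ZMod p, x * x = a + b * x := by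
  have := Fact.mk hp
  have hD := isFundamentalDiscriminant_of_coeffs a b
  have hdvd : p ∣ (b ^ 2 + 4 * a).natAbs := by
    have := ((isRealCharacter_kroneckerFun hD hab.neg).eq_zero p).mp h
    rwa [Nat.Prime.coprime_iff_not_dvd hp, not_not] at this
  have hD0 : ((b : ZMod p)) ^ 2 + 4 * a = 0 := by
    have := (ZMod.intCast_zmod_eq_zero_iff_dvd (b ^ 2 + 4 * a) p).mpr (Int.natCast_dvd.mpr hdvd)
    push_cast at this
    exact this
  rcases eq_or_ne p 2 with rfl | hp2
  · have hb : b = 0 := by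
      rcases hab.cases with ⟨rfl, -⟩ | ⟨hb, -⟩
      · omega
      · exact hb
    subst hb
    refine ⟨a, ?_⟩
    clear! this
    generalize (a : ZMod 2) = y
    rw [Int.cast_zero, zero_mul, add_zero]
    revert y; decide
  · have h2 : (2 : ZMod p) ≠ 0 := by
      intro h0
      have : ((2 : ℕ) : ZMod p) = 0 := by exact_mod_cast h0
      rw [ZMod.natCast_eq_zero_iff] at this
      exact hp2 ((Nat.prime_dvd_prime_iff_eq hp Nat.prime_two).mp this)
    refine ⟨b / 2, ?_⟩
    field_simp
    linear_combination -hD0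

lemma exists_roots_of_kroneckerFun_eq_one {p : ℕ} (hp : p.Prime)
    (h : kroneckerFun (b ^ 2 + 4 * a) p = 1) :
    ∃ x y : ZMod p, x ≠ y ∧ x * x = a + b * x ∧ y * y = a + b * y := by
  have := Fact.mk hp
  have hD := isFundamentalDiscriminant_of_coeffs a b
  rcases eq_or_ne p 2 with rfl | hp2
  · have h8 := kroneckerFun_two hab.neg h
    have hb : b = 1 := by
      rcases hab.cases with ⟨hb, -⟩ | ⟨rfl, -⟩
      · exact hb
      · omega
    subst hb
    have ha : (a : ZMod 2) = 0 := by
      rw [ZMod.intCast_zmod_eq_zero_iff_dvd]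
      push_cast
      omega
    exact ⟨0, 1, zero_ne_one, by simp [ha], by simp [ha]⟩
  · have h2 : (2 : ZMod p) ≠ 0 := by
      intro h0
      have : ((2 : ℕ) : ZMod p) = 0 := by exact_mod_cast h0
      rw [ZMod.natCast_eq_zero_iff] at this
      exact hp2 ((Nat.prime_dvd_prime_iff_eq hp Nat.prime_two).mp this)
    rw [kroneckerFun_odd hD hab.neg (hp.odd_of_ne_two hp2)] at h
    obtain ⟨c, hc⟩ := ZMod.isSquare_of_jacobiSym_eq_one h
    have hc0 : c ≠ 0 := by
      rintro rfl
      rw [mul_zero, ZMod.intCast_zmod_eq_zero_iff_dvd] at hc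
      rw [← jacobiSym.legendreSym.to_jacobiSym, (legendreSym.eq_zero_iff p _).mpr
        ((ZMod.intCast_zmod_eq_zero_iff_dvd _ p).mpr hc)] at h
      exact zero_ne_one h
    push_cast at hc
    refine ⟨(b + c) / 2, (b - c) / 2, fun hxy ↦ hc0 ?_, ?_, ?_⟩
    · field_simp at hxy
      have : 2 * c = 0 := by linear_combination hxy
      exact (mul_eq_zero.mp this).resolve_left h2
    · field_simp
      linear_combination -hc
    · field_simp
      linear_combination -hc

end Roots

section IdealCountBound

variable {R : Type*} [CommRing R] [IsDedekindDomain R] [Module.Free ℤ R] [Module.Finite ℤ R]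
  [CharZero R] {a b : ℤ} [hab : FundamentalCoeffs a b] (e : R ≃+* QuadInt a b)

lemma convChar_isMultiplicative {q : ℕ} {χ : DirichletCharacter ℂ q} (hχ : χ.IsQuadratic) :
    (convChar χ).IsMultiplicative := by
  have h := isSignFunction_charFun hχ
  refine ArithmeticFunction.IsMultiplicative.mul
    ArithmeticFunction.isMultiplicative_zeta.natCast ⟨h.map_one, fun {m n} _ ↦ h.map_mul m n⟩

lemma convChar_prime_pow {q : ℕ} {χ : DirichletCharacter ℂ q} (hχ : χ.IsQuadratic) {p : ℕ}
    (hp : p.Prime) (k : ℕ) :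
    convChar χ (p ^ k) = ∑ i ∈ Finset.range (k + 1), charFun χ p ^ i := by
  have h := isSignFunction_charFun hχ
  rw [convChar, ArithmeticFunction.coe_zeta_mul_apply, Nat.sum_divisors_prime_pow hp]
  have hpow : ∀ i, charFun χ (p ^ i) = charFun χ p ^ i := fun i ↦ by
    induction i with
    | zero => simp [h.map_one]
    | succ i ih => rw [pow_succ, h.map_mul, ih, pow_succ]
  exact Finset.sum_congr rfl fun i _ ↦ hpow i

include e

omit hab [CharZero R] in
lemma absNorm_span_natCast (n : ℕ) : Ideal.absNorm (Ideal.span {(n : R)}) = n ^ 2 := by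
  have h : Module.finrank ℤ R = 2 := by
    rw [← QuadraticAlgebra.finrank_eq_two a b]
    exact (e.toAddEquiv.toIntLinearEquiv).finrank_eq
  rw [Ideal.absNorm_span_singleton]
  have := Algebra.norm_algebraMap_of_basis (Module.finBasis ℤ R) (n : ℤ)
  simp only [Fintype.card_fin, h, algebraMap_int_eq, eq_intCast, Int.cast_natCast] at this
  rw [this, Int.natAbs_pow, Int.natAbs_natCast]

lemma convChar_kroneckerChar_prime_pow_le [NeZero (b ^ 2 + 4 * a).natAbs]
    {p : ℕ} (hp : p.Prime) (k : ℕ) :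
    convChar (kroneckerChar (isFundamentalDiscriminant_of_coeffs a b) hab.neg) (p ^ k) ≤
      idealCount R (p ^ k) := by
  have hD := isFundamentalDiscriminant_of_coeffs a b
  have hX := isRealCharacter_kroneckerFun hD hab.neg
  change convChar hX.toDirichletCharacter (p ^ k) ≤ _
  rw [convChar_prime_pow hX.isQuadratic hp, hX.charFun_toDirichletCharacter hp.ne_zero]
  rcases hX.values p with h | h | h
  · obtain ⟨x, hx⟩ := exists_root_of_kroneckerFun_eq_zero a b hp h
    have := one_le_idealCount_pow ((QuadInt.toRing x hx).comp e.toRingHom) k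
    rw [h, Finset.sum_range_succ']
    simpa using this
  · obtain ⟨x, y, hxy, hx, hy⟩ := exists_roots_of_kroneckerFun_eq_one a b hp h
    have hker : RingHom.ker ((QuadInt.toRing x hx).comp e.toRingHom) ≠
        RingHom.ker ((QuadInt.toRing y hy).comp e.toRingHom) := by
      have := Fact.mk hp
      intro heq
      have h1 : e.symm (QuadraticAlgebra.omega - (x.val : QuadInt a b)) ∈
          RingHom.ker ((QuadInt.toRing x hx).comp e.toRingHom) := by
        rw [RingHom.mem_ker]
        simp [QuadInt.toRing_omega]
      rw [heq, RingHom.mem_ker] at h1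
      simp [QuadInt.toRing_omega] at h1
      exact hxy (sub_eq_zero.mp h1).symm
    have := succ_le_idealCount_pow hp hker k
    rw [h]
    simp only [Int.cast_one, one_pow, Finset.sum_const, Finset.card_range, nsmul_eq_mul, mul_one]
    exact_mod_cast this
  · rw [h]
    rcases Nat.even_or_odd' k with ⟨j, rfl | rfl⟩
    · have h1 : 1 ≤ idealCount R (p ^ (2 * j)) :=
        one_le_idealCount (Ideal.span {((p ^ j : ℕ) : R)}) (by
          rw [absNorm_span_natCast e, ← pow_mul, mul_comm])
      have h2 : ∑ i ∈ Finset.range (2 * j + 1), ((-1 : ℤ) : ℝ) ^ i = 1 := by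
        simp
      rw [h2]
      exact_mod_cast h1
    · have h2 : ∑ i ∈ Finset.range (2 * j + 1 + 1), ((-1 : ℤ) : ℝ) ^ i = 0 := by
        simp [show Even (2 * j + 1 + 1) from ⟨j + 1, by ring⟩]
      rw [h2]
      exact Nat.cast_nonneg _

lemma convChar_kroneckerChar_le [NeZero (b ^ 2 + 4 * a).natAbs] {n : ℕ} (hn : n ≠ 0) :
    convChar (kroneckerChar (isFundamentalDiscriminant_of_coeffs a b) hab.neg) n ≤
      idealCount R n := by
  have hD := isFundamentalDiscriminant_of_coeffs a b
  have hX := isRealCharacter_kroneckerFun hD hab.neg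
  have hmul := convChar_isMultiplicative hX.isQuadratic
  have hnonneg : ∀ {p : ℕ}, p.Prime → ∀ k,
      0 ≤ convChar hX.toDirichletCharacter (p ^ k) := fun {p} hp k ↦ by
    rw [convChar_prime_pow hX.isQuadratic hp, hX.charFun_toDirichletCharacter hp.ne_zero]
    rcases hX.values p with h | h | h <;> rw [h]
    · exact Finset.sum_nonneg fun i _ ↦ by positivity
    · exact Finset.sum_nonneg fun i _ ↦ by positivity
    · simp only [Int.cast_neg, Int.cast_one, neg_one_geom_sum]
      split_ifs <;> simp
  suffices h : 0 ≤ convChar hX.toDirichletCharacter n ∧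
      convChar hX.toDirichletCharacter n ≤ idealCount R n from h.2
  induction n using Nat.recOnPosPrimePosCoprime with
  | prime_pow p k hp hk => exact ⟨hnonneg hp k, convChar_kroneckerChar_prime_pow_le e hp k⟩
  | zero => exact absurd rfl hn
  | one => exact ⟨by simpa using hnonneg Nat.prime_two 0,
      pow_zero 2 ▸ convChar_kroneckerChar_prime_pow_le e Nat.prime_two 0⟩
  | coprime m n hm hn hmn ihm ihn =>
    obtain ⟨h1, h2⟩ := ihm (by omega)
    obtain ⟨h3, h4⟩ := ihn (by omega)
    rw [hmul.map_mul_of_coprime hmn]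
    refine ⟨mul_nonneg h1 h3, (mul_le_mul h2 h4 h3 (Nat.cast_nonneg _)).trans ?_⟩
    exact_mod_cast idealCount_mul_le hmn

end IdealCountBound

end

section

open Filter Topology

section ClassNumberFormula

variable (a b : ℤ) [hab : FundamentalCoeffs a b] [NeZero (b ^ 2 + 4 * a).natAbs]

lemma sum_idealCount_le {R : Type*} [CommRing R] [IsDedekindDomain R] [Module.Free ℤ R]
    [Module.Finite ℤ R] [CharZero R] {y : ℝ} (hy : 0 ≤ y) :
    ∑ n ∈ Finset.Ioc 0 ⌊y⌋₊, idealCount R n ≤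
      Nat.card {I : Ideal R // (Ideal.absNorm I : ℝ) ≤ y} := by
  have hfin (n : ℕ) := finite_absNorm_eq (R := R) (n := n)
  have : Finite {I : Ideal R // (Ideal.absNorm I : ℝ) ≤ y} := by
    refine Set.Finite.to_subtype ((Ideal.finite_setOfPred_absNorm_le (S := R) ⌊y⌋₊).subset ?_)
    exact fun I hI ↦ Nat.le_floor hI
  simp only [idealCount]
  rw [← Finset.sum_coe_sort, ← Nat.card_sigma]
  refine Nat.card_le_card_of_injective (fun x ↦ ⟨x.2.1, ?_⟩) ?_
  · rw [x.2.2]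
    exact (Nat.le_floor_iff hy).mp (Finset.mem_Ioc.mp x.1.2).2
  · rintro ⟨⟨m, hm⟩, I, hI⟩ ⟨⟨n, hn⟩, J, hJ⟩ h
    simp only [Subtype.mk.injEq] at h
    subst h
    dsimp only at hI hJ
    subst hI
    subst hJ
    rfl

/-- The upper bound in the class number formula for an imaginary quadratic field. -/
theorem realL_kroneckerChar_le_classNumber :
    realL (kroneckerChar (isFundamentalDiscriminant_of_coeffs a b) hab.neg) 0 ≤
      Real.pi * classNumber (QuadRat a b) / √|((b ^ 2 + 4 * a : ℤ) : ℝ)| := by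
  have hD := isFundamentalDiscriminant_of_coeffs a b
  have hX := isRealCharacter_kroneckerFun hD hab.neg
  obtain ⟨c, hc, hlim⟩ := FundamentalCoeffs.tendsto_card_ideal_div a b
  refine le_trans ?_ hc
  set χ := kroneckerChar hD hab.neg with hχ
  obtain ⟨n, hn⟩ := exists_kroneckerFun_eq_neg_one hD hab.neg
  have hχ1 : χ ≠ 1 := hX.toDirichletCharacter_ne_one hn
  have hχ2 : χ.IsQuadratic := hX.isQuadratic
  set K : ℝ := 7 * √((b ^ 2 + 4 * a).natAbs : ℝ)
  have hlim2 : Tendsto (fun y : ℝ ↦ K * y ^ (-(1 / 2) : ℝ)) atTop (𝓝 0) := by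
    simpa using (tendsto_rpow_neg_atTop (y := 1 / 2) (by norm_num)).const_mul K
  have h := hlim.add hlim2
  rw [add_zero] at h
  refine ge_of_tendsto h ?_
  filter_upwards [eventually_ge_atTop 1] with y hy
  have hy0 : 0 < y := by linarith
  have h1 := (abs_le.mp (abs_partialSum_zeta_mul_sub_le hχ1 hχ2 hy)).1
  have h2 : partialSum (convChar χ) y ≤
      Nat.card {I : Ideal (𝓞 (QuadRat a b)) // (Ideal.absNorm I : ℝ) ≤ y} := by
    refine le_trans ?_ (Nat.cast_le.mpr (sum_idealCount_le hy0.le))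
    rw [Nat.cast_sum]
    exact Finset.sum_le_sum fun n hn ↦ convChar_kroneckerChar_le
      (FundamentalCoeffs.ringOfIntegersEquiv a b) (Finset.mem_Ioc.mp hn).1.ne'
  have h3 : K * y ^ (-(1 / 2) : ℝ) = K * y ^ (1 / 2 : ℝ) / y := by
    rw [mul_div_assoc]
    nth_rewrite 3 [← Real.rpow_one y]
    rw [← Real.rpow_sub hy0]
    norm_num
  rw [h3, ← add_div, le_div_iff₀ hy0]
  linarith

end ClassNumberFormula

end

section

open nonZeroDivisors

section TwoTorsion

lemma Ideal.dvd_of_sq_dvd_sq {R : Type*} [CommRing R] [IsDedekindDomain R] {I J : Ideal R}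
    (hJ : J ≠ ⊥) (h : I ^ 2 ∣ J ^ 2) : I ∣ J := by
  classical
  rw [← Ideal.zero_eq_bot] at hJ
  have hJ2 : J ^ 2 ≠ 0 := pow_ne_zero 2 hJ
  have hI : I ≠ 0 := by
    rintro rfl
    rw [zero_pow two_ne_zero, zero_dvd_iff] at h
    exact hJ2 h
  rw [UniqueFactorizationMonoid.dvd_iff_normalizedFactors_le_normalizedFactors
    (pow_ne_zero 2 hI) hJ2, UniqueFactorizationMonoid.normalizedFactors_pow,
    UniqueFactorizationMonoid.normalizedFactors_pow, Multiset.le_iff_count] at h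
  rw [UniqueFactorizationMonoid.dvd_iff_normalizedFactors_le_normalizedFactors hI hJ,
    Multiset.le_iff_count]
  intro P
  have := h P
  simp only [Multiset.count_nsmul] at this
  omega

lemma Ideal.eq_of_sq_eq_sq {R : Type*} [CommRing R] [IsDedekindDomain R] {I J : Ideal R}
    (hI : I ≠ ⊥) (hJ : J ≠ ⊥) (h : I ^ 2 = J ^ 2) : I = J :=
  le_antisymm (Ideal.le_of_dvd (dvd_of_sq_dvd_sq hI h.symm.dvd))
    (Ideal.le_of_dvd (dvd_of_sq_dvd_sq hJ h.dvd))

/-- A finite abelian group of exponent dividing `2 ^ r` has at most `#G[2] ^ r` elements. -/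
lemma card_le_card_ker_pow {G : Type*} [CommGroup G] [Finite G] (r : ℕ)
    (hG : ∀ g : G, g ^ 2 ^ r = 1) : Nat.card G ≤ Nat.card {g : G // g ^ 2 = 1} ^ r := by
  induction r generalizing G with
  | zero =>
    have : Subsingleton G := ⟨fun x y ↦ by simpa using (hG x).trans (hG y).symm⟩
    simp
  | succ r ih =>
    let f : G →* G := powMonoidHom 2
    have h1 : Nat.card f.range ≤ Nat.card {g : f.range // g ^ 2 = 1} ^ r := ih fun g ↦ by
      obtain ⟨x, hx⟩ := g.2
      ext
      rw [SubgroupClass.coe_pow, ← hx, ← map_pow]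
      change (x ^ 2 ^ r) ^ 2 = 1
      rw [← pow_mul, ← pow_succ, hG]
    have h2 : Nat.card {g : f.range // g ^ 2 = 1} ≤ Nat.card {g : G // g ^ 2 = 1} :=
      Nat.card_le_card_of_injective
        (fun g ↦ ⟨g.1.1, congrArg (Subtype.val : f.range → G) g.2⟩) fun x y hxy ↦
          Subtype.ext (Subtype.ext (Subtype.mk.inj hxy))
    have h3 : Nat.card f.ker = Nat.card {g : G // g ^ 2 = 1} :=
      Nat.card_congr (Equiv.subtypeEquivRight fun g ↦ by simp [f, MonoidHom.mem_ker])
    rw [← f.ker.card_mul_index, Subgroup.index_ker, h3, pow_succ']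
    exact Nat.mul_le_mul_left _ (h1.trans (Nat.pow_le_pow_left h2 r))

end TwoTorsion

namespace FundamentalCoeffs

variable (a b : ℤ) [hab : FundamentalCoeffs a b]

instance : IsDomain (QuadInt a b) := (toQuadRat_injective a b).isDomain

instance : IsDedekindDomain (QuadInt a b) :=
  letI := (toQuadRat a b).toAlgebra
  haveI : IsIntegralClosure (QuadInt a b) ℤ (QuadRat a b) :=
    { algebraMap_injective := toQuadRat_injective a b
      isIntegral_iff := fun {_} ↦ ⟨exists_toQuadRat_eq a b, fun ⟨z, hz⟩ ↦
        hz ▸ (Algebra.IsIntegral.isIntegral (R := ℤ) z).map (toQuadRat a b).toIntAlgHom⟩ }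
  IsIntegralClosure.isDedekindDomain ℤ ℚ (QuadRat a b) (QuadInt a b)

noncomputable instance : Fintype (ClassGroup (QuadInt a b)) :=
  Fintype.ofEquiv _ (ClassGroup.mulEquiv (ringOfIntegersEquiv a b)).toEquiv

variable {a b}

lemma norm_nonneg (z : QuadInt a b) : 0 ≤ z.norm := by
  have := hab.neg
  rw [QuadraticAlgebra.norm_def]
  nlinarith [sq_nonneg (2 * z.re + b * z.im), sq_nonneg z.im]

lemma absNorm_span_singleton (z : QuadInt a b) :
    (Ideal.absNorm (Ideal.span {z}) : ℤ) = z.norm := by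
  rw [Ideal.absNorm_span_singleton, Int.natCast_natAbs, Algebra.norm_apply,
    ← QuadraticAlgebra.det_toLinearMap_eq_norm]
  rw [abs_of_nonneg]
  · rfl
  · exact (QuadraticAlgebra.det_toLinearMap_eq_norm z).symm ▸ norm_nonneg z

omit hab in
lemma intCast_dvd_iff {p : ℤ} {z : QuadInt a b} :
    (p : QuadInt a b) ∣ z ↔ p ∣ z.re ∧ p ∣ z.im := by
  constructor
  · rintro ⟨w, rfl⟩
    simp
  · rintro ⟨⟨x, hx⟩, ⟨y, hy⟩⟩
    refine ⟨⟨x, y⟩, ?_⟩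
    ext <;> simp [hx, hy]

omit hab in
/-- Primes not dividing the discriminant generate radical ideals. -/
lemma dvd_of_dvd_mul_self {p : ℤ} (hp : Prime p) (hpD : ¬ p ∣ b ^ 2 + 4 * a) {z : QuadInt a b}
    (h : (p : QuadInt a b) ∣ z * z) : (p : QuadInt a b) ∣ z := by
  rw [intCast_dvd_iff] at h ⊢
  obtain ⟨h1, h2⟩ := h
  simp only [QuadraticAlgebra.re_mul, QuadraticAlgebra.im_mul] at h1 h2
  have hv : p ∣ z.im := by
    have h3 : p ∣ (b ^ 2 + 4 * a) * z.im ^ 3 := by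
      have h4 : (b ^ 2 + 4 * a) * z.im ^ 3 = 4 * z.im * (z.re * z.re + a * z.im * z.im) +
          (b * z.im - 2 * z.re) * (z.re * z.im + z.im * z.re + b * z.im * z.im) := by ring
      rw [h4]
      exact dvd_add (h1.mul_left _) (h2.mul_left _)
    exact hp.dvd_of_dvd_pow ((hp.dvd_or_dvd h3).resolve_left hpD)
  refine ⟨hp.dvd_of_dvd_pow (n := 2) ?_, hv⟩
  have h4 : z.re ^ 2 = z.re * z.re + a * z.im * z.im - a * z.im * z.im := by ring
  rw [h4]
  exact dvd_sub h1 (hv.mul_left (a * z.im))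

/-- Every ideal class of order dividing two contains an ideal whose square is generated by a
positive integer. -/
lemma exists_ideal_sq_eq_natCast {c : ClassGroup (QuadInt a b)} (hc : c ^ 2 = 1) :
    ∃ (J : (Ideal (QuadInt a b))⁰) (k : ℕ), k ≠ 0 ∧ ClassGroup.mk0 J = c ∧
      (J : Ideal (QuadInt a b)) ^ 2 = Ideal.span {(k : QuadInt a b)} := by
  obtain ⟨I, rfl⟩ := ClassGroup.mk0_surjective c
  rw [← map_pow, ClassGroup.mk0_eq_one_iff] at hc
  obtain ⟨α, hα⟩ := hc.principal
  rw [SubmonoidClass.coe_pow, ← Ideal.span] at hα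
  set n := Ideal.absNorm (I : Ideal (QuadInt a b)) with hn
  have hI0 : (I : Ideal (QuadInt a b)) ≠ ⊥ := nonZeroDivisors.coe_ne_zero I
  have hn0 : n ≠ 0 := by rwa [hn, Ne, Ideal.absNorm_eq_zero_iff]
  have hnorm : α * star α = (n : QuadInt a b) ^ 2 := by
    rw [← QuadraticAlgebra.algebraMap_norm_eq_mul_star, ← absNorm_span_singleton, ← hα, map_pow,
      ← hn]
    simp
  by_cases hγ : (n : QuadInt a b) + α = 0
  · refine ⟨I, n, hn0, rfl, ?_⟩
    rw [hα, ← Ideal.span_singleton_neg, eq_neg_of_add_eq_zero_left hγ]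
  · have hγ' : star ((n : QuadInt a b) + α) ≠ 0 := by rwa [Ne, star_eq_zero]
    have hspan : Ideal.span {star ((n : QuadInt a b) + α)} ≠ ⊥ := by
      rwa [Ne, Ideal.span_singleton_eq_bot]
    set S : (Ideal (QuadInt a b))⁰ := ⟨_, mem_nonZeroDivisors_of_ne_zero hspan⟩ with hS
    have hstar : star (n : QuadInt a b) = n := by ext <;> simp
    have hm : α * star ((n : QuadInt a b) + α) ^ 2 =
        ((n * (n + α).norm : ℤ) : QuadInt a b) := by
      push_cast
      have h1 := QuadraticAlgebra.algebraMap_norm_eq_mul_star ((n : QuadInt a b) + α)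
      rw [algebraMap_int_eq, eq_intCast] at h1
      rw [h1, star_add, hstar]
      linear_combination (n + star α) * hnorm
    refine ⟨I * S, (n * (n + α).norm : ℤ).natAbs, ?_, ?_, ?_⟩
    · rw [Int.natAbs_ne_zero]
      refine mul_ne_zero (by exact_mod_cast hn0) ?_
      rw [← absNorm_span_singleton]
      simpa [Ideal.absNorm_eq_zero_iff] using hγ
    · rw [map_mul, mul_eq_left, ClassGroup.mk0_eq_one_iff]
      exact ⟨_, rfl⟩
    · rw [Submonoid.coe_mul, mul_pow, hα, hS, Ideal.span_singleton_pow,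
        Ideal.span_singleton_mul_span_singleton, hm]
      rcases Int.natAbs_eq (n * (n + α).norm : ℤ) with h | h
      · rw [h]; simp
      · rw [h]; simp [Ideal.span_singleton_neg]

/-- One can divide an ideal by the square part of the integer generating its square. -/
lemma exists_squarefree_of_sq_eq {J : (Ideal (QuadInt a b))⁰} {k : ℕ} (hk : k ≠ 0)
    (hJ : (J : Ideal (QuadInt a b)) ^ 2 = Ideal.span {(k : QuadInt a b)}) :
    ∃ (J' : (Ideal (QuadInt a b))⁰) (m c : ℕ), Squarefree m ∧ c ^ 2 * m = k ∧
      ClassGroup.mk0 J' = ClassGroup.mk0 J ∧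
      (J' : Ideal (QuadInt a b)) ^ 2 = Ideal.span {(m : QuadInt a b)} := by
  obtain ⟨m, c, hm0, hc0, hcm, hm⟩ := Nat.sq_mul_squarefree_of_pos (Nat.pos_of_ne_zero hk)
  have hJ0 : (J : Ideal (QuadInt a b)) ≠ ⊥ := nonZeroDivisors.coe_ne_zero J
  have hk' : (k : QuadInt a b) = (c : QuadInt a b) ^ 2 * m := by
    rw [← hcm]; push_cast; ring
  have hc : Ideal.span {(c : QuadInt a b)} ≠ ⊥ := by
    rw [Ne, Ideal.span_singleton_eq_bot]
    exact_mod_cast hc0.ne'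
  obtain ⟨J', hJ'⟩ : Ideal.span {(c : QuadInt a b)} ∣ J := by
    refine Ideal.dvd_of_sq_dvd_sq hJ0 ⟨Ideal.span {(m : QuadInt a b)}, ?_⟩
    rw [hJ, Ideal.span_singleton_pow, Ideal.span_singleton_mul_span_singleton, hk']
  have hJ'0 : J' ≠ ⊥ := by
    rintro rfl
    exact hJ0 (hJ'.trans (Ideal.mul_bot _))
  refine ⟨⟨J', mem_nonZeroDivisors_of_ne_zero hJ'0⟩, m, c, hm, hcm, ?_, ?_⟩
  · rw [ClassGroup.mk0_eq_mk0_iff]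
    exact ⟨c, 1, by exact_mod_cast hc0.ne', one_ne_zero, by simp [hJ']⟩
  · have h : Ideal.span {(c : QuadInt a b)} ^ 2 * J' ^ 2 =
        Ideal.span {(c : QuadInt a b)} ^ 2 * Ideal.span {(m : QuadInt a b)} := by
      rw [← mul_pow, ← hJ', hJ, Ideal.span_singleton_pow,
        Ideal.span_singleton_mul_span_singleton, hk']
    exact mul_left_cancel₀ (pow_ne_zero 2 hc) h

omit hab in
/-- Primes dividing the squarefree generator of the square of an ideal are ramified. -/
lemma dvd_disc_of_sq_eq {J : Ideal (QuadInt a b)} {m p : ℕ} (hm : Squarefree m) (hp : p.Prime)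
    (hpm : p ∣ m) (hJ : J ^ 2 = Ideal.span {(m : QuadInt a b)}) : (p : ℤ) ∣ b ^ 2 + 4 * a := by
  by_contra hpD
  have h1 : J ≤ Ideal.span {((p : ℤ) : QuadInt a b)} := fun x hx ↦ by
    rw [Ideal.mem_span_singleton]
    refine dvd_of_dvd_mul_self (Nat.prime_iff_prime_int.mp hp) hpD ?_
    have : x * x ∈ J ^ 2 := by rw [sq]; exact Ideal.mul_mem_mul hx hx
    rw [hJ, Ideal.mem_span_singleton] at this
    refine dvd_trans ?_ this
    exact_mod_cast (Nat.cast_dvd_cast hpm : (p : QuadInt a b) ∣ m)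
  have h2 : ((p ^ 2 : ℤ) : QuadInt a b) ∣ (m : QuadInt a b) := by
    have := Ideal.pow_right_mono h1 2
    rw [hJ, Ideal.span_singleton_pow, Ideal.span_singleton_le_span_singleton] at this
    exact_mod_cast this
  rw [intCast_dvd_iff] at h2
  have h3 : p * p ∣ m := by
    have := h2.1
    simp only [QuadraticAlgebra.re_natCast] at this
    rw [← sq]
    exact_mod_cast this
  exact hp.one_lt.ne' (Nat.isUnit_iff.mp (hm p h3))

end FundamentalCoeffs

namespace FundamentalCoeffs

variable (a b : ℤ) [hab : FundamentalCoeffs a b]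

/-- The field contains the square root of a squarefree integer with a ramified prime factor. -/
lemma exists_mul_self_eq_squarefree (h4 : b ^ 2 + 4 * a ≠ -4) :
    ∃ (θ : QuadInt a b) (d : ℤ) (s : ℕ), θ * θ = d ∧ Squarefree d ∧ s.Prime ∧ (s : ℤ) ∣ d ∧
      (s : ℤ) ∣ b ^ 2 + 4 * a := by
  have hneg := hab.neg
  rcases hab.cases with ⟨hb, hs⟩ | ⟨rfl, hs, -⟩
  · have h1 : (b ^ 2 + 4 * a).natAbs ≠ 1 := by
      rw [hb] at hneg ⊢; omega
    refine ⟨⟨-b, 2⟩, b ^ 2 + 4 * a, (b ^ 2 + 4 * a).natAbs.minFac, ?_, hs, Nat.minFac_prime h1,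
      Int.natCast_dvd.mpr (Nat.minFac_dvd _), Int.natCast_dvd.mpr (Nat.minFac_dvd _)⟩
    ext
    · rw [QuadraticAlgebra.re_intCast, Int.cast_id, QuadraticAlgebra.re_mul]
      ring
    · rw [QuadraticAlgebra.im_intCast, QuadraticAlgebra.im_mul]
      ring
  · have h1 : a.natAbs ≠ 1 := by omega
    have h2 : (a.natAbs.minFac : ℤ) ∣ a := Int.natCast_dvd.mpr (Nat.minFac_dvd _)
    refine ⟨⟨0, 1⟩, a, a.natAbs.minFac, ?_, hs, Nat.minFac_prime h1, h2, ?_⟩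
    · ext <;> simp
    · exact dvd_add (by simp) (h2.mul_left 4)

lemma not_dvd_of_sq_mul_eq {s m d c k : ℕ} (hs : s.Prime) (hm : Squarefree m) (hd : Squarefree d)
    (hk : Squarefree k) (hsm : s ∣ m) (hsd : s ∣ d) (h : c ^ 2 * k = m * d) : ¬ s ∣ k := by
  intro hsk
  have hnot {x y : ℕ} (hx : Squarefree x) (hxy : x = s * y) : ¬ s ∣ y := fun ⟨z, hz⟩ ↦
    hs.one_lt.ne' (Nat.isUnit_iff.mp (hx s ⟨z, by rw [hxy, hz, mul_assoc]⟩))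
  obtain ⟨m', hm'⟩ := hsm
  obtain ⟨d', hd'⟩ := hsd
  obtain ⟨k', hk'⟩ := hsk
  have h1 : c ^ 2 * k' = s * (m' * d') := by
    refine Nat.eq_of_mul_eq_mul_left hs.pos ?_
    calc s * (c ^ 2 * k') = c ^ 2 * k := by rw [hk']; ring
      _ = s * (s * (m' * d')) := by rw [h, hm', hd']; ring
  have h2 : s ∣ c := hs.dvd_of_dvd_pow
    ((hs.dvd_mul.mp ⟨_, h1⟩).resolve_right (hnot hk hk'))
  obtain ⟨c', rfl⟩ := h2
  have h3 : s * (c' ^ 2 * k') = m' * d' := by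
    refine Nat.eq_of_mul_eq_mul_left hs.pos ?_
    rw [← h1]; ring
  rcases hs.dvd_mul.mp ⟨_, h3.symm⟩ with h4 | h4
  · exact hnot hm hm' h4
  · exact hnot hd hd' h4

variable {a b} in
/-- Every class of order dividing two contains an ideal whose square is generated by a squarefree
integer prime to `s`. -/
lemma exists_ideal_sq_eq_not_dvd {θ : QuadInt a b} {d : ℤ} {s : ℕ} (hθ : θ * θ = d)
    (hd : Squarefree d) (hs : s.Prime) (hsd : (s : ℤ) ∣ d) {c : ClassGroup (QuadInt a b)}
    (hc : c ^ 2 = 1) :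
    ∃ (J : (Ideal (QuadInt a b))⁰) (m : ℕ), Squarefree m ∧ ¬ s ∣ m ∧ ClassGroup.mk0 J = c ∧
      (J : Ideal (QuadInt a b)) ^ 2 = Ideal.span {(m : QuadInt a b)} := by
  obtain ⟨J₀, k, hk0, rfl, hJ₀⟩ := exists_ideal_sq_eq_natCast hc
  obtain ⟨J, m, -, hm, -, hJc, hJ⟩ := exists_squarefree_of_sq_eq hk0 hJ₀
  by_cases hsm : s ∣ m
  swap
  · exact ⟨J, m, hm, hsm, hJc, hJ⟩
  have hd0 : d ≠ 0 := hd.ne_zero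
  have hθ0 : Ideal.span {θ} ≠ ⊥ := by
    rw [Ne, Ideal.span_singleton_eq_bot]
    rintro rfl
    rw [mul_zero] at hθ
    exact hd0 (by exact_mod_cast hθ.symm)
  set S : (Ideal (QuadInt a b))⁰ := ⟨_, mem_nonZeroDivisors_of_ne_zero hθ0⟩ with hS
  have hJS : ((J * S : (Ideal (QuadInt a b))⁰) : Ideal (QuadInt a b)) ^ 2 =
      Ideal.span {((m * d.natAbs : ℕ) : QuadInt a b)} := by
    rw [Submonoid.coe_mul, mul_pow, hJ, hS, Ideal.span_singleton_pow, sq, hθ,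
      Ideal.span_singleton_mul_span_singleton]
    rcases Int.natAbs_eq d with h | h
    · nth_rewrite 1 [h]; simp
    · nth_rewrite 1 [h]; simp [Ideal.span_singleton_neg]
  obtain ⟨J', m', e, hm', he, hJ'c, hJ'⟩ := exists_squarefree_of_sq_eq
    (mul_ne_zero hm.ne_zero (Int.natAbs_ne_zero.mpr hd0)) hJS
  refine ⟨J', m', hm', not_dvd_of_sq_mul_eq hs hm (Int.squarefree_natAbs.mpr hd) hm' hsm
    (Int.natCast_dvd.mp hsd) he, ?_, hJ'⟩
  rw [hJ'c, ← hJc, map_mul, mul_eq_left, ClassGroup.mk0_eq_one_iff]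
  exact ⟨_, rfl⟩

/-- Gauss' bound for the two-torsion of the class group. -/
theorem card_two_torsion_le (h4 : b ^ 2 + 4 * a ≠ -4) :
    Nat.card {c : ClassGroup (QuadInt a b) // c ^ 2 = 1} ≤
      2 ^ ((b ^ 2 + 4 * a).natAbs.primeFactors.card - 1) := by
  obtain ⟨θ, d, s, hθ, hd, hs, hsd, hsD⟩ := exists_mul_self_eq_squarefree a b h4
  have hD0 : (b ^ 2 + 4 * a).natAbs ≠ 0 := Int.natAbs_ne_zero.mpr hab.neg.ne
  have hsmem : s ∈ (b ^ 2 + 4 * a).natAbs.primeFactors :=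
    Nat.mem_primeFactors.mpr ⟨hs, Int.natCast_dvd.mp hsD, hD0⟩
  choose J m hm hsm hJc hJ using fun c : {c : ClassGroup (QuadInt a b) // c ^ 2 = 1} ↦
    exists_ideal_sq_eq_not_dvd hθ hd hs hsd c.2
  have hsub (c) : (m c).primeFactors ⊆ (b ^ 2 + 4 * a).natAbs.primeFactors.erase s := by
    intro p hp
    have hp' := Nat.mem_primeFactors.mp hp
    refine Finset.mem_erase.mpr ⟨?_, Nat.mem_primeFactors.mpr ⟨hp'.1, ?_, hD0⟩⟩
    · rintro rfl
      exact hsm c hp'.2.1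
    · exact Int.natCast_dvd.mp (dvd_disc_of_sq_eq (hm c) hp'.1 hp'.2.1 (hJ c))
  rw [← Finset.card_erase_of_mem hsmem, ← Finset.card_powerset, ← Nat.card_eq_finsetCard]
  refine Nat.card_le_card_of_injective
    (fun c ↦ ⟨(m c).primeFactors, Finset.mem_powerset.mpr (hsub c)⟩) fun x y hxy ↦ ?_
  have h1 : (m x).primeFactors = (m y).primeFactors := Subtype.mk.inj hxy
  have h2 : m x = m y := by
    rw [← Nat.prod_primeFactors_of_squarefree (hm x), h1,
      Nat.prod_primeFactors_of_squarefree (hm y)]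
  have h3 : J x = J y := Subtype.ext (Ideal.eq_of_sq_eq_sq (nonZeroDivisors.coe_ne_zero _)
    (nonZeroDivisors.coe_ne_zero _) (by rw [hJ x, hJ y, h2]))
  exact Subtype.ext (by rw [← hJc x, ← hJc y, h3])

/-- The class number is bounded in terms of the number of ramified primes if the exponent of the
class group is a power of two. -/
theorem classNumber_le_of_exponent_eq (h4 : b ^ 2 + 4 * a ≠ -4) {r : ℕ}
    (hr : Monoid.exponent (ClassGroup (𝓞 (QuadRat a b))) = 2 ^ r) :
    classNumber (QuadRat a b) ≤ 2 ^ (r * ((b ^ 2 + 4 * a).natAbs.primeFactors.card - 1)) := by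
  have e := ClassGroup.mulEquiv (ringOfIntegersEquiv a b)
  rw [Monoid.exponent_eq_of_mulEquiv e] at hr
  rw [classNumber, ← Nat.card_eq_fintype_card, Nat.card_congr e.toEquiv, mul_comm, pow_mul]
  exact (card_le_card_ker_pow r fun g ↦ hr ▸ Monoid.pow_exponent_eq_one g).trans
    (Nat.pow_le_pow_left (card_two_torsion_le a b h4) r)

end FundamentalCoeffs

end

section Primorial

lemma primesProd_pos (n : ℕ) : 0 < primesProd n :=
  Finset.prod_pos fun i _ ↦ (Nat.prime_nth_prime i).pos

lemma primesProd_succ (n : ℕ) : primesProd (n + 1) = primesProd n * Nat.nth Nat.Prime n :=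
  Finset.prod_range_succ _ _

lemma primesProd_mono : Monotone primesProd := monotone_nat_of_le_succ fun n ↦ by
  rw [primesProd_succ]
  exact Nat.le_mul_of_pos_right _ (Nat.prime_nth_prime n).pos

/-- The product of `n` distinct primes is at least the product of the first `n` primes. -/
lemma primesProd_card_le (S : Finset ℕ) (hS : ∀ p ∈ S, p.Prime) :
    primesProd S.card ≤ ∏ p ∈ S, p := by
  induction S using Finset.induction_on_max with
  | empty => simp [primesProd]
  | insert m S hm ih =>
    have hmS : m ∉ S := fun h ↦ (hm m h).false
    rw [Finset.card_insert_of_notMem hmS, Finset.prod_insert hmS, primesProd_succ, mul_comm]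
    refine Nat.mul_le_mul ?_ (ih fun p hp ↦ hS p (Finset.mem_insert_of_mem hp))
    refine Nat.lt_succ_iff.mp (Nat.nth_lt_of_lt_count ?_)
    rw [Nat.count_eq_card_filter_range, ← Nat.add_one_le_iff,
      ← Finset.card_insert_of_notMem hmS]
    refine Finset.card_le_card fun p hp ↦ Finset.mem_filter.mpr ⟨?_, hS p hp⟩
    rw [Finset.mem_range, Nat.lt_succ_iff]
    rcases Finset.mem_insert.mp hp with rfl | hp
    · exact le_rfl
    · exact (hm p hp).le

lemma two_mul_primesProd_le {D : ℤ} (hD : IsFundamentalDiscriminant D)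
    (hn : 2 ≤ D.natAbs.primeFactors.card) :
    2 * primesProd D.natAbs.primeFactors.card ≤ D.natAbs := by
  have hprime : ∀ p ∈ D.natAbs.primeFactors, p.Prime := fun p hp ↦
    Nat.prime_of_mem_primeFactors hp
  rcases hD.2 with ⟨h, hs⟩ | ⟨m, hm, hs, -⟩
  · have h2 : 2 ∉ D.natAbs.primeFactors := fun h2 ↦ by
      have := Nat.dvd_of_mem_primeFactors h2
      omega
    have h3 := primesProd_card_le (insert 2 D.natAbs.primeFactors) fun p hp ↦ by
      rcases Finset.mem_insert.mp hp with rfl | hp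
      · exact Nat.prime_two
      · exact hprime p hp
    rw [Finset.card_insert_of_notMem h2, Finset.prod_insert h2, primesProd_succ,
      Nat.prod_primeFactors_of_squarefree (Int.squarefree_natAbs.mpr hs)] at h3
    have h4 := Nat.add_two_le_nth_prime D.natAbs.primeFactors.card
    have h5 := Nat.mul_le_mul_left (primesProd D.natAbs.primeFactors.card)
      (show 4 ≤ Nat.nth Nat.Prime D.natAbs.primeFactors.card by omega)
    omega
  · have hm0 := Int.natAbs_ne_zero.mpr hs.ne_zero
    have h1 : D.natAbs = 2 * (2 * m.natAbs) := by omega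
    have h2 : D.natAbs.primeFactors = (2 * m.natAbs).primeFactors := by
      rw [h1, Nat.primeFactors_mul two_ne_zero (by omega), Nat.primeFactors_mul two_ne_zero hm0,
        ← Finset.union_assoc, Finset.union_self]
    have h3 : ∏ p ∈ D.natAbs.primeFactors, p ≤ 2 * m.natAbs := by
      rw [h2]
      exact Nat.le_of_dvd (by omega) (Nat.prod_primeFactors_dvd _)
    have h4 := primesProd_card_le _ hprime
    omega

lemma pow_mul_primesProd_rpow_le {x δ : ℝ} (hx : 0 ≤ x) (hδ : 0 ≤ δ) {N n : ℕ} (hNn : N ≤ n)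
    (h : x ≤ (Nat.nth Nat.Prime (N - 1) : ℝ) ^ δ) :
    x ^ (n - N) * (primesProd N : ℝ) ^ δ ≤ (primesProd n : ℝ) ^ δ := by
  induction n, hNn using Nat.le_induction with
  | base => simp
  | succ n hn ih =>
    have h1 : x ≤ (Nat.nth Nat.Prime n : ℝ) ^ δ := h.trans
      (Real.rpow_le_rpow (Nat.cast_nonneg _) (Nat.cast_le.mpr
        (Nat.nth_monotone Nat.infinite_setOfPred_prime (by omega))) hδ)
    rw [Nat.sub_add_comm hn, pow_succ', primesProd_succ, Nat.cast_mul,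
      Real.mul_rpow (Nat.cast_nonneg _) (Nat.cast_nonneg _), mul_assoc, mul_comm]
    exact mul_le_mul ih h1 hx (by positivity)

lemma nth_prime_values : Nat.nth Nat.Prime 5 = 13 ∧ Nat.nth Nat.Prime 6 = 17 ∧
    Nat.nth Nat.Prime 7 = 19 ∧ Nat.nth Nat.Prime 8 = 23 ∧ Nat.nth Nat.Prime 9 = 29 ∧
    Nat.nth Nat.Prime 10 = 31 :=
  ⟨Nat.nth_count (p := Nat.Prime) (n := 13) (by norm_num),
    Nat.nth_count (p := Nat.Prime) (n := 17) (by norm_num),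
    Nat.nth_count (p := Nat.Prime) (n := 19) (by norm_num),
    Nat.nth_count (p := Nat.Prime) (n := 23) (by norm_num),
    Nat.nth_count (p := Nat.Prime) (n := 29) (by norm_num),
    Nat.nth_count (p := Nat.Prime) (n := 31) (by norm_num)⟩

lemma primesProd_values : primesProd 6 = 30030 ∧ primesProd 7 = 510510 ∧
    primesProd 8 = 9699690 ∧ primesProd 9 = 223092870 ∧ primesProd 10 = 6469693230 ∧
    primesProd 11 = 200560490130 := by
  obtain ⟨h5, h6, h7, h8, h9, h10⟩ := nth_prime_values
  simp [primesProd, Finset.prod_range_succ, h5, h6, h7, h8, h9, h10]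

end Primorial

section Numerics

lemma eleven_le_of_le {r N : ℕ} (hr : 1 ≤ r) (h1 : Real.exp 11.2 ≤ (primesProd N : ℝ))
    (h3 : (2 : ℝ) ^ (r * (N - 1)) ≤
      0.655 / (Real.pi * Real.exp 1) *
        (Real.sqrt (primesProd N) / Real.log (primesProd N))) : 11 ≤ N := by
  obtain ⟨p6, p7, p8, p9, p10, -⟩ := primesProd_values
  have hN7 : 7 ≤ N := by
    by_contra! hN
    have h : (primesProd N : ℝ) ≤ 30030 := by
      exact_mod_cast p6 ▸ primesProd_mono (show N ≤ 6 by omega)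
    have h4 := pow_le_exp_of_le (n := 11) (t := 11.2) (by norm_num)
    have h5 : (30030 : ℝ) < 2.7 ^ 11 := by norm_num
    linarith
  have hd0 : (0 : ℝ) < primesProd N := Nat.cast_pos.mpr (primesProd_pos N)
  have hlog : 11 ≤ Real.log (primesProd N) := by
    have := (Real.le_log_iff_exp_le hd0).mpr h1
    linarith
  have key {t : ℝ} (ht : 0 < t) (hlog : t ≤ Real.log (primesProd N)) {m : ℕ} (hm : N = m) {S : ℝ}
      (hS0 : 0 ≤ S) (hS : (primesProd m : ℝ) ≤ S ^ 2) (h : 0.08 * S < t * 2 ^ (m - 1)) :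
      False := by
    subst hm
    have hpi : (8.2 : ℝ) ≤ Real.pi * Real.exp 1 := by
      have h1 := Real.pi_gt_d2
      have h2 := Real.exp_one_gt_d9
      nlinarith
    have hs : √(primesProd N : ℝ) ≤ S := Real.sqrt_le_iff.mpr ⟨hS0, hS⟩
    have h4 : (2 : ℝ) ^ (N - 1) ≤ 2 ^ (r * (N - 1)) :=
      pow_le_pow_right₀ one_le_two (Nat.le_mul_of_pos_left _ hr)
    have h5 : 0.655 / (Real.pi * Real.exp 1) ≤ 0.08 := by
      rw [div_le_iff₀ (by linarith)]; linarith
    have h6 : √(primesProd N : ℝ) / Real.log (primesProd N) ≤ S / t :=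
      div_le_div₀ hS0 hs ht hlog
    have h7 : (2 : ℝ) ^ (N - 1) ≤ 0.08 * (S / t) :=
      h4.trans (h3.trans (mul_le_mul h5 h6 (by positivity) (by norm_num)))
    rw [← mul_div_assoc, le_div_iff₀ ht] at h7
    linarith
  by_contra! hN
  obtain rfl | rfl | rfl | rfl : N = 7 ∨ N = 8 ∨ N = 9 ∨ N = 10 := by omega
  · exact key (by norm_num) hlog rfl (S := 715) (by norm_num) (by rw [p7]; norm_num) (by norm_num)
  · exact key (by norm_num) hlog rfl (S := 3115) (by norm_num) (by rw [p8]; norm_num) (by norm_num)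
  · exact key (by norm_num) hlog rfl (S := 14937) (by norm_num) (by rw [p9]; norm_num) (by norm_num)
  · refine key (t := 15) (by norm_num) ?_ rfl (S := 80435) (by norm_num) (by rw [p10]; norm_num)
      (by norm_num)
    rw [Real.le_log_iff_exp_le hd0, p10]
    have h : Real.exp 15 = Real.exp 1 ^ 15 := by rw [← Real.exp_nat_mul]; norm_num
    rw [h]
    exact (pow_le_pow_left₀ (Real.exp_pos 1).le Real.exp_one_lt_d9.le 15).trans (by norm_num)

lemma twentySix_le_log_primesProd {N : ℕ} (hN : 11 ≤ N) : 26 ≤ Real.log (primesProd N) := by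
  rw [Real.le_log_iff_exp_le (Nat.cast_pos.mpr (primesProd_pos N))]
  refine le_trans ?_ (Nat.cast_le.mpr (primesProd_mono hN))
  rw [primesProd_values.2.2.2.2.2]
  have h : Real.exp 26 = Real.exp 1 ^ 26 := by rw [← Real.exp_nat_mul]; norm_num
  rw [h]
  exact (pow_le_pow_left₀ (Real.exp_pos 1).le Real.exp_one_lt_d9.le 26).trans (by norm_num)

lemma le_mul_two_rpow {ℓ : ℝ} (hℓ : 26 ≤ ℓ) : 0.655 ≤ 0.4757 * (2 : ℝ) ^ (1 / 2 - 1 / ℓ) := by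
  have h1 : (6 / 13 : ℝ) ≤ 1 / 2 - 1 / ℓ := by
    have : 1 / ℓ ≤ 1 / 26 := one_div_le_one_div_of_le (by norm_num) hℓ
    linarith
  have h2 : (0.655 / 0.4757 : ℝ) ≤ 2 ^ (6 / 13 : ℝ) := by
    refine le_of_pow_le_pow_left₀ (n := 13) (by norm_num) (by positivity) ?_
    rw [← Real.rpow_mul_natCast zero_le_two]
    norm_num
  have h3 := h2.trans (Real.rpow_le_rpow_of_exponent_le one_le_two h1)
  rw [div_le_iff₀ (by norm_num)] at h3
  linarith

/-- If the class number is small compared with the discriminant, then so is the value at one of the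
`L`-function. -/
lemma realL_le_of_exponent_eq {r N : ℕ} (hr : 1 ≤ r) (hN : 11 ≤ N)
    (h2 : (2 : ℝ) ^ r ≤
      (Nat.nth Nat.Prime (N - 1) : ℝ) ^ ((1 : ℝ) / 2 - 1 / Real.log (primesProd N)))
    (h3 : (2 : ℝ) ^ (r * (N - 1)) ≤
      0.655 / (Real.pi * Real.exp 1) *
        (Real.sqrt (primesProd N) / Real.log (primesProd N)))
    (a b : ℤ) [hab : FundamentalCoeffs a b] [NeZero (b ^ 2 + 4 * a).natAbs]
    (hq : primesProd N ≤ (b ^ 2 + 4 * a).natAbs)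
    (hexp : Monoid.exponent (ClassGroup (𝓞 (QuadRat a b))) = 2 ^ r) :
    realL (kroneckerChar (isFundamentalDiscriminant_of_coeffs a b) hab.neg) 0 ≤
      0.4757 / Real.log (primesProd N) *
        Real.exp (-(Real.log (b ^ 2 + 4 * a).natAbs / Real.log (primesProd N))) := by
  have hℓ := twentySix_le_log_primesProd hN
  have hd0 : (0 : ℝ) < primesProd N := Nat.cast_pos.mpr (primesProd_pos N)
  have hd26 : 26 ≤ primesProd N := by
    have := primesProd_mono hN
    rw [primesProd_values.2.2.2.2.2] at this
    omega
  have hq0 : (0 : ℝ) < (b ^ 2 + 4 * a).natAbs := Nat.cast_pos.mpr (by omega)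
  have hh := FundamentalCoeffs.classNumber_le_of_exponent_eq a b (by omega) hexp
  refine (realL_kroneckerChar_le_classNumber a b).trans ?_
  rw [← Int.cast_abs, Int.abs_eq_natAbs, Int.cast_natCast]
  set ℓ := Real.log (primesProd N) with hℓdef
  set q := (b ^ 2 + 4 * a).natAbs
  set n := q.primeFactors.card with hn
  set δ : ℝ := 1 / 2 - 1 / ℓ with hδ
  have hδ0 : 0 ≤ δ := by
    have : 1 / ℓ ≤ 1 / 26 := one_div_le_one_div_of_le (by norm_num) hℓ
    rw [hδ]; linarith
  have hℓ0 : 0 < ℓ := by linarith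
  have hqδ : √(q : ℝ) * Real.exp (-(Real.log q / ℓ)) = (q : ℝ) ^ δ := by
    rw [Real.sqrt_eq_rpow, Real.rpow_def_of_pos hq0, Real.rpow_def_of_pos hq0, ← Real.exp_add, hδ]
    ring_nf
  have hdδ : √(primesProd N : ℝ) = Real.exp 1 * (primesProd N : ℝ) ^ δ := by
    rw [Real.sqrt_eq_rpow, Real.rpow_def_of_pos hd0, Real.rpow_def_of_pos hd0, ← Real.exp_add, hδ,
      ← hℓdef]
    congr 1
    field_simp
    ring
  have hpi := Real.pi_pos
  have he := Real.exp_pos 1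
  have h3' : Real.pi * ℓ * 2 ^ (r * (N - 1)) ≤ 0.655 * (primesProd N : ℝ) ^ δ := by
    refine (mul_le_mul_of_nonneg_left h3 (by positivity)).trans_eq ?_
    rw [hdδ]
    field_simp
  suffices h : Real.pi * ℓ * 2 ^ (r * (n - 1)) ≤ 0.4757 * (q : ℝ) ^ δ by
    rw [div_le_iff₀ (Real.sqrt_pos.mpr hq0), mul_assoc, mul_comm _ √(q : ℝ), hqδ,
      div_mul_eq_mul_div, le_div_iff₀ hℓ0]
    refine le_trans ?_ h
    have hh' : (classNumber (QuadRat a b) : ℝ) ≤ 2 ^ (r * (n - 1)) := by exact_mod_cast hh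
    rw [mul_right_comm]
    exact mul_le_mul_of_nonneg_left hh' (by positivity)
  rcases lt_or_ge n N with hnN | hnN
  · have h4 : (2 : ℝ) ^ (r * (n - 1)) * 2 ≤ 2 ^ (r * (N - 1)) := by
      rw [← pow_succ]
      refine pow_le_pow_right₀ one_le_two ?_
      have : n - 1 + 1 ≤ N - 1 := by omega
      nlinarith [Nat.mul_le_mul_left r this]
    have h5 : (primesProd N : ℝ) ^ δ ≤ (q : ℝ) ^ δ :=
      Real.rpow_le_rpow hd0.le (Nat.cast_le.mpr hq) hδ0
    have h6 := mul_le_mul_of_nonneg_left h4 (show 0 ≤ Real.pi * ℓ by positivity)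
    have h7 : 0 ≤ (q : ℝ) ^ δ := by positivity
    linarith
  · have h4 : (2 : ℝ) ^ (r * (n - 1)) = (2 ^ r) ^ (n - N) * 2 ^ (r * (N - 1)) := by
      rw [← pow_mul, ← pow_add, ← mul_add]
      congr 2
      omega
    have h5 := pow_mul_primesProd_rpow_le (by positivity) hδ0 hnN h2
    have h6 : 2 ^ δ * (primesProd n : ℝ) ^ δ ≤ (q : ℝ) ^ δ := by
      rw [← Real.mul_rpow zero_le_two (Nat.cast_nonneg _)]
      refine Real.rpow_le_rpow (by positivity) ?_ hδ0
      exact_mod_cast two_mul_primesProd_le (isFundamentalDiscriminant_of_coeffs a b)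
        (show 2 ≤ n by omega)
    have h7 : (0 : ℝ) ≤ (primesProd n : ℝ) ^ δ := by positivity
    calc Real.pi * ℓ * 2 ^ (r * (n - 1))
        = (2 ^ r) ^ (n - N) * (Real.pi * ℓ * 2 ^ (r * (N - 1))) := by rw [h4]; ring
      _ ≤ (2 ^ r) ^ (n - N) * (0.655 * (primesProd N : ℝ) ^ δ) :=
        mul_le_mul_of_nonneg_left h3' (by positivity)
      _ = 0.655 * ((2 ^ r) ^ (n - N) * (primesProd N : ℝ) ^ δ) := by ring
      _ ≤ 0.655 * (primesProd n : ℝ) ^ δ := mul_le_mul_of_nonneg_left h5 (by norm_num)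
      _ ≤ 0.4757 * 2 ^ δ * (primesProd n : ℝ) ^ δ :=
        mul_le_mul_of_nonneg_right (le_mul_two_rpow hℓ) h7
      _ = 0.4757 * (2 ^ δ * (primesProd n : ℝ) ^ δ) := by ring
      _ ≤ 0.4757 * (q : ℝ) ^ δ := mul_le_mul_of_nonneg_left h6 (by norm_num)

end Numerics

/-- Let `r ≥ 1` and let `N ≥ 1` satisfy `d_N ≥ e^{11.2}`,
`p_N^{1/2 − 1/log d_N} ≥ 2^r` and `(0.655/(π e))·√d_N/log d_N ≥ 2^{r(N−1)}`.
Then there is at most one fundamental discriminant `D < 0` with `|D| ≥ d_N` whose class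
group has exponent `2^r`. -/
theorem at_most_one_exponent_two_pow
    (r : ℕ) (hr : 1 ≤ r) (N : ℕ) (hN : 1 ≤ N)
    (h1 : Real.exp 11.2 ≤ (primesProd N : ℝ))
    (h2 : (2 : ℝ) ^ r ≤
      (Nat.nth Nat.Prime (N - 1) : ℝ) ^ ((1 : ℝ) / 2 - 1 / Real.log (primesProd N)))
    (h3 : (2 : ℝ) ^ (r * (N - 1)) ≤
      0.655 / (Real.pi * Real.exp 1) *
        (Real.sqrt (primesProd N) / Real.log (primesProd N))) :
    {D : ℤ | IsFundamentalDiscriminant D ∧ D < 0 ∧ (primesProd N : ℝ) ≤ |(D : ℝ)| ∧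
      ∀ (K : Type) [Field K] [NumberField K], Module.finrank ℚ K = 2 →
        NumberField.discr K = D →
          Monoid.exponent (ClassGroup (𝓞 K)) = 2 ^ r}.Subsingleton := by
  have hN11 := eleven_le_of_le hr h1 h3
  have hbound {D : ℤ} (hD : IsFundamentalDiscriminant D) (hD0 : D < 0)
      (hq : primesProd N ≤ D.natAbs)
      (hexp : ∀ (K : Type) [Field K] [NumberField K], Module.finrank ℚ K = 2 →
        NumberField.discr K = D → Monoid.exponent (ClassGroup (𝓞 K)) = 2 ^ r)
      [NeZero D.natAbs] : realL (kroneckerChar hD hD0) 0 ≤ 0.4757 / Real.log (primesProd N) *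
        Real.exp (-(Real.log D.natAbs / Real.log (primesProd N))) := by
    obtain ⟨a, b, hab, rfl⟩ := exists_fundamentalCoeffs hD hD0
    exact realL_le_of_exponent_eq hr hN11 h2 h3 a b hq (hexp (QuadRat a b)
      (by convert FundamentalCoeffs.finrank_quadRat a b) (FundamentalCoeffs.discr_quadRat a b))
  rintro D₁ ⟨hD₁, hneg₁, hq₁, hexp₁⟩ D₂ ⟨hD₂, hneg₂, hq₂, hexp₂⟩
  by_contra hne
  have hnat {D : ℤ} (h : (primesProd N : ℝ) ≤ |(D : ℝ)|) : primesProd N ≤ D.natAbs := by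
    rw [← Int.cast_abs, Int.abs_eq_natAbs, Int.cast_natCast] at h
    exact_mod_cast h
  have hlog {D : ℤ} (h : (primesProd N : ℝ) ≤ |(D : ℝ)|) :
      Real.log (primesProd N) ≤ Real.log D.natAbs :=
    Real.log_le_log (Nat.cast_pos.mpr (primesProd_pos N)) (Nat.cast_le.mpr (hnat h))
  have : NeZero D₁.natAbs := ⟨Int.natAbs_ne_zero.mpr hneg₁.ne⟩
  have : NeZero D₂.natAbs := ⟨Int.natAbs_ne_zero.mpr hneg₂.ne⟩
  exact not_both_realL_kroneckerChar_small hD₁ hD₂ hneg₁ hneg₂ hne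
    (twentySix_le_log_primesProd hN11) (hlog hq₁) (hlog hq₂)
    (hbound hD₁ hneg₁ (hnat hq₁) hexp₁) (hbound hD₂ hneg₂ (hnat hq₂) hexp₂)
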